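/- Assume in addition that f₊ ∈ C⁴([0,l₊]) and |f₊'''(x)| ≤ δ₃ x^{λ−1} on [0,l₊]. Let 0 < M₁ ≤ M₂ be any constants. Suppose (Q, Q₊) and (Q̂, Q̂₊) are two pairs, each consisting of a boundary speed in C([0,l₊]) with values in [c_*, q_max) and a weak solution of the sonic–supersonic problem with that data satisfying the compatibility condition (Q₊(x) = A₊⁻¹(Q(Φ₊(x), m)), and correspondingly for the hatted pair with its own map Φ̂₊ and extent ζ̂₊), and suppose both Q and Q̂ satisfy, almost everywhere on their respective domains, the bounds −M₂φ^{λ+2} ≤ Q ≤ −M₁φ^{λ+2}, −M₂φ^{λ+1} ≤ Q_φ ≤ −M₁φ^{λ+1}, |Q_ψ| ≤ M₂φ^{3λ/2+1}. Then the two solutions coincide: Q = Q̂ on [0, min(ζ₊, ζ̂₊)]×[0,m], Q₊ = Q̂₊ on [0,l₊], and hence ζ₊ = ζ̂₊ and Q = Q̂ everywhere. -/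

import Mathlib

open Real Set MeasureTheory Filter

noncomputable section

/-- The density function `ρ(t) = (1 − ((γ−1)/2) t)^{1/(γ−1)}`. -/
def rhoF (γ t : ℝ) : ℝ := (1 - (γ - 1) / 2 * t) ^ ((1 : ℝ) / (γ - 1))

/-- The critical (sonic) speed `c_* = (2/(γ+1))^{1/2}`. -/
def cstar (γ : ℝ) : ℝ := Real.sqrt (2 / (γ + 1))

/-- The maximal speed `q_max = (2/(γ−1))^{1/2}`. -/
def qmaxF (γ : ℝ) : ℝ := Real.sqrt (2 / (γ - 1))

/-- `A(q) = ∫_{c_*}^q (ρ(s²)+2s²ρ'(s²))/(s ρ(s²)²) ds`. -/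
def Afun (γ q : ℝ) : ℝ :=
  ∫ s in (cstar γ)..q,
    (rhoF γ (s ^ 2) + 2 * s ^ 2 * deriv (rhoF γ) (s ^ 2)) / (s * (rhoF γ (s ^ 2)) ^ 2)

/-- `B(q) = ∫_{c_*}^q ρ(s²)/s ds`. -/
def Bfun (γ q : ℝ) : ℝ := ∫ s in (cstar γ)..q, rhoF γ (s ^ 2) / s

/-- Inverse of `A` restricted to `[c_*, q_max)`. -/
def AplusInv (γ : ℝ) : ℝ → ℝ := Function.invFunOn (Afun γ) (Ico (cstar γ) (qmaxF γ))

/-- `K(s) = B(A₊⁻¹(s))`. -/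
def Kfun (γ s : ℝ) : ℝ := Bfun γ (AplusInv γ s)

/-- `b(s) = −K'(s)`. -/
def bfun (γ s : ℝ) : ℝ := -deriv (Kfun γ) s

/-- `p(s) = −K''(s)`. -/
def pfun (γ s : ℝ) : ℝ := -deriv (deriv (Kfun γ)) s

/-- Partial derivative in the first (potential) variable. -/
def pdx (u : ℝ × ℝ → ℝ) (p : ℝ × ℝ) : ℝ := deriv (fun x => u (x, p.2)) p.1

/-- Partial derivative in the second (stream) variable. -/
def pdy (u : ℝ × ℝ → ℝ) (p : ℝ × ℝ) : ℝ := deriv (fun y => u (p.1, y)) p.2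

/-- The Chaplygin equation (⋆) at a point. -/
def chap (γ : ℝ) (q : ℝ × ℝ → ℝ) (p : ℝ × ℝ) : Prop :=
  pdx (pdx fun z => Afun γ (q z)) p + pdy (pdy fun z => Bfun γ (q z)) p = 0

/-- Flow angle on the upper wall of the divergent part. -/
def ThP (f : ℝ → ℝ) (x : ℝ) : ℝ := Real.arctan (deriv f x)

/-- The potential on the upper wall: `Φ₊(x) = ∫₀ˣ Q₊(s)/cos Θ₊(s) ds`. -/
def PhiP (f Qp : ℝ → ℝ) (x : ℝ) : ℝ := ∫ s in (0 : ℝ)..x, Qp s / Real.cos (ThP f s)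

/-- The potential extent `ζ₊ = Φ₊(l₊)`. -/
def zetaP (f Qp : ℝ → ℝ) (l : ℝ) : ℝ := PhiP f Qp l

/-- `X₊ = Φ₊⁻¹`. -/
def XP (f Qp : ℝ → ℝ) (l : ℝ) : ℝ → ℝ := Function.invFunOn (PhiP f Qp) (Icc 0 l)

/-- The geometric hypotheses on the divergent part of the nozzle wall. -/
def NozzlePlus (lamp δ1 δ2 l : ℝ) (f : ℝ → ℝ) : Prop :=
  ContDiff ℝ 3 f ∧ (∀ x ∈ Icc (0 : ℝ) l, 0 < f x) ∧ deriv f 0 = 0 ∧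
  (∀ x ∈ Icc (0 : ℝ) l,
    δ1 * x ^ lamp ≤ deriv (deriv f) x ∧ deriv (deriv f) x ≤ δ2 * x ^ lamp ∧
    0 ≤ deriv (deriv (deriv f)) x)

/-- A weak solution of the sonic–supersonic problem with boundary speed `Q₊`. -/
def SupersonicWeakSol (γ m l : ℝ) (f Qp : ℝ → ℝ) (Q : ℝ × ℝ → ℝ) : Prop :=
  (∃ L : NNReal, LipschitzOnWith L Q (Icc 0 (zetaP f Qp l) ×ˢ Icc 0 m)) ∧
  (∀ p ∈ Icc (0 : ℝ) (zetaP f Qp l) ×ˢ Icc (0 : ℝ) m, Q p ≤ 0) ∧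
  (∀ ψ ∈ Ioo (0 : ℝ) m, Q (0, ψ) = 0) ∧
  ∀ ξ : ℝ × ℝ → ℝ, ContDiff ℝ 1 ξ →
    (∀ ψ ∈ Ioo (0 : ℝ) m, ξ (zetaP f Qp l, ψ) = 0) →
    (∫ p in Ioo (0 : ℝ) (zetaP f Qp l) ×ˢ Ioo (0 : ℝ) m,
        (pdx Q p * pdx ξ p - bfun γ (Q p) * pdy Q p * pdy ξ p))
    - (∫ φ in Ioo (0 : ℝ) (zetaP f Qp l),
        deriv (ThP f) (XP f Qp l φ) * Real.cos (ThP f (XP f Qp l φ)) /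
          AplusInv γ (Q (φ, m)) * ξ (φ, m)) = 0

/-- uniqueness of the sonic–supersonic flow in the class of weak
solutions with the natural decay rates at the sonic curve (Theorem
`uu-theorem` / `theoremm4`). -/

def xF (γ q : ℝ) : ℝ := 1 - (γ - 1) / 2 * q ^ 2

lemma cstar_pos {γ : ℝ} (hγ : 1 < γ) : 0 < cstar γ := by
  unfold cstar; apply Real.sqrt_pos.2; have : 0 < γ + 1 := by linarith
  positivity

lemma cstar_sq {γ : ℝ} (hγ : 1 < γ) : cstar γ ^ 2 = 2 / (γ + 1) := by
  unfold cstar; apply Real.sq_sqrt; have : 0 < γ + 1 := by linarith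
  positivity

lemma qmax_sq {γ : ℝ} (hγ : 1 < γ) : qmaxF γ ^ 2 = 2 / (γ - 1) := by
  unfold qmaxF; apply Real.sq_sqrt; have : 0 < γ - 1 := by linarith
  positivity

lemma cstar_lt_qmax {γ : ℝ} (hγ : 1 < γ) : cstar γ < qmaxF γ := by
  unfold cstar qmaxF
  have : 0 < γ - 1 := by linarith
  apply Real.sqrt_lt_sqrt (by positivity)
  apply div_lt_div_of_pos_left <;> linarith

lemma xF_pos {γ q : ℝ} (hγ : 1 < γ) (h0 : 0 < q) (hq : q < qmaxF γ) : 0 < xF γ q := by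
  unfold xF
  have h1 : 0 < γ - 1 := by linarith
  have h2 : q ^ 2 < 2 / (γ - 1) := by
    rw [← qmax_sq hγ]; nlinarith
  rw [lt_div_iff₀ h1] at h2
  linarith

lemma xF_continuous (γ : ℝ) : Continuous (xF γ) := by unfold xF; fun_prop

/-- the auxiliary kernel `κ` with `A' = -(q - c_*) κ(q)` -/
def kapF (γ q : ℝ) : ℝ := (γ + 1) / 2 * (q + cstar γ) * xF γ q ^ (-(1 / (γ - 1) + 1)) / q

def betF (γ q : ℝ) : ℝ := xF γ q ^ (1 / (γ - 1)) / q

def nuF (γ q : ℝ) : ℝ := xF γ q ^ (2 * (1 / (γ - 1)) + 1) * (2 / ((γ + 1) * (q + cstar γ)))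

lemma kap_pos {γ q : ℝ} (hγ : 1 < γ) (h0 : 0 < q) (hq : q < qmaxF γ) : 0 < kapF γ q := by
  have := xF_pos hγ h0 hq
  have := cstar_pos hγ
  unfold kapF; positivity

lemma bet_pos {γ q : ℝ} (hγ : 1 < γ) (h0 : 0 < q) (hq : q < qmaxF γ) : 0 < betF γ q := by
  have := xF_pos hγ h0 hq
  unfold betF; positivity

lemma nu_pos {γ q : ℝ} (hγ : 1 < γ) (h0 : 0 < q) (hq : q < qmaxF γ) : 0 < nuF γ q := by
  have := xF_pos hγ h0 hq
  have := cstar_pos hγ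
  unfold nuF; positivity

lemma nu_eq {γ q : ℝ} (hγ : 1 < γ) (h0 : 0 < q) (hq : q < qmaxF γ) :
    betF γ q / kapF γ q = nuF γ q := by
  have hx := xF_pos hγ h0 hq
  have := cstar_pos hγ
  unfold betF kapF nuF
  have e : xF γ q ^ (2 * (1 / (γ - 1)) + 1) =
      xF γ q ^ (1 / (γ - 1)) / xF γ q ^ (-(1 / (γ - 1) + 1)) := by
    rw [← Real.rpow_sub hx]; congr 1; ring
  rw [e]
  have : 0 < xF γ q ^ (-(1 / (γ - 1) + 1)) := by positivity
  have : (γ + 1) ≠ 0 := by linarith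
  field_simp

lemma kap_cont {γ : ℝ} (hγ : 1 < γ) : ContinuousOn (kapF γ) (Ioo 0 (qmaxF γ)) := by
  unfold kapF
  apply ContinuousOn.div
  · apply ContinuousOn.mul (by fun_prop)
    apply (xF_continuous γ).continuousOn.rpow_const
    intro q hq; left; exact (xF_pos hγ hq.1 hq.2).ne'
  · fun_prop
  · intro q hq; exact hq.1.ne'

lemma bet_cont {γ : ℝ} (hγ : 1 < γ) : ContinuousOn (betF γ) (Ioo 0 (qmaxF γ)) := by
  unfold betF
  apply ContinuousOn.div
  · apply (xF_continuous γ).continuousOn.rpow_const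
    intro q hq; left; exact (xF_pos hγ hq.1 hq.2).ne'
  · fun_prop
  · intro q hq; exact hq.1.ne'

lemma nu_cont {γ : ℝ} (hγ : 1 < γ) : ContinuousOn (nuF γ) (Ioo 0 (qmaxF γ)) := by
  unfold nuF
  have h := cstar_pos hγ
  apply ContinuousOn.mul
  · apply (xF_continuous γ).continuousOn.rpow_const
    intro q hq; left; exact (xF_pos hγ hq.1 hq.2).ne'
  · apply ContinuousOn.div (by fun_prop) (by fun_prop)
    intro q hq; have := hq.1; positivity

lemma intA_eq {γ q : ℝ} (hγ : 1 < γ) (h0 : 0 < q) (hq : q < qmaxF γ) :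
    (rhoF γ (q ^ 2) + 2 * q ^ 2 * deriv (rhoF γ) (q ^ 2)) / (q * (rhoF γ (q ^ 2)) ^ 2)
      = -((q - cstar γ) * kapF γ q) := by
  have hx := xF_pos hγ h0 hq
  have hx' : 0 < 1 - (γ - 1) / 2 * q ^ 2 := hx
  have h1 : γ - 1 ≠ 0 := by linarith
  have h1' : γ + 1 ≠ 0 := by linarith
  have hd : deriv (rhoF γ) (q ^ 2) = -(1 / 2) * xF γ q ^ (1 / (γ - 1) - 1) := by
    have h2 : HasDerivAt (fun t : ℝ => 1 - (γ - 1) / 2 * t) (-((γ - 1) / 2)) (q ^ 2) := by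
      simpa using ((hasDerivAt_id (q ^ 2)).const_mul ((γ - 1) / 2)).const_sub 1
    have h3 := h2.rpow_const (p := 1 / (γ - 1)) (Or.inl hx'.ne')
    have h4 : HasDerivAt (rhoF γ) _ (q ^ 2) := h3
    rw [h4.deriv]
    unfold xF
    field_simp
  rw [hd]
  have hr : rhoF γ (q ^ 2) = xF γ q ^ (1 / (γ - 1)) := rfl
  rw [hr]
  have e1 : xF γ q ^ (1 / (γ - 1) - 1) = xF γ q ^ (1 / (γ - 1)) / xF γ q := by
    rw [Real.rpow_sub hx, Real.rpow_one]
  have e2 : xF γ q ^ (-(1 / (γ - 1) + 1)) = 1 / (xF γ q ^ (1 / (γ - 1)) * xF γ q) := by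
    rw [Real.rpow_neg hx.le, Real.rpow_add hx, Real.rpow_one, one_div, one_div]
  unfold kapF
  rw [e1, e2]
  set R := xF γ q ^ (1 / (γ - 1)) with hR
  have hRp : 0 < R := by positivity
  have hD : xF γ q - q ^ 2 = -((q - cstar γ) * ((γ + 1) / 2 * (q + cstar γ))) := by
    have : (q - cstar γ) * ((γ + 1) / 2 * (q + cstar γ)) = (γ + 1) / 2 * (q ^ 2 - cstar γ ^ 2) := by
      ring
    rw [this, cstar_sq hγ]; unfold xF; field_simp; ring
  have e3 : (R + 2 * q ^ 2 * (-(1 / 2) * (R / xF γ q))) / (q * R ^ 2)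
      = (xF γ q - q ^ 2) * (1 / (R * xF γ q)) / q := by
    field_simp
    ring
  rw [e3, hD]; ring

lemma intA_cont {γ : ℝ} (hγ : 1 < γ) : ContinuousOn (fun q : ℝ =>
    (rhoF γ (q ^ 2) + 2 * q ^ 2 * deriv (rhoF γ) (q ^ 2)) / (q * (rhoF γ (q ^ 2)) ^ 2))
    (Ioo 0 (qmaxF γ)) := by
  have : ContinuousOn (fun q => -((q - cstar γ) * kapF γ q)) (Ioo 0 (qmaxF γ)) :=
    ((by fun_prop : ContinuousOn (fun q : ℝ => q - cstar γ) _).mul (kap_cont hγ)).neg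
  exact this.congr (fun q hq => intA_eq hγ hq.1 hq.2)

lemma hasDerivAt_integral_Ioo {F : ℝ → ℝ} {a b c q : ℝ} (hF : ContinuousOn F (Ioo a b))
    (hc : c ∈ Ioo a b) (hq : q ∈ Ioo a b) :
    HasDerivAt (fun y => ∫ s in c..y, F s) (F q) q := by
  apply intervalIntegral.integral_hasDerivAt_right
  · apply ContinuousOn.intervalIntegrable
    exact hF.mono (by
      intro z hz
      rcases le_total c q with h | h
      · rw [uIcc_of_le h] at hz; exact ⟨hc.1.trans_le hz.1, hz.2.trans_lt hq.2⟩
      · rw [uIcc_of_ge h] at hz; exact ⟨hq.1.trans_le hz.1, hz.2.trans_lt hc.2⟩)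
  · exact hF.stronglyMeasurableAtFilter isOpen_Ioo q hq
  · exact hF.continuousAt (isOpen_Ioo.mem_nhds hq)

lemma cstar_mem {γ : ℝ} (hγ : 1 < γ) : cstar γ ∈ Ioo 0 (qmaxF γ) :=
  ⟨cstar_pos hγ, cstar_lt_qmax hγ⟩

lemma A_deriv {γ q : ℝ} (hγ : 1 < γ) (hq : q ∈ Ioo 0 (qmaxF γ)) :
    HasDerivAt (Afun γ) (-((q - cstar γ) * kapF γ q)) q := by
  have := hasDerivAt_integral_Ioo (intA_cont hγ) (cstar_mem hγ) hq
  simp only [intA_eq hγ hq.1 hq.2] at this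
  exact this

lemma B_deriv {γ q : ℝ} (hγ : 1 < γ) (hq : q ∈ Ioo 0 (qmaxF γ)) :
    HasDerivAt (Bfun γ) (betF γ q) q :=
  hasDerivAt_integral_Ioo (bet_cont hγ) (cstar_mem hγ) hq

lemma A_cstar (γ : ℝ) : Afun γ (cstar γ) = 0 := by simp [Afun]

lemma Ico_sub {γ : ℝ} (hγ : 1 < γ) : Ico (cstar γ) (qmaxF γ) ⊆ Ioo 0 (qmaxF γ) :=
  fun _ h => ⟨(cstar_pos hγ).trans_le h.1, h.2⟩

lemma A_contOn {γ : ℝ} (hγ : 1 < γ) : ContinuousOn (Afun γ) (Ico (cstar γ) (qmaxF γ)) :=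
  fun q hq => (A_deriv hγ (Ico_sub hγ hq)).continuousAt.continuousWithinAt

lemma A_anti {γ : ℝ} (hγ : 1 < γ) : StrictAntiOn (Afun γ) (Ico (cstar γ) (qmaxF γ)) := by
  apply strictAntiOn_of_deriv_neg (convex_Ico _ _) (A_contOn hγ)
  intro q hq
  rw [interior_Ico] at hq
  have hq' : q ∈ Ioo 0 (qmaxF γ) := ⟨(cstar_pos hγ).trans hq.1, hq.2⟩
  rw [(A_deriv hγ hq').deriv]
  have := kap_pos hγ hq'.1 hq'.2
  have := hq.1
  have : 0 < (q - cstar γ) * kapF γ q := mul_pos (by linarith) (by assumption)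
  linarith

/-- `A` is unbounded below. -/
lemma A_surj {γ s : ℝ} (hγ : 1 < γ) (hs : s ≤ 0) : ∃ q ∈ Ico (cstar γ) (qmaxF γ), Afun γ q = s := by
  have hc := cstar_pos hγ
  have hcq := cstar_lt_qmax hγ
  set s0 := (cstar γ + qmaxF γ) / 2 with hs0
  have h1 : cstar γ < s0 := by rw [hs0]; linarith
  have h2 : s0 < qmaxF γ := by rw [hs0]; linarith
  -- k s / x(s) is a lower bound of |A'|
  have hg1 : 0 < γ - 1 := by linarith
  set k : ℝ := (s0 - cstar γ) / qmaxF γ ^ 2 * ((γ + 1) / 2 * cstar γ) with hk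
  have hkp : 0 < k := by
    have : 0 < s0 - cstar γ := by linarith
    have : 0 < qmaxF γ := by linarith
    positivity
  -- comparison function
  have hcomp : ∀ q ∈ Ico s0 (qmaxF γ),
      Afun γ q ≤ Afun γ s0 + k / (γ - 1) * (Real.log (xF γ q) - Real.log (xF γ s0)) := by
    intro q hq
    have hanti : AntitoneOn (fun q => Afun γ q - k / (γ - 1) * Real.log (xF γ q))
        (Ico s0 (qmaxF γ)) := by
      have hder : ∀ r ∈ Ico s0 (qmaxF γ),
          HasDerivAt (fun q => Afun γ q - k / (γ - 1) * Real.log (xF γ q))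
            (-((r - cstar γ) * kapF γ r) - k / (γ - 1) * (-(γ - 1) * r / xF γ r)) r := by
        intro r hr
        have hr' : r ∈ Ioo 0 (qmaxF γ) := ⟨by linarith [hr.1], hr.2⟩
        have hx := xF_pos hγ hr'.1 hr'.2
        have hxd : HasDerivAt (xF γ) (-(γ - 1) * r) r := by
          have := ((hasDerivAt_pow 2 r).const_mul ((γ - 1) / 2)).const_sub 1
          convert! this using 1
          simp; ring
        exact (A_deriv hγ hr').sub ((hxd.log hx.ne').const_mul _)
      apply antitoneOn_of_deriv_nonpos (convex_Ico _ _)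
      · exact fun r hr => (hder r hr).continuousAt.continuousWithinAt
      · intro r hr; rw [interior_Ico] at hr
        exact (hder r ⟨hr.1.le, hr.2⟩).differentiableAt.differentiableWithinAt
      · intro r hr; rw [interior_Ico] at hr
        rw [(hder r ⟨hr.1.le, hr.2⟩).deriv]
        have hr' : r ∈ Ioo 0 (qmaxF γ) := ⟨by linarith [hr.1], hr.2⟩
        have hx := xF_pos hγ hr'.1 hr'.2
        have hx1 : xF γ r ≤ 1 := by unfold xF; nlinarith [sq_nonneg r]
        have e : -((r - cstar γ) * kapF γ r) - k / (γ - 1) * (-(γ - 1) * r / xF γ r)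
          = -((r - cstar γ) * kapF γ r) + k * r / xF γ r := by
          field_simp
          ring
        rw [e]
        have hpow : (xF γ r)⁻¹ ≤ xF γ r ^ (-(1 / (γ - 1) + 1)) := by
          rw [← Real.rpow_neg_one]
          apply Real.rpow_le_rpow_of_exponent_ge hx hx1
          have : 0 < 1 / (γ - 1) := by positivity
          linarith
        have hkap : (γ + 1) / 2 * cstar γ * (xF γ r)⁻¹ / r ≤ kapF γ r := by
          unfold kapF
          have : 0 < r := hr'.1
          gcongr
          linarith
        have : k * r / xF γ r ≤ (r - cstar γ) * kapF γ r := by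
          calc k * r / xF γ r = (s0 - cstar γ) * (r ^ 2 / qmaxF γ ^ 2) *
              ((γ + 1) / 2 * cstar γ * (xF γ r)⁻¹ / r) := by
                rw [hk]
                have := hr'.1
                have : 0 < qmaxF γ := by linarith
                field_simp
            _ ≤ (s0 - cstar γ) * 1 * ((γ + 1) / 2 * cstar γ * (xF γ r)⁻¹ / r) := by
                have := hr'.1
                have : r ^ 2 / qmaxF γ ^ 2 ≤ 1 := by
                  rw [div_le_one (by nlinarith)]
                  nlinarith [hr'.2]
                have : 0 ≤ s0 - cstar γ := by linarith
                gcongr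
            _ ≤ (r - cstar γ) * kapF γ r := by
                have := kap_pos hγ hr'.1 hr'.2
                have : 0 ≤ s0 - cstar γ := by linarith
                rw [mul_one]
                have h5 := hr.1
                have h6 := hr'.1
                have : 0 ≤ r - cstar γ := by linarith
                have : 0 ≤ (γ + 1) / 2 * cstar γ * (xF γ r)⁻¹ / r := by positivity
                gcongr
        linarith
    have := hanti (left_mem_Ico.2 h2) hq hq.1
    simp only at this
    linarith
  have hlog : Tendsto (fun q => Real.log (xF γ q)) (nhdsWithin (qmaxF γ) (Iio (qmaxF γ))) atBot := by
    apply Real.tendsto_log_nhdsGT_zero.comp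
    rw [tendsto_nhdsWithin_iff]
    constructor
    · have hz : xF γ (qmaxF γ) = 0 := by
        unfold xF; rw [qmax_sq hγ]; field_simp; ring
      have := (xF_continuous γ).tendsto (qmaxF γ)
      rw [hz] at this
      exact this.mono_left nhdsWithin_le_nhds
    · filter_upwards [Ioo_mem_nhdsLT h2] with q hq
      exact xF_pos hγ (by linarith [hq.1]) hq.2
  have hev := (hlog.eventually (eventually_le_atBot
    ((s - Afun γ s0) / (k / (γ - 1)) + Real.log (xF γ s0)))).and (Ioo_mem_nhdsLT h2)
  obtain ⟨q, hq1, hq2⟩ := hev.exists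
  have h3 := hcomp q ⟨hq2.1.le, hq2.2⟩
  have h4 : Afun γ q ≤ s := by
    have hpos : 0 < k / (γ - 1) := by positivity
    have : k / (γ - 1) * (Real.log (xF γ q) - Real.log (xF γ s0)) ≤ s - Afun γ s0 := by
      rw [mul_comm, ← le_div_iff₀ hpos]; linarith
    linarith
  have hivt := intermediate_value_Icc' (show cstar γ ≤ q by linarith [hq2.1])
    ((A_contOn hγ).mono (fun z hz => ⟨hz.1, hz.2.trans_lt hq2.2⟩))
  rw [A_cstar] at hivt
  obtain ⟨z, hz, hzs⟩ := hivt ⟨h4, hs⟩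
  exact ⟨z, ⟨hz.1, hz.2.trans_lt hq2.2⟩, hzs⟩

lemma AI_mem {γ s : ℝ} (hγ : 1 < γ) (hs : s ≤ 0) : AplusInv γ s ∈ Ico (cstar γ) (qmaxF γ) :=
  Function.invFunOn_mem (A_surj hγ hs)

lemma A_AI {γ s : ℝ} (hγ : 1 < γ) (hs : s ≤ 0) : Afun γ (AplusInv γ s) = s :=
  Function.invFunOn_eq (A_surj hγ hs)

lemma AI_anti {γ : ℝ} (hγ : 1 < γ) : StrictAntiOn (AplusInv γ) (Iic 0) := by
  intro s hs t ht hst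
  have := (A_anti hγ).lt_iff_gt (AI_mem hγ hs) (AI_mem hγ ht)
  rw [A_AI hγ hs, A_AI hγ ht] at this
  exact this.1 hst

/-- bounds on compact subsets -/
lemma exists_bounds {F : ℝ → ℝ} {a b : ℝ} (hF : ContinuousOn F (Icc a b)) (hab : a ≤ b)
    (hp : ∀ x ∈ Icc a b, 0 < F x) : ∃ c > 0, ∃ C > 0, ∀ x ∈ Icc a b, c ≤ F x ∧ F x ≤ C := by
  obtain ⟨x0, hx0, h0⟩ := isCompact_Icc.exists_isMinOn (nonempty_Icc.2 hab) hF
  obtain ⟨x1, hx1, h1⟩ := isCompact_Icc.exists_isMaxOn (nonempty_Icc.2 hab) hF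
  exact ⟨F x0, hp _ hx0, F x1, hp _ hx1, fun x hx => ⟨h0 hx, h1 hx⟩⟩


lemma A_sandwich {γ q1 k1 k2 : ℝ} (hγ : 1 < γ) (hq1 : q1 < qmaxF γ)
    (hk : ∀ q ∈ Icc (cstar γ) q1, k1 ≤ kapF γ q ∧ kapF γ q ≤ k2) {q q' : ℝ}
    (hq : q ∈ Icc (cstar γ) q1) (hq' : q' ∈ Icc (cstar γ) q1) (hle : q ≤ q') :
    k1 / 2 * ((q' - cstar γ) ^ 2 - (q - cstar γ) ^ 2) ≤ Afun γ q - Afun γ q' ∧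
    Afun γ q - Afun γ q' ≤ k2 / 2 * ((q' - cstar γ) ^ 2 - (q - cstar γ) ^ 2) := by
  have hd : ∀ k : ℝ, ∀ r ∈ Icc (cstar γ) q1,
      HasDerivAt (fun r => Afun γ r + k / 2 * (r - cstar γ) ^ 2)
        ((r - cstar γ) * (k - kapF γ r)) r := by
    intro k r hr
    have h1 := A_deriv hγ (Ico_sub hγ ⟨hr.1, hr.2.trans_lt hq1⟩)
    have h2 := (((hasDerivAt_id r).sub_const (cstar γ)).pow 2).const_mul (k / 2)
    convert! h1.add h2 using 1
    simp; ring
  constructor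
  · have : AntitoneOn (fun r => Afun γ r + k1 / 2 * (r - cstar γ) ^ 2) (Icc (cstar γ) q1) := by
      apply antitoneOn_of_deriv_nonpos (convex_Icc _ _)
      · exact fun r hr => (hd k1 r hr).continuousAt.continuousWithinAt
      · intro r hr
        exact (hd k1 r (interior_subset hr)).differentiableAt.differentiableWithinAt
      · intro r hr
        have hr := interior_subset hr
        rw [(hd k1 r hr).deriv]
        exact mul_nonpos_of_nonneg_of_nonpos (by linarith [hr.1]) (by linarith [(hk r hr).1])
    have := this hq hq' hle
    simp only at this
    linarith
  · have : MonotoneOn (fun r => Afun γ r + k2 / 2 * (r - cstar γ) ^ 2) (Icc (cstar γ) q1) := by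
      apply monotoneOn_of_deriv_nonneg (convex_Icc _ _)
      · exact fun r hr => (hd k2 r hr).continuousAt.continuousWithinAt
      · intro r hr
        exact (hd k2 r (interior_subset hr)).differentiableAt.differentiableWithinAt
      · intro r hr
        have hr := interior_subset hr
        rw [(hd k2 r hr).deriv]
        exact mul_nonneg (by linarith [hr.1]) (by linarith [(hk r hr).2])
    have := this hq hq' hle
    simp only at this
    linarith

lemma Icc_sub {γ q1 : ℝ} (hγ : 1 < γ) (hq1 : q1 < qmaxF γ) :
    Icc (cstar γ) q1 ⊆ Ioo 0 (qmaxF γ) :=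
  fun _ h => ⟨(cstar_pos hγ).trans_le h.1, h.2.trans_lt hq1⟩

lemma AI_Icc {γ S s : ℝ} (hγ : 1 < γ) (hs : s ∈ Icc (-S) 0) :
    AplusInv γ s ∈ Icc (cstar γ) (AplusInv γ (-S)) := by
  refine ⟨(AI_mem hγ hs.2).1, ?_⟩
  exact (AI_anti hγ).antitoneOn (by simp only [mem_Iic]; linarith [hs.1, hs.2]) hs.2 hs.1

lemma AI_zero {γ : ℝ} (hγ : 1 < γ) : AplusInv γ 0 = cstar γ := by
  apply (A_anti hγ).injOn (AI_mem hγ le_rfl) ⟨le_rfl, cstar_lt_qmax hγ⟩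
  rw [A_AI hγ le_rfl, A_cstar]

lemma AI_sub {γ S : ℝ} (hγ : 1 < γ) (hS : 0 ≤ S) : ∃ k1 > 0, ∃ k2 > 0,
    ∀ s t, s ∈ Icc (-S) 0 → t ∈ Icc (-S) 0 → s ≤ t →
    k1 * ((AplusInv γ s - cstar γ) ^ 2 - (AplusInv γ t - cstar γ) ^ 2) ≤ t - s ∧
    t - s ≤ k2 * ((AplusInv γ s - cstar γ) ^ 2 - (AplusInv γ t - cstar γ) ^ 2) := by
  have hm := AI_mem (s := -S) hγ (by linarith)
  obtain ⟨k1, h1, k2, h2, hk⟩ := exists_bounds ((kap_cont hγ).mono (Icc_sub hγ hm.2)) hm.1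
    (fun x hx => kap_pos hγ (Icc_sub hγ hm.2 hx).1 (Icc_sub hγ hm.2 hx).2)
  refine ⟨k1 / 2, by positivity, k2 / 2, by positivity, fun s t hs ht hst => ?_⟩
  have := A_sandwich hγ hm.2 hk (AI_Icc hγ ht) (AI_Icc hγ hs)
    ((AI_anti hγ).antitoneOn hs.2 ht.2 hst)
  rwa [A_AI hγ hs.2, A_AI hγ ht.2] at this

lemma AI_cont {γ : ℝ} (hγ : 1 < γ) : ContinuousOn (AplusInv γ) (Iic 0) := by
  intro s hs
  have hs : s ≤ 0 := hs
  obtain ⟨k1, h1, k2, h2, hk⟩ := AI_sub (S := 1 - s) hγ (by linarith)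
  have key : ∀ t ∈ Icc (-(1 - s)) 0, |AplusInv γ t - AplusInv γ s| ≤ √(|t - s| / k1) := by
    intro t ht
    apply Real.abs_le_sqrt
    rw [le_div_iff₀ h1]
    have hsm : s ∈ Icc (-(1 - s)) 0 := ⟨by linarith, hs⟩
    have a1 := (AI_mem hγ ht.2).1
    have a2 := (AI_mem hγ hs).1
    rcases le_total s t with h | h
    · have := (hk s t hsm ht h).1
      have a3 := (AI_anti hγ).antitoneOn hs ht.2 h
      rw [abs_of_nonneg (by linarith)]
      have : (AplusInv γ t - AplusInv γ s) ^ 2 ≤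
        ((AplusInv γ s - cstar γ) ^ 2 - (AplusInv γ t - cstar γ) ^ 2) := by nlinarith
      nlinarith
    · have := (hk t s ht hsm h).1
      have a3 := (AI_anti hγ).antitoneOn ht.2 hs h
      rw [abs_of_nonpos (by linarith)]
      have : (AplusInv γ t - AplusInv γ s) ^ 2 ≤
        ((AplusInv γ t - cstar γ) ^ 2 - (AplusInv γ s - cstar γ) ^ 2) := by nlinarith
      nlinarith
  unfold ContinuousWithinAt
  rw [tendsto_iff_dist_tendsto_zero]
  have hlim : Tendsto (fun t => √(|t - s| / k1)) (nhdsWithin s (Iic 0)) (nhds 0) := by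
    have : Continuous (fun t => √(|t - s| / k1)) := by fun_prop
    have := this.tendsto s
    simp only [sub_self, abs_zero, zero_div, Real.sqrt_zero] at this
    exact this.mono_left nhdsWithin_le_nhds
  apply squeeze_zero' (Eventually.of_forall fun t => dist_nonneg) _ hlim
  have hn : Ioi (s - 1) ∈ nhds s := Ioi_mem_nhds (by linarith)
  filter_upwards [self_mem_nhdsWithin, nhdsWithin_le_nhds hn] with t ht ht2
  rw [Real.dist_eq]
  exact key t ⟨by linarith [mem_Ioi.1 ht2], ht⟩

lemma AI_gt {γ s : ℝ} (hγ : 1 < γ) (hs : s < 0) : cstar γ < AplusInv γ s := by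
  rw [← AI_zero hγ]; exact AI_anti hγ hs.le (mem_Iic.2 le_rfl) hs

lemma K_deriv {γ s : ℝ} (hγ : 1 < γ) (hs : s < 0) :
    HasDerivAt (Kfun γ) (-(nuF γ (AplusInv γ s) / (AplusInv γ s - cstar γ))) s := by
  have hm := Ico_sub hγ (AI_mem hγ hs.le)
  have hg := AI_gt hγ hs
  have hkp := kap_pos hγ hm.1 hm.2
  have hA := A_deriv hγ hm
  have hne : -((AplusInv γ s - cstar γ) * kapF γ (AplusInv γ s)) ≠ 0 := by
    have : 0 < (AplusInv γ s - cstar γ) * kapF γ (AplusInv γ s) := mul_pos (by linarith) hkp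
    linarith
  have hc : ContinuousAt (AplusInv γ) s := (AI_cont hγ).continuousAt (Iic_mem_nhds hs)
  have hI := HasDerivAt.of_local_left_inverse hc hA hne (by
    filter_upwards [Iic_mem_nhds hs] with t ht
    exact A_AI hγ ht)
  have := (B_deriv hγ hm).comp s hI
  convert! this using 1
  rw [← nu_eq hγ hm.1 hm.2]
  have : AplusInv γ s - cstar γ ≠ 0 := by linarith
  field_simp

lemma b_eq {γ s : ℝ} (hγ : 1 < γ) (hs : s < 0) :
    bfun γ s = nuF γ (AplusInv γ s) / (AplusInv γ s - cstar γ) := by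
  unfold bfun; rw [(K_deriv hγ hs).deriv]; ring

lemma K_hasDeriv {γ s : ℝ} (hγ : 1 < γ) (hs : s < 0) :
    HasDerivAt (Kfun γ) (-(bfun γ s)) s := by
  rw [b_eq hγ hs]; exact K_deriv hγ hs

lemma b_pos {γ s : ℝ} (hγ : 1 < γ) (hs : s < 0) : 0 < bfun γ s := by
  rw [b_eq hγ hs]
  have hm := Ico_sub hγ (AI_mem hγ hs.le)
  exact div_pos (nu_pos hγ hm.1 hm.2) (by linarith [AI_gt hγ hs])

lemma nu_anti {γ : ℝ} (hγ : 1 < γ) : AntitoneOn (nuF γ) (Ioo 0 (qmaxF γ)) := by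
  intro q hq q' hq' h
  unfold nuF
  have hx' := xF_pos hγ hq'.1 hq'.2
  have hx : xF γ q' ≤ xF γ q := by
    unfold xF
    have : q ^ 2 ≤ q' ^ 2 := by nlinarith [hq.1]
    nlinarith
  have hg : 0 < γ - 1 := by linarith
  have := cstar_pos hγ
  have := hq.1
  have := hq'.1
  have : 0 < xF γ q := by linarith
  have : 0 ≤ 2 / ((γ + 1) * (q' + cstar γ)) := by positivity
  have : 0 ≤ xF γ q ^ (2 * (1 / (γ - 1)) + 1) := by positivity
  gcongr

lemma b_mono {γ s t : ℝ} (hγ : 1 < γ) (hst : s ≤ t) (ht : t < 0) : bfun γ s ≤ bfun γ t := by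
  have hs : s < 0 := by linarith
  rw [b_eq hγ hs, b_eq hγ ht]
  have hms := Ico_sub hγ (AI_mem hγ hs.le)
  have hmt := Ico_sub hγ (AI_mem hγ ht.le)
  have h := (AI_anti hγ).antitoneOn hs.le ht.le hst
  have h1 := nu_anti hγ hmt hms h
  have := AI_gt hγ ht
  exact div_le_div₀ (nu_pos hγ hmt.1 hmt.2).le h1 (by linarith) (by linarith)

lemma K_cont {γ : ℝ} (hγ : 1 < γ) : ContinuousOn (Kfun γ) (Iic 0) := by
  intro s hs
  have hm := Ico_sub hγ (AI_mem hγ hs)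
  exact (B_deriv hγ hm).continuousAt.comp_continuousWithinAt (AI_cont hγ s hs)

lemma nu_lip {γ q1 : ℝ} (hγ : 1 < γ) (hq1 : q1 < qmaxF γ) : ∃ L ≥ 0, ∀ q ∈ Icc (cstar γ) q1,
    ∀ q' ∈ Icc (cstar γ) q1, |nuF γ q - nuF γ q'| ≤ L * |q - q'| := by
  have hcd : ContDiffOn ℝ 1 (nuF γ) (Icc (cstar γ) q1) := by
    unfold nuF
    have hc := cstar_pos hγ
    apply ContDiffOn.mul
    · apply ContDiffOn.rpow_const_of_ne
      · unfold xF; fun_prop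
      · intro q hq; exact (xF_pos hγ (Icc_sub hγ hq1 hq).1 (Icc_sub hγ hq1 hq).2).ne'
    · apply ContDiffOn.div (by fun_prop) (by fun_prop)
      intro q hq
      have := (Icc_sub hγ hq1 hq).1
      positivity
  obtain ⟨K, hK⟩ := hcd.exists_lipschitzOnWith one_ne_zero (convex_Icc _ _) isCompact_Icc
  refine ⟨K, K.2, fun q hq q' hq' => ?_⟩
  have := hK.dist_le_mul q hq q' hq'
  rwa [Real.dist_eq, Real.dist_eq] at this

lemma b_size {γ S : ℝ} (hγ : 1 < γ) (hS : 0 ≤ S) : ∃ c > 0, ∃ C > 0,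
    ∀ s ∈ Ico (-S) 0, c ≤ bfun γ s * √(-s) ∧ bfun γ s * √(-s) ≤ C := by
  obtain ⟨k1, h1, k2, h2, hk⟩ := AI_sub hγ hS
  have hm := AI_mem (s := -S) hγ (by linarith)
  obtain ⟨n1, hn1, n2, hn2, hn⟩ := exists_bounds ((nu_cont hγ).mono (Icc_sub hγ hm.2)) hm.1
    (fun x hx => nu_pos hγ (Icc_sub hγ hm.2 hx).1 (Icc_sub hγ hm.2 hx).2)
  refine ⟨n1 * √k1, by positivity, n2 * √k2, by positivity, fun s hs => ?_⟩
  have hs' : s ∈ Icc (-S) 0 := ⟨hs.1, hs.2.le⟩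
  have hh := hk s 0 hs' ⟨by linarith, le_rfl⟩ hs.2.le
  rw [AI_zero hγ] at hh
  have hr : 0 < AplusInv γ s - cstar γ := by linarith [AI_gt hγ hs.2]
  rw [b_eq hγ hs.2]
  have hnn := hn _ (AI_Icc hγ hs')
  set r := AplusInv γ s - cstar γ
  have e1 : √k1 * r ≤ √(-s) := by
    rw [← Real.sqrt_sq hr.le, ← Real.sqrt_mul h1.le]
    apply Real.sqrt_le_sqrt; nlinarith
  have e2 : √(-s) ≤ √k2 * r := by
    rw [← Real.sqrt_sq hr.le, ← Real.sqrt_mul h2.le]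
    apply Real.sqrt_le_sqrt; nlinarith
  constructor
  · rw [div_mul_eq_mul_div, le_div_iff₀ hr, mul_assoc]
    have := Real.sqrt_nonneg k1
    exact mul_le_mul hnn.1 e1 (by positivity) (by linarith)
  · rw [div_mul_eq_mul_div, div_le_iff₀ hr, mul_assoc]
    exact mul_le_mul hnn.2 e2 (by positivity) (by linarith)

lemma b_lip {γ S : ℝ} (hγ : 1 < γ) (hS : 0 ≤ S) : ∃ C > 0,
    ∀ δ > 0, ∀ s ∈ Icc (-S) (-δ), ∀ t ∈ Icc (-S) (-δ),
      |bfun γ s - bfun γ t| * (δ * √δ) ≤ C * |s - t| := by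
  obtain ⟨k1, h1, k2, h2, hk⟩ := AI_sub hγ hS
  have hm := AI_mem (s := -S) hγ (by linarith)
  obtain ⟨n1, hn1, n2, hn2, hn⟩ := exists_bounds ((nu_cont hγ).mono (Icc_sub hγ hm.2)) hm.1
    (fun x hx => nu_pos hγ (Icc_sub hγ hm.2 hx).1 (Icc_sub hγ hm.2 hx).2)
  obtain ⟨L, hL, hLip⟩ := nu_lip hγ hm.2
  set R := AplusInv γ (-S) - cstar γ with hR
  have hR0 : 0 ≤ R := by linarith [hm.1]
  set C := (L * R + n2) / k1 * (k2 * √k2) with hC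
  have hCp : 0 < C := by positivity
  refine ⟨C, hCp, ?_⟩
  intro δ hδ
  have main : ∀ s ∈ Icc (-S) (-δ), ∀ t ∈ Icc (-S) (-δ), s ≤ t →
      |bfun γ s - bfun γ t| * (δ * √δ) ≤ C * |s - t| := by
    intro s hs t ht hst
    have hs0 : s < 0 := by linarith [hs.2]
    have ht0 : t < 0 := by linarith [ht.2]
    have hs' : s ∈ Icc (-S) 0 := ⟨hs.1, hs0.le⟩
    have ht' : t ∈ Icc (-S) 0 := ⟨ht.1, ht0.le⟩
    have hh := (hk s t hs' ht' hst).1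
    have hh0 := (hk t 0 ht' ⟨by linarith, le_rfl⟩ ht0.le).2
    rw [AI_zero hγ] at hh0
    have hqs := AI_Icc hγ hs'
    have hqt := AI_Icc hγ ht'
    have hrt : 0 < AplusInv γ t - cstar γ := by linarith [AI_gt hγ ht0]
    have hrr : AplusInv γ t - cstar γ ≤ AplusInv γ s - cstar γ := by
      linarith [(AI_anti hγ).antitoneOn hs0.le ht0.le hst]
    have hrR : AplusInv γ s - cstar γ ≤ R := by rw [hR]; linarith [hqs.2]
    have hl := hLip _ hqs _ hqt
    have hnn := hn _ hqt
    have hnns := hn _ hqs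
    rw [b_eq hγ hs0, b_eq hγ ht0]
    set r := AplusInv γ s - cstar γ
    set r' := AplusInv γ t - cstar γ
    set a := nuF γ (AplusInv γ s)
    set a' := nuF γ (AplusInv γ t)
    have hr : 0 < r := by linarith
    have e0 : AplusInv γ s - AplusInv γ t = r - r' := by simp only [r, r']; ring
    rw [e0, abs_of_nonneg (by linarith : 0 ≤ r - r')] at hl
    have e1 : |a / r - a' / r'| ≤ (L * R + n2) * (r - r') / (r * r') := by
      have : a / r - a' / r' = ((a - a') * r' - a' * (r - r')) / (r * r') := by
        field_simp; ring
      rw [this, abs_div, abs_of_pos (mul_pos hr hrt)]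
      gcongr
      calc |(a - a') * r' - a' * (r - r')| ≤ |(a - a') * r'| + |a' * (r - r')| := abs_sub _ _
        _ = |a - a'| * r' + a' * (r - r') := by
          rw [abs_mul, abs_mul, abs_of_pos hrt, abs_of_nonneg (by linarith : 0 ≤ a'),
            abs_of_nonneg (by linarith : 0 ≤ r - r')]
        _ ≤ L * (r - r') * R + n2 * (r - r') := by
          have : 0 ≤ r - r' := by linarith
          have : r' ≤ R := by linarith
          gcongr
          exact hnn.2
        _ = _ := by ring
    have e2 : δ ≤ k2 * r' ^ 2 := by
      have : δ ≤ 0 - t := by linarith [ht.2]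
      nlinarith
    have e3 : √δ ≤ √k2 * r' := by
      rw [← Real.sqrt_sq hrt.le, ← Real.sqrt_mul h2.le]
      exact Real.sqrt_le_sqrt e2
    have e4 : δ * √δ ≤ k2 * √k2 * (r' * r' * r') := by
      calc δ * √δ ≤ (k2 * r' ^ 2) * (√k2 * r') := by gcongr
        _ = _ := by ring
    have e5 : k1 * ((r - r') * (r + r')) ≤ |s - t| := by
      rw [abs_of_nonpos (by linarith)]
      calc _ = k1 * (r ^ 2 - r' ^ 2) := by ring
        _ ≤ _ := by linarith
    have e6 : (r - r') * r ≤ |s - t| / k1 := by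
      rw [le_div_iff₀ h1]
      have : 0 ≤ k1 * (r - r') * r' := by
        have : 0 ≤ r - r' := by linarith
        positivity
      linarith
    calc |a / r - a' / r'| * (δ * √δ) ≤ (L * R + n2) * (r - r') / (r * r') *
          (k2 * √k2 * (r' * r' * r')) := by
          have : 0 ≤ r - r' := by linarith
          gcongr
      _ = (L * R + n2) * (k2 * √k2) * ((r - r') * r' * (r' / r)) := by field_simp
      _ ≤ (L * R + n2) * (k2 * √k2) * ((r - r') * r * 1) := by
          have : 0 ≤ r - r' := by linarith
          have : r' / r ≤ 1 := by rw [div_le_one hr]; exact hrr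
          gcongr
      _ ≤ (L * R + n2) * (k2 * √k2) * (|s - t| / k1) := by
          rw [mul_one]; gcongr
      _ = C * |s - t| := by rw [hC]; ring
  intro s hs t ht
  rcases le_total s t with h | h
  · exact main s hs t ht h
  · rw [abs_sub_comm, abs_sub_comm s t]; exact main t ht s hs h

lemma q_K {γ S : ℝ} (hγ : 1 < γ) (hS : 0 ≤ S) : ∃ C > 0, ∀ s ∈ Icc (-S) 0, ∀ t ∈ Icc (-S) 0,
    |1 / AplusInv γ s - 1 / AplusInv γ t| ≤ C * |Kfun γ s - Kfun γ t| := by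
  have hm := AI_mem (s := -S) hγ (by linarith)
  obtain ⟨n1, hn1, n2, hn2, hn⟩ := exists_bounds ((bet_cont hγ).mono (Icc_sub hγ hm.2)) hm.1
    (fun x hx => bet_pos hγ (Icc_sub hγ hm.2 hx).1 (Icc_sub hγ hm.2 hx).2)
  have hc := cstar_pos hγ
  have hB : MonotoneOn (fun q => Bfun γ q - n1 * q) (Icc (cstar γ) (AplusInv γ (-S))) := by
    have hd : ∀ r ∈ Icc (cstar γ) (AplusInv γ (-S)),
        HasDerivAt (fun q => Bfun γ q - n1 * q) (betF γ r - n1 * 1) r := fun r hr =>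
      (B_deriv hγ (Icc_sub hγ hm.2 hr)).sub ((hasDerivAt_id r).const_mul n1)
    apply monotoneOn_of_deriv_nonneg (convex_Icc _ _)
    · exact fun r hr => (hd r hr).continuousAt.continuousWithinAt
    · intro r hr
      exact (hd r (interior_subset hr)).differentiableAt.differentiableWithinAt
    · intro r hr
      have hr := interior_subset hr
      rw [(hd r hr).deriv]
      linarith [(hn r hr).1]
  refine ⟨1 / (cstar γ ^ 2 * n1), by positivity, ?_⟩
  have main : ∀ s ∈ Icc (-S) 0, ∀ t ∈ Icc (-S) 0, s ≤ t →
      |1 / AplusInv γ s - 1 / AplusInv γ t| ≤ 1 / (cstar γ ^ 2 * n1) * |Kfun γ s - Kfun γ t| := by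
    intro s hs t ht hst
    have hqs := AI_Icc hγ hs
    have hqt := AI_Icc hγ ht
    have h := (AI_anti hγ).antitoneOn hs.2 ht.2 hst
    have h2 := hB hqt hqs h
    simp only at h2
    have h3 : n1 * (AplusInv γ s - AplusInv γ t) ≤ |Kfun γ s - Kfun γ t| := by
      refine le_trans ?_ (le_abs_self _)
      unfold Kfun; linarith
    have p1 : 0 < AplusInv γ s := hc.trans_le hqs.1
    have p2 : 0 < AplusInv γ t := hc.trans_le hqt.1
    have : 1 / AplusInv γ s - 1 / AplusInv γ t =
      -((AplusInv γ s - AplusInv γ t) / (AplusInv γ s * AplusInv γ t)) := by field_simp; ring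
    rw [this, abs_neg, abs_of_nonneg (div_nonneg (by linarith) (by positivity))]
    rw [div_le_iff₀ (by positivity)]
    have h4 : cstar γ ^ 2 ≤ AplusInv γ s * AplusInv γ t := by nlinarith [hqs.1, hqt.1]
    calc AplusInv γ s - AplusInv γ t = 1 / (cstar γ ^ 2 * n1) *
          (n1 * (AplusInv γ s - AplusInv γ t)) * cstar γ ^ 2 := by field_simp
      _ ≤ _ := by gcongr
  intro s hs t ht
  rcases le_total s t with h | h
  · exact main s hs t ht h
  · rw [abs_sub_comm, abs_sub_comm (Kfun γ s)]; exact main t ht s hs h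


lemma ThP_deriv {f : ℝ → ℝ} (hf : ContDiff ℝ 3 f) (x : ℝ) :
    HasDerivAt (ThP f) (1 / (1 + deriv f x ^ 2) * deriv (deriv f) x) x := by
  have h1 : ContDiff ℝ 2 (deriv f) := ((contDiff_succ_iff_deriv (n := 2)).1 hf).2.2
  have h2 : HasDerivAt (deriv f) (deriv (deriv f) x) x :=
    (h1.differentiable (by norm_num) x).hasDerivAt
  exact h2.arctan

lemma ThP_deriv_cont {f : ℝ → ℝ} (hf : ContDiff ℝ 3 f) : Continuous (deriv (ThP f)) := by
  have h1 : ContDiff ℝ 2 (deriv f) := ((contDiff_succ_iff_deriv (n := 2)).1 hf).2.2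
  have h2 : ContDiff ℝ 1 (deriv (deriv f)) := ((contDiff_succ_iff_deriv (n := 1)).1 h1).2.2
  have : deriv (ThP f) = fun x => 1 / (1 + deriv f x ^ 2) * deriv (deriv f) x :=
    funext fun x => (ThP_deriv hf x).deriv
  rw [this]
  have c1 := h1.continuous
  have c2 := h2.continuous
  apply Continuous.mul _ c2
  apply Continuous.div (by fun_prop) (by fun_prop)
  intro x; positivity

lemma ThP_cont {f : ℝ → ℝ} (hf : ContDiff ℝ 3 f) : Continuous (ThP f) :=
  continuous_iff_continuousAt.2 fun x => (ThP_deriv hf x).continuousAt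

lemma cos_ThP_pos (f : ℝ → ℝ) (x : ℝ) : 0 < Real.cos (ThP f x) := Real.cos_arctan_pos _

lemma integral_ge_of_ge {F : ℝ → ℝ} {a b c : ℝ} (hF : ContinuousOn F (Icc a b)) (hab : a ≤ b)
    (hc : ∀ x ∈ Icc a b, c ≤ F x) : c * (b - a) ≤ ∫ s in a..b, F s := by
  have h : ∫ s in a..b, (fun _ => c) s ≤ ∫ s in a..b, F s := by
    apply intervalIntegral.integral_mono_on hab (by simp) _ hc
    apply ContinuousOn.intervalIntegrable
    rwa [uIcc_of_le hab]
  simp at h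
  linarith

lemma Phi_cont {f Qp : ℝ → ℝ} {l : ℝ} (hf : ContDiff ℝ 3 f)
    (hQpc : ContinuousOn Qp (Icc 0 l)) :
    ContinuousOn (fun s => Qp s / Real.cos (ThP f s)) (Icc 0 l) := by
  have := ThP_cont hf
  apply hQpc.div (by fun_prop)
  intro x _; exact (cos_ThP_pos f x).ne'

lemma Phi_grow {γ : ℝ} (hγ : 1 < γ) {f Qp : ℝ → ℝ} {l : ℝ} (hf : ContDiff ℝ 3 f)
    (hQpc : ContinuousOn Qp (Icc 0 l))
    (hQpr : ∀ x ∈ Icc (0 : ℝ) l, cstar γ ≤ Qp x ∧ Qp x < qmaxF γ) {x y : ℝ}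
    (hx : 0 ≤ x) (hxy : x ≤ y) (hy : y ≤ l) :
    cstar γ * (y - x) ≤ PhiP f Qp y - PhiP f Qp x := by
  have hc := Phi_cont hf hQpc
  have hI : ∀ z ∈ Icc 0 l, IntervalIntegrable (fun s => Qp s / Real.cos (ThP f s)) volume 0 z := by
    intro z hz
    apply ContinuousOn.intervalIntegrable
    rw [uIcc_of_le hz.1]
    exact hc.mono (Icc_subset_Icc le_rfl hz.2)
  unfold PhiP
  rw [intervalIntegral.integral_interval_sub_left (hI y ⟨by linarith, hy⟩) (hI x ⟨hx, by linarith⟩)]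
  apply integral_ge_of_ge (hc.mono (Icc_subset_Icc hx hy)) hxy
  intro z hz
  have h1 := hQpr z ⟨by linarith [hz.1], by linarith [hz.2]⟩
  have h2 := cos_ThP_pos f z
  have h3 := Real.cos_le_one (ThP f z)
  rw [le_div_iff₀ h2]
  have := cstar_pos hγ
  nlinarith

lemma X_facts {γ : ℝ} (hγ : 1 < γ) {f Qp : ℝ → ℝ} {l : ℝ} (hl : 0 < l) (hf : ContDiff ℝ 3 f)
    (hQpc : ContinuousOn Qp (Icc 0 l))
    (hQpr : ∀ x ∈ Icc (0 : ℝ) l, cstar γ ≤ Qp x ∧ Qp x < qmaxF γ) :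
    0 < zetaP f Qp l ∧
    (∀ x ∈ Icc 0 l, PhiP f Qp x ∈ Icc 0 (zetaP f Qp l) ∧ XP f Qp l (PhiP f Qp x) = x) ∧
    (∀ φ ∈ Icc 0 (zetaP f Qp l), XP f Qp l φ ∈ Icc 0 l ∧ PhiP f Qp (XP f Qp l φ) = φ ∧
      cstar γ * XP f Qp l φ ≤ φ) ∧
    ContinuousOn (XP f Qp l) (Icc 0 (zetaP f Qp l)) ∧
    (∀ φ ∈ Ioo 0 (zetaP f Qp l), HasDerivAt (XP f Qp l)
      (Real.cos (ThP f (XP f Qp l φ)) / Qp (XP f Qp l φ)) φ) := by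
  have hcs := cstar_pos hγ
  have hgrow := fun {x y : ℝ} => Phi_grow (x := x) (y := y) hγ hf hQpc hQpr
  have hP0 : PhiP f Qp 0 = 0 := by simp [PhiP]
  have hζ : 0 < zetaP f Qp l := by
    have := hgrow le_rfl hl.le le_rfl
    unfold zetaP; rw [hP0] at this
    have : 0 < cstar γ * (l - 0) := by rw [sub_zero]; positivity
    linarith
  have hinj : InjOn (PhiP f Qp) (Icc 0 l) := by
    have : StrictMonoOn (PhiP f Qp) (Icc 0 l) := by
      intro x hx y hy hxy
      have := hgrow hx.1 hxy.le hy.2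
      have : 0 < cstar γ * (y - x) := mul_pos hcs (by linarith)
      linarith
    exact this.injOn
  have hc := Phi_cont hf hQpc
  have hPc : ContinuousOn (PhiP f Qp) (Icc 0 l) := by
    have := intervalIntegral.continuousOn_primitive_interval
      (f := fun s => Qp s / Real.cos (ThP f s)) (a := 0) (b := l) (μ := volume)
      (by rw [uIcc_of_le hl.le]; exact hc.integrableOn_Icc)
    rw [uIcc_of_le hl.le] at this
    exact this
  have hsurj : ∀ φ ∈ Icc 0 (zetaP f Qp l), ∃ x ∈ Icc 0 l, PhiP f Qp x = φ := by
    intro φ hφ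
    have := intermediate_value_Icc hl.le hPc
    rw [hP0] at this
    exact this hφ
  have hX : ∀ φ ∈ Icc 0 (zetaP f Qp l), XP f Qp l φ ∈ Icc 0 l ∧ PhiP f Qp (XP f Qp l φ) = φ ∧
      cstar γ * XP f Qp l φ ≤ φ := by
    intro φ hφ
    have h1 : XP f Qp l φ ∈ Icc 0 l := Function.invFunOn_mem (hsurj φ hφ)
    have h2 : PhiP f Qp (XP f Qp l φ) = φ := Function.invFunOn_eq (hsurj φ hφ)
    refine ⟨h1, h2, ?_⟩
    have := hgrow le_rfl h1.1 h1.2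
    rw [h2, hP0] at this
    linarith
  have hXc : ContinuousOn (XP f Qp l) (Icc 0 (zetaP f Qp l)) := by
    have : LipschitzOnWith ⟨1 / cstar γ, by positivity⟩ (XP f Qp l) (Icc 0 (zetaP f Qp l)) := by
      apply LipschitzOnWith.of_dist_le_mul
      intro a ha b hb
      change _ ≤ 1 / cstar γ * _
      rw [Real.dist_eq, Real.dist_eq, one_div_mul_eq_div, le_div_iff₀ hcs]
      obtain ⟨a1, a2, -⟩ := hX a ha
      obtain ⟨b1, b2, -⟩ := hX b hb
      rcases le_total (XP f Qp l a) (XP f Qp l b) with h | h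
      · have := hgrow a1.1 h b1.2
        rw [a2, b2] at this
        rw [abs_sub_comm, abs_of_nonneg (by linarith), abs_sub_comm]
        have := le_abs_self (b - a)
        linarith
      · have := hgrow b1.1 h a1.2
        rw [a2, b2] at this
        rw [abs_of_nonneg (by linarith)]
        have := le_abs_self (a - b)
        linarith
    exact this.continuousOn
  refine ⟨hζ, ?_, hX, hXc, ?_⟩
  · intro x hx
    have hm : PhiP f Qp x ∈ Icc 0 (zetaP f Qp l) := by
      constructor
      · have := hgrow le_rfl hx.1 hx.2
        rw [hP0] at this
        have : 0 ≤ cstar γ * (x - 0) := by rw [sub_zero]; exact mul_nonneg hcs.le hx.1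
        linarith
      · have := hgrow hx.1 hx.2 le_rfl
        have : 0 ≤ cstar γ * (l - x) := mul_nonneg hcs.le (by linarith [hx.2])
        unfold zetaP
        linarith
    refine ⟨hm, hinj (hX _ hm).1 hx (hX _ hm).2.1⟩
  · intro φ hφ
    obtain ⟨h1, h2, -⟩ := hX φ ⟨hφ.1.le, hφ.2.le⟩
    have hlt : XP f Qp l φ ∈ Ioo 0 l := by
      constructor
      · apply lt_of_le_of_ne h1.1
        intro h; rw [← h, hP0] at h2; linarith [hφ.1]
      · apply lt_of_le_of_ne h1.2
        intro h; rw [h] at h2; have := hφ.2; unfold zetaP at this; linarith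
    have hd : HasDerivAt (PhiP f Qp) (Qp (XP f Qp l φ) / Real.cos (ThP f (XP f Qp l φ)))
        (XP f Qp l φ) := by
      apply intervalIntegral.integral_hasDerivAt_right
      · apply ContinuousOn.intervalIntegrable
        rw [uIcc_of_le h1.1]
        exact hc.mono (Icc_subset_Icc le_rfl h1.2)
      · exact (hc.mono Ioo_subset_Icc_self).stronglyMeasurableAtFilter isOpen_Ioo _ hlt
      · exact hc.continuousAt (Icc_mem_nhds hlt.1 hlt.2)
    have hq : 0 < Qp (XP f Qp l φ) := hcs.trans_le (hQpr _ h1).1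
    have := HasDerivAt.of_local_left_inverse (hXc.continuousAt (Icc_mem_nhds hφ.1 hφ.2)) hd
      (div_pos hq (cos_ThP_pos f _)).ne' (by
        filter_upwards [Icc_mem_nhds hφ.1 hφ.2] with t ht
        exact (hX t ht).2.1)
    rwa [inv_div] at this

/-- Consequences of the compatibility condition along the wall. -/
lemma wall_facts {γ : ℝ} (hγ : 1 < γ) {f Qp : ℝ → ℝ} {l m : ℝ} {Q : ℝ × ℝ → ℝ}
    (hl : 0 < l) (hf : ContDiff ℝ 3 f) (hf0 : deriv f 0 = 0)
    (hQpc : ContinuousOn Qp (Icc 0 l))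
    (hQpr : ∀ x ∈ Icc (0 : ℝ) l, cstar γ ≤ Qp x ∧ Qp x < qmaxF γ)
    (hcomp : ∀ x ∈ Icc (0 : ℝ) l, Qp x = AplusInv γ (Q (PhiP f Qp x, m))) :
    ContinuousOn (fun φ => deriv (ThP f) (XP f Qp l φ) * Real.cos (ThP f (XP f Qp l φ)) /
          AplusInv γ (Q (φ, m))) (Icc 0 (zetaP f Qp l)) ∧
    (∀ φ ∈ Icc 0 (zetaP f Qp l),
      ∫ s in (0 : ℝ)..φ, (deriv (ThP f) (XP f Qp l s) * Real.cos (ThP f (XP f Qp l s)) /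
          AplusInv γ (Q (s, m))) = ThP f (XP f Qp l φ)) ∧
    (∀ φ ∈ Icc 0 (zetaP f Qp l),
      ∫ s in (0 : ℝ)..φ, 1 / AplusInv γ (Q (s, m))
        = ∫ x in (0 : ℝ)..(XP f Qp l φ), 1 / Real.cos (ThP f x)) := by
  obtain ⟨hζ, hPX, hX, hXc, hXd⟩ := X_facts hγ hl hf hQpc hQpr
  have hcs := cstar_pos hγ
  have hT := ThP_cont hf
  have hT' := ThP_deriv_cont hf
  have hq : ∀ φ ∈ Icc 0 (zetaP f Qp l), AplusInv γ (Q (φ, m)) = Qp (XP f Qp l φ) := by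
    intro φ hφ
    have := hcomp _ (hX φ hφ).1
    rw [(hX φ hφ).2.1] at this
    exact this.symm
  have hqpos : ∀ φ ∈ Icc 0 (zetaP f Qp l), 0 < Qp (XP f Qp l φ) := fun φ hφ =>
    hcs.trans_le (hQpr _ (hX φ hφ).1).1
  have hQX : ContinuousOn (fun φ => Qp (XP f Qp l φ)) (Icc 0 (zetaP f Qp l)) :=
    hQpc.comp hXc (fun φ hφ => (hX φ hφ).1)
  have hX0 : XP f Qp l 0 = 0 := by
    have := (hPX 0 ⟨le_rfl, hl.le⟩).2
    simpa [PhiP] using this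
  have hgc : ContinuousOn (fun φ => deriv (ThP f) (XP f Qp l φ) *
      Real.cos (ThP f (XP f Qp l φ)) / AplusInv γ (Q (φ, m))) (Icc 0 (zetaP f Qp l)) := by
    have h1 : ContinuousOn (fun φ => deriv (ThP f) (XP f Qp l φ) *
      Real.cos (ThP f (XP f Qp l φ)) / Qp (XP f Qp l φ)) (Icc 0 (zetaP f Qp l)) := by
      apply ContinuousOn.div _ hQX (fun φ hφ => (hqpos φ hφ).ne')
      exact (hT'.comp_continuousOn hXc).mul
        (Real.continuous_cos.comp_continuousOn (hT.comp_continuousOn hXc))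
    apply h1.congr
    intro φ hφ
    simp only [hq φ hφ]
  refine ⟨hgc, ?_, ?_⟩
  · intro φ hφ
    have h := intervalIntegral.integral_eq_sub_of_hasDerivAt_of_le hφ.1
      (f := fun s => ThP f (XP f Qp l s))
      (f' := fun s => deriv (ThP f) (XP f Qp l s) * Real.cos (ThP f (XP f Qp l s)) /
          AplusInv γ (Q (s, m)))
      ((hT.comp_continuousOn hXc).mono (Icc_subset_Icc le_rfl hφ.2))
      (by
        intro s hs
        have hs' : s ∈ Ioo 0 (zetaP f Qp l) := ⟨hs.1, hs.2.trans_le hφ.2⟩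
        have h1 := (ThP_deriv hf (XP f Qp l s)).differentiableAt.hasDerivAt.comp s (hXd s hs')
        rw [hq s ⟨hs'.1.le, hs'.2.le⟩]
        convert! h1 using 1
        ring)
      (by
        apply ContinuousOn.intervalIntegrable
        rw [uIcc_of_le hφ.1]
        exact hgc.mono (Icc_subset_Icc le_rfl hφ.2))
    rw [h]
    simp [hX0, ThP, hf0]
  · intro φ hφ
    have hcc : Continuous (fun x => 1 / Real.cos (ThP f x)) := by
      apply Continuous.div (by fun_prop) (by fun_prop)
      intro x; exact (cos_ThP_pos f x).ne'
    have hS : ∀ x, HasDerivAt (fun y => ∫ x in (0 : ℝ)..y, 1 / Real.cos (ThP f x))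
        (1 / Real.cos (ThP f x)) x := fun x =>
      intervalIntegral.integral_hasDerivAt_right (hcc.intervalIntegrable _ _)
        (hcc.stronglyMeasurableAtFilter _ _) hcc.continuousAt
    have hSc : Continuous (fun y => ∫ x in (0 : ℝ)..y, 1 / Real.cos (ThP f x)) :=
      continuous_iff_continuousAt.2 fun x => (hS x).continuousAt
    have h := intervalIntegral.integral_eq_sub_of_hasDerivAt_of_le hφ.1
      (f := fun s => ∫ x in (0 : ℝ)..(XP f Qp l s), 1 / Real.cos (ThP f x))
      (f' := fun s => 1 / AplusInv γ (Q (s, m)))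
      ((hSc.comp_continuousOn hXc).mono (Icc_subset_Icc le_rfl hφ.2))
      (by
        intro s hs
        have hs' : s ∈ Ioo 0 (zetaP f Qp l) := ⟨hs.1, hs.2.trans_le hφ.2⟩
        have h1 := (hS (XP f Qp l s)).comp s (hXd s hs')
        have h2 := (cos_ThP_pos f (XP f Qp l s)).ne'
        have h3 := (hqpos s ⟨hs'.1.le, hs'.2.le⟩).ne'
        rw [hq s ⟨hs'.1.le, hs'.2.le⟩]
        convert! h1 using 1
        field_simp)
      (by
        apply ContinuousOn.intervalIntegrable
        rw [uIcc_of_le hφ.1]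
        have : ContinuousOn (fun s => 1 / Qp (XP f Qp l s)) (Icc 0 (zetaP f Qp l)) :=
          continuousOn_const.div hQX (fun φ hφ => (hqpos φ hφ).ne')
        apply (this.congr _).mono (Icc_subset_Icc le_rfl hφ.2)
        intro s hs
        simp only [hq s hs])
    rw [h]
    simp [hX0]

/-- arclength grows at least linearly -/
lemma arc_grow {f : ℝ → ℝ} (hf : ContDiff ℝ 3 f) (x y : ℝ) :
    |x - y| ≤ |(∫ s in (0 : ℝ)..x, 1 / Real.cos (ThP f s)) -
      ∫ s in (0 : ℝ)..y, 1 / Real.cos (ThP f s)| := by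
  have hT := ThP_cont hf
  have hcc : Continuous (fun x => 1 / Real.cos (ThP f x)) := by
    apply Continuous.div (by fun_prop) (by fun_prop)
    intro x; exact (cos_ThP_pos f x).ne'
  rw [intervalIntegral.integral_interval_sub_left (hcc.intervalIntegrable _ _)
    (hcc.intervalIntegrable _ _)]
  have main : ∀ a b : ℝ, a ≤ b → 1 * (b - a) ≤ ∫ s in a..b, 1 / Real.cos (ThP f s) := by
    intro a b hab
    apply integral_ge_of_ge hcc.continuousOn hab
    intro z _
    rw [le_div_iff₀ (cos_ThP_pos f z), one_mul]
    exact Real.cos_le_one _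
  rcases le_total y x with h | h
  · have := main y x h
    rw [abs_of_nonneg (by linarith)]
    exact le_trans (by linarith) (le_abs_self _)
  · have := main x y h
    rw [abs_sub_comm, abs_of_nonneg (by linarith), intervalIntegral.integral_symm, abs_neg]
    exact le_trans (by linarith) (le_abs_self _)

/-- Lipschitz bound for the wall angle -/
lemma ThP_lip {f : ℝ → ℝ} {l lamp δ1 δ2 : ℝ} (hδ1 : 0 < δ1) (hδ2 : 0 ≤ δ2) (hlam : 0 < lamp)
    (hnoz : NozzlePlus lamp δ1 δ2 l f) {x y z : ℝ} (hx : x ∈ Icc 0 l) (hy : y ∈ Icc 0 l)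
    (hxz : x ≤ z) (hyz : y ≤ z) :
    |ThP f x - ThP f y| ≤ δ2 * z ^ lamp * |x - y| := by
  obtain ⟨hf, -, -, h2⟩ := hnoz
  have := Convex.norm_image_sub_le_of_norm_hasDerivWithin_le (f := ThP f)
    (f' := fun x => 1 / (1 + deriv f x ^ 2) * deriv (deriv f) x) (C := δ2 * z ^ lamp)
    (s := Icc 0 (min l z)) (x := y) (y := x)
    (fun t _ => (ThP_deriv hf t).hasDerivWithinAt)
    (by
      intro t ht
      have htl : t ∈ Icc 0 l := ⟨ht.1, ht.2.trans (min_le_left _ _)⟩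
      obtain ⟨a1, a2, -⟩ := h2 t htl
      have hpow : 0 ≤ t ^ lamp := Real.rpow_nonneg ht.1 _
      have a0 : 0 ≤ deriv (deriv f) t := le_trans (by positivity) a1
      have hδ2t : 0 ≤ δ2 * t ^ lamp := a0.trans a2
      rw [Real.norm_of_nonneg (by positivity)]
      have h3 : 1 / (1 + deriv f t ^ 2) ≤ 1 := by
        rw [div_le_one (by positivity)]; nlinarith [sq_nonneg (deriv f t)]
      have htz : t ^ lamp ≤ z ^ lamp :=
        Real.rpow_le_rpow ht.1 (ht.2.trans (min_le_right _ _)) hlam.le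
      calc _ ≤ 1 * (δ2 * t ^ lamp) := by gcongr
        _ ≤ δ2 * z ^ lamp := by rw [one_mul]; gcongr)
    (convex_Icc _ _) ⟨hy.1, le_min hy.2 hyz⟩ ⟨hx.1, le_min hx.2 hxz⟩
  simpa [Real.norm_eq_abs] using this


lemma intervalInt_of_contOn {z : ℝ → ℝ} {T a b : ℝ} (hz : ContinuousOn z (Icc 0 T))
    (ha : a ∈ Icc 0 T) (hb : b ∈ Icc 0 T) : IntervalIntegrable z volume a b := by
  apply ContinuousOn.intervalIntegrable
  apply hz.mono
  intro x hx
  rcases le_total a b with h | h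
  · rw [uIcc_of_le h] at hx; exact ⟨ha.1.trans hx.1, hx.2.trans hb.2⟩
  · rw [uIcc_of_ge h] at hx; exact ⟨hb.1.trans hx.1, hx.2.trans ha.2⟩

/-- Cauchy--Schwarz in the form needed here -/
lemma cs_interval {z : ℝ → ℝ} {a b : ℝ} (hz : ContinuousOn z (Icc a b)) (hab : a ≤ b) :
    (∫ s in a..b, |z s|) ^ 2 ≤ (b - a) * ∫ s in a..b, z s ^ 2 := by
  have i1 : IntervalIntegrable (fun s => |z s|) volume a b := by
    apply ContinuousOn.intervalIntegrable; rw [uIcc_of_le hab]; exact hz.abs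
  have i2 : IntervalIntegrable (fun s => z s ^ 2) volume a b := by
    apply ContinuousOn.intervalIntegrable; rw [uIcc_of_le hab]; exact hz.pow 2
  set V := ∫ s in a..b, |z s| with hV
  set I := ∫ s in a..b, z s ^ 2 with hI
  have key : ∀ t : ℝ, 0 ≤ I - 2 * t * V + t ^ 2 * (b - a) := by
    intro t
    have h : ∫ s in a..b, (z s ^ 2 - 2 * t * |z s| + t ^ 2) = I - 2 * t * V + t ^ 2 * (b - a) := by
      rw [intervalIntegral.integral_add (i2.sub (i1.const_mul _)) (by simp),
        intervalIntegral.integral_sub i2 (i1.const_mul _), intervalIntegral.integral_const_mul]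
      simp [hV, hI]; ring
    rw [← h]
    apply intervalIntegral.integral_nonneg hab
    intro s _
    nlinarith [sq_nonneg (|z s| - t), sq_abs (z s)]
  rcases hab.eq_or_lt with h | h
  · subst h; simp [hV]
  · have h1 := key (V / (b - a))
    have h2 : 0 < b - a := by linarith
    have : I - 2 * (V / (b - a)) * V + (V / (b - a)) ^ 2 * (b - a) = I - V ^ 2 / (b - a) := by
      field_simp; ring
    rw [this, sub_nonneg, div_le_iff₀ h2] at h1
    linarith

lemma abstract_gronwall {T k C0 C1 C2 : ℝ} (hk : 2 ≤ k) (hC0 : 0 ≤ C0) (hC1 : 0 ≤ C1)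
    (hC2 : 0 ≤ C2) (hT : 0 < T) {E z : ℝ → ℝ} (hz : ContinuousOn z (Icc 0 T))
    (hE : ∀ s ∈ Ioc 0 T, 0 ≤ E s ∧ E s ≤ C0 * s ^ (2 * k))
    (hI1 : ∀ φ ∈ Ioc 0 T, ∀ ε ∈ Ioo 0 φ,
      E φ ≤ E ε + C1 * φ ^ (2 * k - 2) * (∫ s in (0 : ℝ)..φ, |z s|) ^ 2)
    (hI2 : ∀ φ ∈ Ioc 0 T, ∀ ε ∈ Ioo 0 φ, ∀ S, 0 ≤ S → (∀ s ∈ Ioc 0 φ, E s ≤ S * s ^ (2 * k)) →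
      ∫ s in ε..φ, z s ^ 2 ≤ C2 * S * φ ^ k) :
    ∀ s ∈ Ioc 0 T, E s = 0 := by
  have hz2 : ContinuousOn (fun s => z s ^ 2) (Icc 0 T) := hz.pow 2
  have hza : ContinuousOn (fun s => |z s|) (Icc 0 T) := hz.abs
  -- limit of the first inequality
  have h1 : ∀ φ ∈ Ioc 0 T, E φ ≤ C1 * φ ^ (2 * k - 2) * (∫ s in (0 : ℝ)..φ, |z s|) ^ 2 := by
    intro φ hφ
    have hlim : Tendsto (fun ε : ℝ => C0 * ε ^ (2 * k) +
        C1 * φ ^ (2 * k - 2) * (∫ s in (0 : ℝ)..φ, |z s|) ^ 2) (nhdsWithin 0 (Ioi 0))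
        (nhds (C0 * 0 ^ (2 * k) + C1 * φ ^ (2 * k - 2) * (∫ s in (0 : ℝ)..φ, |z s|) ^ 2)) := by
      apply Tendsto.mono_left _ nhdsWithin_le_nhds
      apply Tendsto.add_const
      apply Tendsto.const_mul
      exact (Real.continuous_rpow_const (by linarith)).tendsto 0
    rw [Real.zero_rpow (by linarith), mul_zero, zero_add] at hlim
    apply ge_of_tendsto hlim
    filter_upwards [Ioo_mem_nhdsGT hφ.1] with ε hε
    have := hI1 φ hφ ε hε
    have := (hE ε ⟨hε.1, hε.2.le.trans hφ.2⟩).2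
    linarith
  have h2 : ∀ φ ∈ Ioc 0 T, ∀ S, 0 ≤ S → (∀ s ∈ Ioc 0 φ, E s ≤ S * s ^ (2 * k)) →
      ∫ s in (0:ℝ)..φ, z s ^ 2 ≤ C2 * S * φ ^ k := by
    intro φ hφ S hS hES
    have hcont : ContinuousOn (fun ε => ∫ s in ε..φ, z s ^ 2) (Icc 0 φ) := by
      have hi : IntegrableOn (fun s => z s ^ 2) (uIcc φ 0) := by
        rw [uIcc_of_ge hφ.1.le]
        exact (hz2.mono (Icc_subset_Icc le_rfl hφ.2)).integrableOn_Icc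
      have := (intervalIntegral.continuousOn_primitive_interval hi).neg
      rw [uIcc_of_ge hφ.1.le] at this
      apply this.congr
      intro x _
      simp only [Pi.neg_apply]
      exact intervalIntegral.integral_symm _ _
    have hlim : Tendsto (fun ε => ∫ s in ε..φ, z s ^ 2) (nhdsWithin 0 (Ioo 0 φ))
        (nhds (∫ s in (0:ℝ)..φ, z s ^ 2)) :=
      (hcont 0 ⟨le_rfl, hφ.1.le⟩).mono Ioo_subset_Icc_self
    have : (nhdsWithin (0:ℝ) (Ioo 0 φ)).NeBot := by
      rw [nhdsWithin_Ioo_eq_nhdsGT hφ.1]; infer_instance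
    apply le_of_tendsto hlim
    filter_upwards [self_mem_nhdsWithin] with ε hε
    exact hI2 φ hφ ε hε S hS hES
  set D := C1 * C2 * T ^ (k - 2) + 1 with hD
  have hDpos : 0 < D := by positivity
  set h := 1 / (2 * D) with hh
  have hhpos : 0 < h := by positivity
  -- one step
  have step : ∀ τ, 0 ≤ τ → (∀ s ∈ Ioc 0 (min T τ), E s = 0) →
      ∀ s ∈ Ioc 0 (min T (τ + h)), E s = 0 := by
    intro τ hτ hzero
    have hV0 : ∫ s in (0:ℝ)..(min T τ), |z s| = 0 := by
      rcases hτ.eq_or_lt with h0 | h0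
      · rw [← h0, min_eq_right hT.le]; simp
      · have hm : min T τ ∈ Ioc 0 T := ⟨lt_min hT h0, min_le_left _ _⟩
        have a1 := h2 _ hm 0 le_rfl (fun s hs => by rw [hzero s hs]; simp)
        have a2 := cs_interval (hz.mono (Icc_subset_Icc le_rfl hm.2)) hm.1.le
        have a3 : (∫ s in (0:ℝ)..(min T τ), |z s|) ^ 2 ≤ 0 := by
          refine a2.trans ?_
          apply mul_nonpos_of_nonneg_of_nonpos
          · linarith [hm.1]
          · simpa using a1
        exact pow_eq_zero_iff (two_ne_zero) |>.1 (le_antisymm a3 (sq_nonneg _))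
    have ind : ∀ n : ℕ, ∀ s ∈ Ioc 0 (min T (τ + h)), E s ≤ (C0 / 2 ^ n) * s ^ (2 * k) := by
      intro n
      induction n with
      | zero =>
        intro s hs
        simpa using (hE s ⟨hs.1, hs.2.trans (min_le_left _ _)⟩).2
      | succ n ih =>
        intro φ hφ
        have hφT : φ ∈ Ioc 0 T := ⟨hφ.1, hφ.2.trans (min_le_left _ _)⟩
        have hφ0 : 0 ≤ φ ^ (2 * k) := Real.rpow_nonneg hφ.1.le _
        rcases le_total φ τ with hc | hc
        · rw [hzero φ ⟨hφ.1, le_min hφT.2 hc⟩]; positivity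
        · have hτT : min T τ = τ := min_eq_right (hc.trans hφT.2)
          rw [hτT] at hV0
          set S := C0 / 2 ^ n with hS
          have hS0 : 0 ≤ S := by positivity
          have b1 := h1 φ hφT
          have b2 := h2 φ hφT S hS0 (fun s hs => ih s ⟨hs.1, hs.2.trans hφ.2⟩)
          have mτ : τ ∈ Icc 0 T := ⟨hτ, hc.trans hφT.2⟩
          have m0 : (0:ℝ) ∈ Icc 0 T := ⟨le_rfl, hT.le⟩
          have mφ : φ ∈ Icc 0 T := ⟨hφ.1.le, hφT.2⟩
          have c1 := intervalIntegral.integral_add_adjacent_intervals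
            (intervalInt_of_contOn hza m0 mτ) (intervalInt_of_contOn hza mτ mφ)
          have c2 := intervalIntegral.integral_add_adjacent_intervals
            (intervalInt_of_contOn hz2 m0 mτ) (intervalInt_of_contOn hz2 mτ mφ)
          have c3 : 0 ≤ ∫ s in (0:ℝ)..τ, z s ^ 2 :=
            intervalIntegral.integral_nonneg hτ (fun s _ => sq_nonneg _)
          have c4 := cs_interval (hz.mono (Icc_subset_Icc hτ hφT.2)) hc
          rw [← c1, hV0, zero_add] at b1
          have hφh : φ - τ ≤ h := by linarith [hφ.2.trans (min_le_right _ _)]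
          have d1 : (∫ s in τ..φ, |z s|) ^ 2 ≤ h * (C2 * S * φ ^ k) := by
            refine c4.trans ?_
            apply mul_le_mul hφh (by linarith) _ hhpos.le
            exact intervalIntegral.integral_nonneg hc (fun s _ => sq_nonneg _)
          have hp : 0 ≤ φ ^ (2 * k - 2) := Real.rpow_nonneg hφ.1.le _
          have d2 : E φ ≤ C1 * φ ^ (2 * k - 2) * (h * (C2 * S * φ ^ k)) :=
            b1.trans (mul_le_mul_of_nonneg_left d1 (by positivity))
          have d3 : φ ^ (2 * k - 2) * φ ^ k = φ ^ (2 * k) * φ ^ (k - 2) := by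
            rw [← Real.rpow_add hφ.1, ← Real.rpow_add hφ.1]; ring_nf
          have d4 : φ ^ (k - 2) ≤ T ^ (k - 2) :=
            Real.rpow_le_rpow hφ.1.le hφT.2 (by linarith)
          have d5 : C1 * φ ^ (2 * k - 2) * (h * (C2 * S * φ ^ k))
              = (C1 * C2 * φ ^ (k - 2)) * h * S * φ ^ (2 * k) := by
            calc _ = C1 * C2 * h * S * (φ ^ (2 * k - 2) * φ ^ k) := by ring
              _ = _ := by rw [d3]; ring
          have d6 : C1 * C2 * φ ^ (k - 2) ≤ D := by
            have := mul_le_mul_of_nonneg_left d4 (mul_nonneg hC1 hC2)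
            linarith
          have d7 : D * h = 1 / 2 := by rw [hh]; field_simp
          have d8 : C1 * C2 * φ ^ (k - 2) * h ≤ 1 / 2 := by
            rw [← d7]; exact mul_le_mul_of_nonneg_right d6 hhpos.le
          rw [d5] at d2
          refine d2.trans ?_
          have : C0 / 2 ^ (n + 1) = 1 / 2 * S := by rw [hS, pow_succ]; field_simp
          rw [this]
          gcongr
    intro s hs
    have hlim : Tendsto (fun n : ℕ => C0 / 2 ^ n * s ^ (2 * k)) atTop (nhds 0) := by
      have : Tendsto (fun n : ℕ => C0 * (1 / 2 : ℝ) ^ n * s ^ (2 * k)) atTop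
          (nhds (C0 * 0 * s ^ (2 * k))) :=
        ((tendsto_pow_atTop_nhds_zero_of_lt_one (by norm_num) (by norm_num)).const_mul
          _).mul_const _
      simpa [div_eq_mul_inv] using this
    apply le_antisymm _ (hE s ⟨hs.1, hs.2.trans (min_le_left _ _)⟩).1
    exact ge_of_tendsto hlim (Eventually.of_forall fun n => ind n s hs)
  have all : ∀ n : ℕ, ∀ s ∈ Ioc 0 (min T (n * h)), E s = 0 := by
    intro n
    induction n with
    | zero => intro s hs; simp [hT.le] at hs
    | succ n ih =>
      have := step (n * h) (by positivity) ih
      intro s hs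
      apply this s
      push_cast at hs
      rwa [add_mul, one_mul] at hs
  intro s hs
  obtain ⟨n, hn⟩ := exists_nat_ge (T / h)
  apply all n s ⟨hs.1, le_min hs.2 _⟩
  rw [div_le_iff₀ hhpos] at hn
  linarith [hs.2]


lemma mem_rect_nhds_x {a b c d : ℝ} {p : ℝ × ℝ} (hp : p ∈ Ioo a b ×ˢ Ioo c d) :
    ∀ᶠ x in nhds p.1, (x, p.2) ∈ Ioo a b ×ˢ Ioo c d := by
  filter_upwards [Ioo_mem_nhds hp.1.1 hp.1.2] with x hx
  exact ⟨hx, hp.2⟩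

lemma mem_rect_nhds_y {a b c d : ℝ} {p : ℝ × ℝ} (hp : p ∈ Ioo a b ×ˢ Ioo c d) :
    ∀ᶠ y in nhds p.2, (p.1, y) ∈ Ioo a b ×ˢ Ioo c d := by
  filter_upwards [Ioo_mem_nhds hp.2.1 hp.2.2] with x hx
  exact ⟨hp.1, hx⟩

lemma pdx_congr {F G : ℝ × ℝ → ℝ} {a b c d : ℝ} (h : ∀ p ∈ Ioo a b ×ˢ Ioo c d, F p = G p)
    {p : ℝ × ℝ} (hp : p ∈ Ioo a b ×ˢ Ioo c d) : pdx F p = pdx G p := by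
  apply Filter.EventuallyEq.deriv_eq
  filter_upwards [mem_rect_nhds_x hp] with x hx using h _ hx

lemma pdy_congr {F G : ℝ × ℝ → ℝ} {a b c d : ℝ} (h : ∀ p ∈ Ioo a b ×ˢ Ioo c d, F p = G p)
    {p : ℝ × ℝ} (hp : p ∈ Ioo a b ×ˢ Ioo c d) : pdy F p = pdy G p := by
  apply Filter.EventuallyEq.deriv_eq
  filter_upwards [mem_rect_nhds_y hp] with x hx using h _ hx

lemma Ioo_sub_Icc_prod {a b c d : ℝ} : Ioo a b ×ˢ Ioo c d ⊆ Icc a b ×ˢ Icc c d :=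
  prod_mono Ioo_subset_Icc_self Ioo_subset_Icc_self

lemma lip_x {F : ℝ × ℝ → ℝ} {L : NNReal} (h : LipschitzWith L F) (y : ℝ) :
    LipschitzWith L (fun x => F (x, y)) := by
  apply LipschitzWith.of_dist_le_mul
  intro a b
  have := h.dist_le_mul (a, y) (b, y)
  simpa [Prod.dist_eq] using this

lemma lip_y {F : ℝ × ℝ → ℝ} {L : NNReal} (h : LipschitzWith L F) (x : ℝ) :
    LipschitzWith L (fun y => F (x, y)) := by
  apply LipschitzWith.of_dist_le_mul
  intro a b
  have := h.dist_le_mul (x, a) (x, b)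
  simpa [Prod.dist_eq] using this

lemma pdx_meas {F : ℝ × ℝ → ℝ} (h : Continuous F) : Measurable (pdx F) := by
  have h1 : Measurable fun p : ℝ × ℝ => deriv ((fun (y x : ℝ) => F (x, y)) p.1) p.2 :=
    measurable_deriv_with_param (f := fun (y x : ℝ) => F (x, y))
      (by unfold Function.uncurry; fun_prop)
  exact h1.comp measurable_swap

lemma pdy_meas {F : ℝ × ℝ → ℝ} (h : Continuous F) : Measurable (pdy F) := by
  have h1 : Measurable fun p : ℝ × ℝ => deriv ((fun (x y : ℝ) => F (x, y)) p.1) p.2 :=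
    measurable_deriv_with_param (f := fun (x y : ℝ) => F (x, y))
      (by unfold Function.uncurry; fun_prop)
  exact h1

lemma pdx_bound {F : ℝ × ℝ → ℝ} {L : NNReal} (h : LipschitzWith L F) (p : ℝ × ℝ) :
    |pdx F p| ≤ L := norm_deriv_le_of_lipschitz (lip_x h p.2)

lemma pdy_bound {F : ℝ × ℝ → ℝ} {L : NNReal} (h : LipschitzWith L F) (p : ℝ × ℝ) :
    |pdy F p| ≤ L := norm_deriv_le_of_lipschitz (lip_y h p.1)

lemma int_rect {h : ℝ × ℝ → ℝ} (hm : Measurable h) {C : ℝ} (hC : ∀ p, |h p| ≤ C) (a b c d : ℝ) :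
    IntegrableOn h (Ioo a b ×ˢ Ioo c d) := by
  apply Measure.integrableOn_of_bounded (M := C) _ hm.aestronglyMeasurable
    (Eventually.of_forall hC)
  rw [Measure.volume_eq_prod, Measure.prod_prod]
  exact (ENNReal.mul_lt_top measure_Ioo_lt_top measure_Ioo_lt_top).ne

lemma ftc_lip {u : ℝ → ℝ} {L : NNReal} (h : LipschitzWith L u) (a b : ℝ) :
    ∫ x in a..b, deriv u x = u b - u a :=
  (h.lipschitzOnWith.absolutelyContinuousOnInterval).integral_deriv_eq_sub

lemma int_pdx {F : ℝ × ℝ → ℝ} {L : NNReal} (h : LipschitzWith L F) {a b c d : ℝ} (hab : a ≤ b)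
    (hcd : c ≤ d) :
    ∫ p in Ioo a b ×ˢ Ioo c d, pdx F p = (∫ y in c..d, F (b, y)) - ∫ y in c..d, F (a, y) := by
  have hc := h.continuous
  have hi := int_rect (pdx_meas hc) (pdx_bound h) a b c d
  rw [Measure.volume_eq_prod] at hi ⊢
  rw [setIntegral_prod_swap (μ := volume) (ν := volume) (Ioo a b) (Ioo c d) (pdx F) |>.symm]
  rw [setIntegral_prod (fun z : ℝ × ℝ => pdx F z.swap) hi.swap]
  rw [← intervalIntegral.integral_sub]
  · rw [intervalIntegral.integral_of_le hcd, integral_Ioc_eq_integral_Ioo]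
    apply integral_congr_ae
    refine Eventually.of_forall fun y => ?_
    beta_reduce
    simp only [Prod.swap_prod_mk]
    rw [← integral_Ioc_eq_integral_Ioo, ← intervalIntegral.integral_of_le hab]
    exact ftc_lip (lip_x h y) a b
  · exact (lip_y h b).continuous.intervalIntegrable _ _
  · exact (lip_y h a).continuous.intervalIntegrable _ _

lemma int_pdy {F : ℝ × ℝ → ℝ} {L : NNReal} (h : LipschitzWith L F) {a b c d : ℝ} (hab : a ≤ b)
    (hcd : c ≤ d) :
    ∫ p in Ioo a b ×ˢ Ioo c d, pdy F p = (∫ x in a..b, F (x, d)) - ∫ x in a..b, F (x, c) := by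
  have hc := h.continuous
  have hi := int_rect (pdy_meas hc) (pdy_bound h) a b c d
  rw [Measure.volume_eq_prod] at hi ⊢
  rw [setIntegral_prod _ hi]
  rw [← intervalIntegral.integral_sub]
  · rw [intervalIntegral.integral_of_le hab, integral_Ioc_eq_integral_Ioo]
    apply integral_congr_ae
    refine Eventually.of_forall fun y => ?_
    beta_reduce
    rw [← integral_Ioc_eq_integral_Ioo, ← intervalIntegral.integral_of_le hcd]
    exact ftc_lip (lip_y h y) c d
  · exact (lip_x h d).continuous.intervalIntegrable _ _
  · exact (lip_x h c).continuous.intervalIntegrable _ _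

/-- Divergence inequality for Lipschitz fields on a rectangle. -/
lemma div_ineq {F G H : ℝ × ℝ → ℝ} {a b c d : ℝ} (hab : a ≤ b) (hcd : c ≤ d)
    (hF : ∃ L, LipschitzOnWith L F (Icc a b ×ˢ Icc c d))
    (hG : ∃ L, LipschitzOnWith L G (Icc a b ×ˢ Icc c d))
    (hH : IntegrableOn H (Ioo a b ×ˢ Ioo c d))
    (hle : ∀ᵐ p ∂(volume.restrict (Ioo a b ×ˢ Ioo c d)), pdx F p + pdy G p ≤ H p) :
    (∫ y in c..d, F (b, y)) - (∫ y in c..d, F (a, y)) +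
      ((∫ x in a..b, G (x, d)) - ∫ x in a..b, G (x, c)) ≤ ∫ p in Ioo a b ×ˢ Ioo c d, H p := by
  obtain ⟨L, hF⟩ := hF
  obtain ⟨L', hG⟩ := hG
  obtain ⟨F', hF', eF⟩ := hF.extend_real
  obtain ⟨G', hG', eG⟩ := hG.extend_real
  have e1 : ∀ x ∈ Icc a b, ∫ y in c..d, F (x, y) = ∫ y in c..d, F' (x, y) := by
    intro x hx
    apply intervalIntegral.integral_congr
    rw [uIcc_of_le hcd]
    intro y hy
    exact eF (show (x, y) ∈ Icc a b ×ˢ Icc c d from ⟨hx, hy⟩)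
  have e2 : ∀ y ∈ Icc c d, ∫ x in a..b, G (x, y) = ∫ x in a..b, G' (x, y) := by
    intro y hy
    apply intervalIntegral.integral_congr
    rw [uIcc_of_le hab]
    intro x hx
    exact eG (show (x, y) ∈ Icc a b ×ˢ Icc c d from ⟨hx, hy⟩)
  rw [e1 b ⟨hab, le_rfl⟩, e1 a ⟨le_rfl, hab⟩, e2 d ⟨hcd, le_rfl⟩, e2 c ⟨le_rfl, hcd⟩]
  rw [← int_pdx hF' hab hcd, ← int_pdy hG' hab hcd, ← integral_add]
  · apply integral_mono_ae _ hH
    · have hmem : ∀ᵐ p ∂(volume.restrict (Ioo a b ×ˢ Ioo c d)), p ∈ Ioo a b ×ˢ Ioo c d :=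
        ae_restrict_mem (measurableSet_Ioo.prod measurableSet_Ioo)
      filter_upwards [hle, hmem] with p hp hpm
      rw [← pdx_congr (fun p hp => eF (Ioo_sub_Icc_prod hp)) hpm,
        ← pdy_congr (fun p hp => eG (Ioo_sub_Icc_prod hp)) hpm]
      exact hp
    · exact (int_rect (pdx_meas hF'.continuous) (pdx_bound hF') a b c d).add
        (int_rect (pdy_meas hG'.continuous) (pdy_bound hG') a b c d)
  · exact int_rect (pdx_meas hF'.continuous) (pdx_bound hF') a b c d
  · exact int_rect (pdy_meas hG'.continuous) (pdy_bound hG') a b c d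

/-- a.e. existence of both partial derivatives -/
lemma lip_ae_deriv {F : ℝ × ℝ → ℝ} {a b c d : ℝ}
    (hF : ∃ L, LipschitzOnWith L F (Icc a b ×ˢ Icc c d)) :
    ∀ᵐ p ∂(volume.restrict (Ioo a b ×ˢ Ioo c d)),
      HasDerivAt (fun x => F (x, p.2)) (pdx F p) p.1 ∧
      HasDerivAt (fun y => F (p.1, y)) (pdy F p) p.2 := by
  obtain ⟨L, hF⟩ := hF
  obtain ⟨F', hF', eF⟩ := hF.extend_real
  have hmem : ∀ᵐ p ∂(volume.restrict (Ioo a b ×ˢ Ioo c d)), p ∈ Ioo a b ×ˢ Ioo c d :=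
    ae_restrict_mem (measurableSet_Ioo.prod measurableSet_Ioo)
  have hd : ∀ᵐ p ∂(volume.restrict (Ioo a b ×ˢ Ioo c d)), DifferentiableAt ℝ F' p :=
    ae_restrict_of_ae hF'.ae_differentiableAt
  filter_upwards [hmem, hd] with p hp hdp
  constructor
  · apply DifferentiableAt.hasDerivAt
    have h1 : DifferentiableAt ℝ (fun x => F' (x, p.2)) p.1 :=
      DifferentiableAt.comp (f := fun x : ℝ => (x, p.2)) p.1 (by simpa using hdp) (by fun_prop)
    apply h1.congr_of_eventuallyEq
    filter_upwards [mem_rect_nhds_x hp] with x hx using eF (Ioo_sub_Icc_prod hx)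
  · apply DifferentiableAt.hasDerivAt
    have h1 : DifferentiableAt ℝ (fun y => F' (p.1, y)) p.2 :=
      DifferentiableAt.comp (f := fun y : ℝ => (p.1, y)) p.2 (by simpa using hdp) (by fun_prop)
    apply h1.congr_of_eventuallyEq
    filter_upwards [mem_rect_nhds_y hp] with x hx using eF (Ioo_sub_Icc_prod hx)

/-- products of Lipschitz functions on compact sets -/
lemma lip_mul {F G : ℝ × ℝ → ℝ} {s : Set (ℝ × ℝ)} (hs : IsCompact s)
    (hF : ∃ L, LipschitzOnWith L F s) (hG : ∃ L, LipschitzOnWith L G s) :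
    ∃ L, LipschitzOnWith L (fun p => F p * G p) s := by
  obtain ⟨L, hF⟩ := hF
  obtain ⟨L', hG⟩ := hG
  obtain ⟨A, hA⟩ := hs.exists_bound_of_continuousOn hF.continuousOn
  obtain ⟨B, hB⟩ := hs.exists_bound_of_continuousOn hG.continuousOn
  refine ⟨L * B.toNNReal + A.toNNReal * L', LipschitzOnWith.of_dist_le_mul fun p hp q hq => ?_⟩
  have h1 := hF.dist_le_mul p hp q hq
  have h2 := hG.dist_le_mul p hp q hq
  have h3 := hB p hp
  have h4 := hA q hq
  rw [Real.norm_eq_abs] at h3 h4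
  rw [Real.dist_eq] at h1 h2 ⊢
  push_cast
  have hB0 := Real.le_coe_toNNReal B
  have hA0 := Real.le_coe_toNNReal A
  have : F p * G p - F q * G q = (F p - F q) * G p + F q * (G p - G q) := by ring
  rw [this]
  calc _ ≤ |F p - F q| * |G p| + |F q| * |G p - G q| := by
        rw [← abs_mul, ← abs_mul]; exact abs_add_le _ _
    _ ≤ (L * dist p q) * B.toNNReal + A.toNNReal * (L' * dist p q) := by
        gcongr
        · exact h3.trans hB0
        · exact h4.trans hA0
    _ = _ := by ring

lemma lip_add {F G : ℝ × ℝ → ℝ} {s : Set (ℝ × ℝ)}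
    (hF : ∃ L, LipschitzOnWith L F s) (hG : ∃ L, LipschitzOnWith L G s) :
    ∃ L, LipschitzOnWith L (fun p => F p + G p) s := by
  obtain ⟨L, hF⟩ := hF
  obtain ⟨L', hG⟩ := hG
  exact ⟨L + L', hF.add hG⟩

lemma lip_sub {F G : ℝ × ℝ → ℝ} {s : Set (ℝ × ℝ)}
    (hF : ∃ L, LipschitzOnWith L F s) (hG : ∃ L, LipschitzOnWith L G s) :
    ∃ L, LipschitzOnWith L (fun p => F p - G p) s := by
  obtain ⟨L, hF⟩ := hF
  obtain ⟨L', hG⟩ := hG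
  exact ⟨L + L', hF.sub hG⟩


lemma bdd_locInt {h : ℝ → ℝ} (hm : Measurable h) {C : ℝ} (hC : ∀ x, |h x| ≤ C) :
    LocallyIntegrable h volume := by
  intro x
  refine ⟨Ioo (x - 1) (x + 1), Ioo_mem_nhds (by linarith) (by linarith), ?_⟩
  exact Measure.integrableOn_of_bounded (M := C) measure_Ioo_lt_top.ne hm.aestronglyMeasurable
    (Eventually.of_forall hC)

lemma bdd_intervalInt {h : ℝ → ℝ} (hm : Measurable h) {C : ℝ} (hC : ∀ x, |h x| ≤ C) (a b : ℝ) :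
    IntervalIntegrable h volume a b :=
  ((bdd_locInt hm hC).integrableOn_isCompact isCompact_uIcc).intervalIntegrable

/-- one-dimensional integration by parts -/
lemma parts_one {h σ : ℝ → ℝ} (hm : Measurable h) {C : ℝ} (hC : ∀ x, |h x| ≤ C)
    (hσ : Continuous σ) (m : ℝ) :
    ∫ y in (0:ℝ)..m, h y * (∫ s in y..m, σ s) = ∫ y in (0:ℝ)..m, (∫ s in (0:ℝ)..y, h s) * σ y := by
  have hI := bdd_intervalInt hm hC
  have hac : AbsolutelyContinuousOnInterval (fun y => ∫ s in (0:ℝ)..y, h s) 0 m :=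
    (hI 0 m).absolutelyContinuousOnInterval_intervalIntegral (by simp)
  have hd : ∀ y, HasDerivAt (fun y => ∫ s in y..m, σ s) (-σ y) y := fun y =>
    intervalIntegral.integral_hasDerivAt_left (hσ.intervalIntegrable _ _)
      (hσ.stronglyMeasurableAtFilter _ _) hσ.continuousAt
  have hac2 : AbsolutelyContinuousOnInterval (fun y => ∫ s in y..m, σ s) 0 m := by
    have := ((hσ.intervalIntegrable (μ := volume) 0 m).absolutelyContinuousOnInterval_intervalIntegral
      (c := m) (by simp)).neg
    convert! this using 1
    funext y
    exact intervalIntegral.integral_symm _ _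
  have key := hac2.integral_mul_deriv_eq_deriv_mul hac
  simp only [intervalIntegral.integral_same, zero_mul, mul_zero, sub_zero, zero_sub] at key
  have e1 : ∫ y in (0:ℝ)..m, h y * (∫ s in y..m, σ s) =
      ∫ x in (0:ℝ)..m, (∫ s in x..m, σ s) * deriv (fun y => ∫ s in (0:ℝ)..y, h s) x := by
    apply intervalIntegral.integral_congr_ae
    filter_upwards [LocallyIntegrable.ae_hasDerivAt_integral (bdd_locInt hm hC)] with y hy _
    rw [(hy 0).deriv, mul_comm]
  rw [e1, key, ← intervalIntegral.integral_neg]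
  apply intervalIntegral.integral_congr
  intro y _
  simp only [(hd y).deriv]
  ring

/-- product test functions separate bounded functions -/
lemma ext_prod_test {μ : Measure (ℝ × ℝ)} [IsFiniteMeasure μ] {h : ℝ × ℝ → ℝ} (hm : Measurable h)
    {M : ℝ} (hM : ∀ᵐ p ∂μ, |h p| ≤ M)
    (htest : ∀ (η σ : BoundedContinuousFunction ℝ ℝ), ∫ p, η p.1 * σ p.2 * h p ∂μ = 0) :
    ∀ᵐ p ∂μ, h p = 0 := by
  have hfm : Measurable (fun p => (h p + |M|).toNNReal) := (hm.add_const _).real_toNNReal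
  have hgm : Measurable (fun _ : ℝ × ℝ => (|M|).toNNReal) := measurable_const
  have f1 : ∫⁻ p, ((h p + |M|).toNNReal : ENNReal) ∂μ ≠ ⊤ := by
    have : ∫⁻ p, ((h p + |M|).toNNReal : ENNReal) ∂μ ≤ ∫⁻ p, ((2 * |M|).toNNReal : ENNReal) ∂μ := by
      apply lintegral_mono_ae
      filter_upwards [hM] with p hp
      norm_cast
      apply Real.toNNReal_le_toNNReal
      have := le_abs_self (h p); have := le_abs_self M
      linarith
    refine ne_top_of_le_ne_top ?_ this
    rw [lintegral_const]
    exact ENNReal.mul_ne_top ENNReal.coe_ne_top (measure_ne_top _ _)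
  have f2 : ∫⁻ _ : ℝ × ℝ, ((|M|).toNNReal : ENNReal) ∂μ ≠ ⊤ := by
    rw [lintegral_const]
    exact ENNReal.mul_ne_top ENNReal.coe_ne_top (measure_ne_top _ _)
  have : IsFiniteMeasure (μ.withDensity fun p => ((h p + |M|).toNNReal : ENNReal)) :=
    isFiniteMeasure_withDensity f1
  have : IsFiniteMeasure (μ.withDensity fun _ => ((|M|).toNNReal : ENNReal)) :=
    isFiniteMeasure_withDensity f2
  have heq : (μ.withDensity fun p => ((h p + |M|).toNNReal : ENNReal)) =
      μ.withDensity fun _ => ((|M|).toNNReal : ENNReal) := by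
    apply Measure.ext_of_integral_mul_boundedContinuousFunction
    intro η σ
    rw [integral_withDensity_eq_integral_smul hfm, integral_withDensity_eq_integral_smul hgm]
    have hps : Measurable (fun p : ℝ × ℝ => η p.1 * σ p.2) := by
      have := η.continuous.measurable; have := σ.continuous.measurable; fun_prop
    have hpsb : ∀ p : ℝ × ℝ, ‖η p.1 * σ p.2‖ ≤ ‖η‖ * ‖σ‖ := fun p => by
      rw [norm_mul]
      exact mul_le_mul (η.norm_coe_le_norm _) (σ.norm_coe_le_norm _) (norm_nonneg _)
        (norm_nonneg _)
    have i1 : Integrable (fun p : ℝ × ℝ => η p.1 * σ p.2 * h p) μ := by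
      apply Integrable.of_bound (C := ‖η‖ * ‖σ‖ * M) (hps.mul hm).aestronglyMeasurable
      filter_upwards [hM] with p hp
      rw [Pi.mul_apply, norm_mul]
      exact mul_le_mul (hpsb p) hp (norm_nonneg _) (by positivity)
    have i2 : Integrable (fun p : ℝ × ℝ => |M| * (η p.1 * σ p.2)) μ := by
      apply Integrable.const_mul
      exact Integrable.of_bound (C := ‖η‖ * ‖σ‖) hps.aestronglyMeasurable
        (Eventually.of_forall hpsb)
    have e1 : ∫ p, (h p + |M|).toNNReal • (η p.1 * σ p.2) ∂μ =
        ∫ p, (η p.1 * σ p.2 * h p + |M| * (η p.1 * σ p.2)) ∂μ := by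
      apply integral_congr_ae
      filter_upwards [hM] with p hp
      have := neg_abs_le (h p); have := le_abs_self M
      rw [NNReal.smul_def, Real.coe_toNNReal _ (by linarith), smul_eq_mul]
      ring
    rw [e1, integral_add i1 i2, htest, zero_add]
    apply integral_congr_ae
    refine Eventually.of_forall fun p => ?_
    simp [NNReal.smul_def, abs_nonneg]
  have := (withDensity_eq_iff hfm.coe_nnreal_ennreal.aemeasurable
    hgm.coe_nnreal_ennreal.aemeasurable f1).1 heq
  filter_upwards [this, hM] with p hp hb
  have hp' : (h p + |M|).toNNReal = (|M|).toNNReal := by exact_mod_cast hp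
  have h1 := neg_abs_le (h p); have h2 := le_abs_self M
  have := congrArg NNReal.toReal hp'
  rw [Real.coe_toNNReal _ (by linarith), Real.coe_toNNReal _ (abs_nonneg _)] at this
  linarith

lemma ext_one_test {a b : ℝ} {h : ℝ → ℝ} (hm : Measurable h) {M : ℝ}
    (hM : ∀ x ∈ Ioo a b, |h x| ≤ M)
    (htest : ∀ η : ℝ → ℝ, Continuous η → ∫ x in Ioo a b, η x * h x = 0) :
    ∀ᵐ x ∂(volume.restrict (Ioo a b)), h x = 0 := by
  have hi : Integrable ((Ioo a b).indicator h) := by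
    rw [integrable_indicator_iff measurableSet_Ioo]
    apply Measure.integrableOn_of_bounded (M := M) measure_Ioo_lt_top.ne hm.aestronglyMeasurable
    filter_upwards [ae_restrict_mem measurableSet_Ioo] with x hx using hM x hx
  have := ae_eq_zero_of_integral_contDiff_smul_eq_zero hi.locallyIntegrable (by
    intro g hg _
    have := htest g hg.continuous
    rw [← integral_indicator measurableSet_Ioo] at this
    rw [← this]
    congr 1
    funext x
    by_cases hx : x ∈ Ioo a b <;> simp [hx])
  rw [ae_restrict_iff' measurableSet_Ioo]
  filter_upwards [this] with x hx hx2
  simpa [hx2] using hx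


/-- primitive in the second variable -/
def primY (α : ℝ × ℝ → ℝ) (p : ℝ × ℝ) : ℝ := ∫ s in (0:ℝ)..p.2, α (p.1, s)

lemma primY_meas {α : ℝ × ℝ → ℝ} (hα : Measurable α) : Measurable (primY α) := by
  have key : ∀ A : Set ((ℝ × ℝ) × ℝ), MeasurableSet A →
      Measurable (fun p : ℝ × ℝ => ∫ s, A.indicator (fun q : (ℝ × ℝ) × ℝ => α (q.1.1, q.2)) (p, s)) := by
    intro A hA
    have : StronglyMeasurable (A.indicator (fun q : (ℝ × ℝ) × ℝ => α (q.1.1, q.2))) := by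
      apply StronglyMeasurable.indicator _ hA
      exact (hα.comp (by fun_prop)).stronglyMeasurable
    exact this.integral_prod_right'.measurable
  have h1 := key {q | 0 < q.2 ∧ q.2 ≤ q.1.2}
    ((measurableSet_lt measurable_const measurable_snd).inter
      (measurableSet_le measurable_snd (by fun_prop)))
  have h2 := key {q | q.1.2 < q.2 ∧ q.2 ≤ 0}
    ((measurableSet_lt (by fun_prop) measurable_snd).inter
      (measurableSet_le measurable_snd measurable_const))
  convert! h1.sub h2 using 1
  funext p
  simp only [primY, intervalIntegral, Pi.sub_apply]
  rw [← integral_indicator measurableSet_Ioc, ← integral_indicator measurableSet_Ioc]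
  rfl

lemma prim_dist {h : ℝ → ℝ} (hm : Measurable h) {C : ℝ} (hC : ∀ x, |h x| ≤ C) (x y : ℝ) :
    |(∫ s in (0:ℝ)..x, h s) - ∫ s in (0:ℝ)..y, h s| ≤ C * |x - y| := by
  rw [intervalIntegral.integral_interval_sub_left (bdd_intervalInt hm hC _ _)
    (bdd_intervalInt hm hC _ _)]
  have := intervalIntegral.norm_integral_le_of_norm_le_const (f := h) (a := y) (b := x) (C := C)
    (fun s _ => by rw [Real.norm_eq_abs]; exact hC s)
  simpa [Real.norm_eq_abs] using this

lemma int_bdd_cont {α u : ℝ × ℝ → ℝ} (hα : Measurable α) {C a b c d : ℝ}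
    (hC : ∀ p ∈ Ioo a b ×ˢ Ioo c d, |α p| ≤ C) (hu : Continuous u) :
    IntegrableOn (fun p => α p * u p) (Ioo a b ×ˢ Ioo c d) := by
  have hu1 : IntegrableOn u (Ioo a b ×ˢ Ioo c d) :=
    (hu.continuousOn.integrableOn_compact (isCompact_Icc.prod isCompact_Icc)).mono_set
      Ioo_sub_Icc_prod
  apply Integrable.bdd_mul (c := C) hu1 hα.aestronglyMeasurable
  filter_upwards [ae_restrict_mem (measurableSet_Ioo.prod measurableSet_Ioo)] with p hp
    using hC p hp

lemma int_Ioo_eq {h : ℝ → ℝ} {m : ℝ} (hm : 0 ≤ m) : ∫ y in Ioo 0 m, h y = ∫ y in (0:ℝ)..m, h y := by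
  rw [intervalIntegral.integral_of_le hm, integral_Ioc_eq_integral_Ioo]

lemma fub_y {α : ℝ × ℝ → ℝ} (hα : Measurable α) {C : ℝ} (hC : ∀ p, |α p| ≤ C) {η σ : ℝ → ℝ}
    (hη : Continuous η) (hσ : Continuous σ) {z m : ℝ} (hm : 0 ≤ m) :
    ∫ p in Ioo 0 z ×ˢ Ioo 0 m, α p * (η p.1 * ∫ s in p.2..m, σ s) =
      ∫ p in Ioo 0 z ×ˢ Ioo 0 m, primY α p * (η p.1 * σ p.2) := by
  have hR : Continuous (fun y => ∫ s in y..m, σ s) := by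
    have hd : ∀ y, HasDerivAt (fun y => ∫ s in y..m, σ s) (-σ y) y := fun y =>
      intervalIntegral.integral_hasDerivAt_left (hσ.intervalIntegrable _ _)
        (hσ.stronglyMeasurableAtFilter _ _) hσ.continuousAt
    exact continuous_iff_continuousAt.2 fun x => (hd x).continuousAt
  have hb : ∀ p ∈ Ioo 0 z ×ˢ Ioo 0 m, |primY α p| ≤ C * m := by
    intro p hp
    have := prim_dist (hα.comp measurable_prodMk_left) (fun s => hC (p.1, s)) p.2 0
    simp only [intervalIntegral.integral_same, sub_zero] at this
    refine this.trans ?_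
    rw [abs_of_pos hp.2.1]
    have : 0 ≤ C := (abs_nonneg _).trans (hC 0)
    exact mul_le_mul_of_nonneg_left hp.2.2.le this
  have i1 := int_bdd_cont (u := fun p : ℝ × ℝ => η p.1 * ∫ s in p.2..m, σ s)
    (a := 0) (b := z) (c := 0) (d := m) hα (fun p _ => hC p) (by fun_prop)
  have i2 := int_bdd_cont (u := fun p : ℝ × ℝ => η p.1 * σ p.2) (primY_meas hα) hb (by fun_prop)
  rw [Measure.volume_eq_prod] at i1 i2 ⊢
  rw [setIntegral_prod _ i1, setIntegral_prod _ i2]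
  apply integral_congr_ae
  refine Eventually.of_forall fun x => ?_
  beta_reduce
  rw [int_Ioo_eq hm, int_Ioo_eq hm]
  have := parts_one (h := fun s => α (x, s)) (hα.comp measurable_prodMk_left)
    (fun s => hC (x, s)) hσ m
  have e1 : ∫ y in (0:ℝ)..m, α (x, y) * (η x * ∫ s in y..m, σ s) =
      η x * ∫ y in (0:ℝ)..m, α (x, y) * ∫ s in y..m, σ s := by
    rw [← intervalIntegral.integral_const_mul]; congr 1; funext y; ring
  have e2 : ∫ y in (0:ℝ)..m, primY α (x, y) * (η x * σ y) =
      η x * ∫ y in (0:ℝ)..m, (∫ s in (0:ℝ)..y, α (x, s)) * σ y := by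
    rw [← intervalIntegral.integral_const_mul]; congr 1; funext y; simp only [primY]; ring
  simp only [e1, e2, this]

lemma fub_x {β : ℝ × ℝ → ℝ} (hβ : Measurable β) {C : ℝ} (hC : ∀ p, |β p| ≤ C) {η σ : ℝ → ℝ}
    (hη : Continuous η) (hσ : Continuous σ) {z m : ℝ} (hz : 0 ≤ z) :
    ∫ p in Ioo 0 z ×ˢ Ioo 0 m, β p * ((∫ s in p.1..z, η s) * σ p.2) =
      ∫ p in Ioo 0 z ×ˢ Ioo 0 m, primY (fun q => β q.swap) p.swap * (η p.1 * σ p.2) := by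
  have h := fub_y (α := fun q => β q.swap) (hβ.comp measurable_swap) (fun p => hC _) hσ hη
    (z := m) (m := z) hz
  rw [Measure.volume_eq_prod] at h ⊢
  rw [← setIntegral_prod_swap (μ := volume) (ν := volume) (Ioo 0 m) (Ioo 0 z)
    (fun p : ℝ × ℝ => β p.swap * (σ p.1 * ∫ s in p.2..z, η s)),
    ← setIntegral_prod_swap (μ := volume) (ν := volume) (Ioo 0 m) (Ioo 0 z)
    (fun p : ℝ × ℝ => primY (fun q => β q.swap) p * (σ p.1 * η p.2))] at h
  simp only [Prod.swap_swap, Prod.fst_swap, Prod.snd_swap] at h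
  convert! h using 3 <;> ring

lemma prim_contDiff {η : ℝ → ℝ} (hη : Continuous η) (z : ℝ) :
    ContDiff ℝ 1 (fun x => ∫ s in x..z, η s) ∧
      ∀ x, HasDerivAt (fun x => ∫ s in x..z, η s) (-η x) x := by
  have hd : ∀ y, HasDerivAt (fun y => ∫ s in y..z, η s) (-η y) y := fun y =>
    intervalIntegral.integral_hasDerivAt_left (hη.intervalIntegrable _ _)
      (hη.stronglyMeasurableAtFilter _ _) hη.continuousAt
  refine ⟨?_, hd⟩
  rw [contDiff_one_iff_deriv]
  refine ⟨fun x => (hd x).differentiableAt, ?_⟩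
  rw [show deriv (fun y => ∫ s in y..z, η s) = fun y => -η y from funext fun y => (hd y).deriv]
  exact hη.neg

/-- the weak formulation forces the two candidate stream functions to agree -/
lemma stream_ae {z m : ℝ} (hz : 0 < z) (hm : 0 < m) {α β : ℝ × ℝ → ℝ} (hα : Measurable α)
    (hβ : Measurable β) {C : ℝ} (hαC : ∀ p, |α p| ≤ C) (hβC : ∀ p, |β p| ≤ C)
    {g : ℝ → ℝ} (hg : Continuous g) (hgC : ∀ x, |g x| ≤ C)
    (hw : ∀ ξ : ℝ × ℝ → ℝ, ContDiff ℝ 1 ξ → (∀ ψ ∈ Ioo (0:ℝ) m, ξ (z, ψ) = 0) →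
      (∫ p in Ioo 0 z ×ˢ Ioo 0 m, (α p * pdx ξ p + β p * pdy ξ p)) -
        ∫ φ in Ioo 0 z, g φ * ξ (φ, m) = 0) :
    (∀ᵐ p ∂(volume.restrict (Ioo 0 z ×ˢ Ioo 0 m)),
      -primY α p = primY (fun q => β q.swap) p.swap) ∧
    (∀ᵐ φ ∂(volume.restrict (Ioo 0 z)), -primY α (φ, m) = ∫ s in (0:ℝ)..φ, g s) := by
  have hC0 : 0 ≤ C := (abs_nonneg _).trans (hαC 0)
  have hb : ∀ p ∈ Icc 0 z ×ˢ Icc 0 m, |primY α p| ≤ C * m := by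
    intro p hp
    have := prim_dist (hα.comp measurable_prodMk_left) (fun s => hαC (p.1, s)) p.2 0
    simp only [intervalIntegral.integral_same, sub_zero] at this
    refine this.trans ?_
    rw [abs_of_nonneg hp.2.1]
    exact mul_le_mul_of_nonneg_left hp.2.2 hC0
  have hβs : Measurable (fun q : ℝ × ℝ => β q.swap) := hβ.comp measurable_swap
  have hb2 : ∀ p ∈ Ioo 0 z ×ˢ Ioo 0 m, |primY (fun q => β q.swap) p.swap| ≤ C * z := by
    intro p hp
    have := prim_dist (h := fun s => β (s, p.2)) (hβ.comp measurable_prodMk_right)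
      (fun s => hβC (s, p.2)) p.1 0
    simp only [intervalIntegral.integral_same, sub_zero] at this
    refine this.trans ?_
    rw [abs_of_pos hp.1.1]
    exact mul_le_mul_of_nonneg_left hp.1.2.le hC0
  constructor
  · have : IsFiniteMeasure ((volume : Measure (ℝ × ℝ)).restrict (Ioo 0 z ×ˢ Ioo 0 m)) := by
      constructor
      rw [Measure.restrict_apply_univ, Measure.volume_eq_prod, Measure.prod_prod]
      exact ENNReal.mul_lt_top measure_Ioo_lt_top measure_Ioo_lt_top
    have hm2 : Measurable (fun p : ℝ × ℝ => primY (fun q => β q.swap) p.swap) :=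
      (primY_meas hβs).comp measurable_swap
    have := ext_prod_test (μ := (volume : Measure (ℝ × ℝ)).restrict (Ioo 0 z ×ˢ Ioo 0 m))
      (h := fun p => primY α p + primY (fun q => β q.swap) p.swap) ((primY_meas hα).add hm2)
      (M := C * m + C * z)
      (by
        filter_upwards [ae_restrict_mem (measurableSet_Ioo.prod measurableSet_Ioo)] with p hp
        exact (abs_add_le _ _).trans (add_le_add (hb p (Ioo_sub_Icc_prod hp)) (hb2 p hp)))
      (by
        intro η σ
        obtain ⟨cP, dP⟩ := prim_contDiff η.continuous z
        obtain ⟨cR, dR⟩ := prim_contDiff σ.continuous m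
        have hξ := hw (fun p => (∫ s in p.1..z, η s) * ∫ s in p.2..m, σ s)
          ((cP.comp contDiff_fst).mul (cR.comp contDiff_snd)) (by simp)
        simp only [intervalIntegral.integral_same, mul_zero, integral_zero, sub_zero] at hξ
        have ex : ∀ p, pdx (fun p : ℝ × ℝ => (∫ s in p.1..z, η s) * ∫ s in p.2..m, σ s) p =
            -(η p.1 * ∫ s in p.2..m, σ s) := fun p => by
          exact ((dP p.1).mul_const (∫ s in p.2..m, σ s)).deriv.trans (by ring)
        have ey : ∀ p, pdy (fun p : ℝ × ℝ => (∫ s in p.1..z, η s) * ∫ s in p.2..m, σ s) p =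
            -((∫ s in p.1..z, η s) * σ p.2) := fun p => by
          exact ((dR p.2).const_mul (∫ s in p.1..z, η s)).deriv.trans (by ring)
        simp only [ex, ey, mul_neg] at hξ
        have i1 := int_bdd_cont (u := fun p : ℝ × ℝ => η p.1 * ∫ s in p.2..m, σ s)
          (a := 0) (b := z) (c := 0) (d := m) hα (fun p _ => hαC p)
          ((η.continuous.comp continuous_fst).mul (cR.continuous.comp continuous_snd))
        have i2 := int_bdd_cont (u := fun p : ℝ × ℝ => (∫ s in p.1..z, η s) * σ p.2)
          (a := 0) (b := z) (c := 0) (d := m) hβ (fun p _ => hβC p)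
          ((cP.continuous.comp continuous_fst).mul (σ.continuous.comp continuous_snd))
        rw [integral_add (f := fun p : ℝ × ℝ => -(α p * (η p.1 * ∫ s in p.2..m, σ s)))
          (g := fun p : ℝ × ℝ => -(β p * ((∫ s in p.1..z, η s) * σ p.2))) i1.neg i2.neg, integral_neg, integral_neg,
          fub_y hα hαC η.continuous σ.continuous hm.le,
          fub_x hβ hβC η.continuous σ.continuous hz.le] at hξ
        have cc : Continuous (fun p : ℝ × ℝ => η p.1 * σ p.2) :=
          (η.continuous.comp continuous_fst).mul (σ.continuous.comp continuous_snd)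
        have i3 := int_bdd_cont (u := fun p : ℝ × ℝ => η p.1 * σ p.2) (primY_meas hα)
          (fun p hp => hb p (Ioo_sub_Icc_prod hp)) cc
        have i4 := int_bdd_cont (u := fun p : ℝ × ℝ => η p.1 * σ p.2) hm2 hb2 cc
        have : ∫ p in Ioo 0 z ×ˢ Ioo 0 m, η p.1 * σ p.2 *
            (primY α p + primY (fun q => β q.swap) p.swap) =
            (∫ p in Ioo 0 z ×ˢ Ioo 0 m, primY α p * (η p.1 * σ p.2)) +
            ∫ p in Ioo 0 z ×ˢ Ioo 0 m, primY (fun q => β q.swap) p.swap * (η p.1 * σ p.2) := by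
          rw [← integral_add i3 i4]; congr 1; funext p; ring
        rw [this]; linarith)
    filter_upwards [this] with p hp
    linarith
  · have hm1 : Measurable (fun φ => primY α (φ, m)) := (primY_meas hα).comp measurable_prodMk_right
    have hGc : Continuous (fun φ => ∫ s in (0:ℝ)..φ, g s) :=
      intervalIntegral.continuous_primitive (fun a b => hg.intervalIntegrable a b) 0
    have := ext_one_test (a := 0) (b := z) (h := fun φ => primY α (φ, m) + ∫ s in (0:ℝ)..φ, g s)
      (hm1.add hGc.measurable) (M := C * m + C * z)
      (by
        intro x hx
        refine (abs_add_le _ _).trans (add_le_add (hb (x, m) ⟨⟨hx.1.le, hx.2.le⟩, hm.le, le_rfl⟩) ?_)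
        have := prim_dist hg.measurable hgC x 0
        simp only [intervalIntegral.integral_same, sub_zero] at this
        refine this.trans ?_
        rw [abs_of_pos hx.1]
        exact mul_le_mul_of_nonneg_left hx.2.le hC0)
      (by
        intro η hη
        obtain ⟨cP, dP⟩ := prim_contDiff hη z
        have hξ := hw (fun p => ∫ s in p.1..z, η s) (cP.comp contDiff_fst) (by simp)
        have ex : ∀ p, pdx (fun p : ℝ × ℝ => ∫ s in p.1..z, η s) p = -η p.1 := fun p => by
          rw [pdx, (dP p.1).deriv]
        have ey : ∀ p, pdy (fun p : ℝ × ℝ => ∫ s in p.1..z, η s) p = 0 := fun p => by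
          simp [pdy]
        simp only [ex, ey, mul_neg, mul_zero, add_zero] at hξ
        have i1 := int_bdd_cont (u := fun p : ℝ × ℝ => η p.1)
          (a := 0) (b := z) (c := 0) (d := m) hα (fun p _ => hαC p) (by fun_prop)
        rw [integral_neg, int_Ioo_eq hz.le, parts_one hg.measurable hgC hη, Measure.volume_eq_prod,
          setIntegral_prod _ (by rw [Measure.volume_eq_prod] at i1; exact i1)] at hξ
        have e1 : ∫ x in Ioo 0 z, ∫ y in Ioo 0 m, α (x, y) * η x =
            ∫ x in (0:ℝ)..z, η x * primY α (x, m) := by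
          rw [int_Ioo_eq hz.le]
          congr 1; funext x
          rw [int_Ioo_eq hm.le, intervalIntegral.integral_mul_const, mul_comm]; rfl
        simp only [e1] at hξ
        rw [int_Ioo_eq hz.le]
        have j1 : IntervalIntegrable (fun x => η x * primY α (x, m)) volume 0 z := by
          rw [intervalIntegrable_iff_integrableOn_Ioo_of_le hz.le]
          have hη1 : IntegrableOn η (Ioo 0 z) :=
            (hη.continuousOn.integrableOn_compact isCompact_Icc).mono_set Ioo_subset_Icc_self
          apply Integrable.mul_bdd (c := C * m) hη1 hm1.aestronglyMeasurable
          filter_upwards [ae_restrict_mem measurableSet_Ioo] with x hx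
          exact hb (x, m) ⟨⟨hx.1.le, hx.2.le⟩, hm.le, le_rfl⟩
        have j2 : IntervalIntegrable (fun x => (∫ s in (0:ℝ)..x, g s) * η x) volume 0 z :=
          (hGc.mul hη).intervalIntegrable _ _
        have : ∫ x in (0:ℝ)..z, η x * (primY α (x, m) + ∫ s in (0:ℝ)..x, g s) =
            (∫ x in (0:ℝ)..z, η x * primY α (x, m)) +
            ∫ x in (0:ℝ)..z, (∫ s in (0:ℝ)..x, g s) * η x := by
          rw [← intervalIntegral.integral_add j1 j2]; congr 1; funext x; ring
        rw [this]; linarith)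
    filter_upwards [this] with p hp
    linarith


/-- an a.e. inequality on an open set extends to its closure by continuity -/
lemma ae_le_closure {X : Type*} [TopologicalSpace X] [MeasurableSpace X] [OpensMeasurableSpace X]
    {μ : Measure X} [μ.IsOpenPosMeasure] {U : Set X} (hU : IsOpen U) {u v : X → ℝ}
    (hu : ContinuousOn u (closure U)) (hv : ContinuousOn v (closure U))
    (h : ∀ᵐ x ∂(μ.restrict U), u x ≤ v x) : ∀ x ∈ closure U, u x ≤ v x := by
  have h1 : ∀ x ∈ U, u x ≤ v x := by
    have ho : IsOpen (U ∩ (fun x => u x - v x) ⁻¹' Ioi 0) :=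
      ((hu.sub hv).mono subset_closure).isOpen_inter_preimage hU isOpen_Ioi
    have h0 : μ (U ∩ (fun x => u x - v x) ⁻¹' Ioi 0) = 0 := by
      rw [ae_restrict_iff' hU.measurableSet, ae_iff] at h
      apply measure_mono_null _ h
      rintro x ⟨hx, hx2⟩
      simp only [mem_preimage, mem_Ioi, sub_pos] at hx2
      simp only [mem_ofPred_eq, Classical.not_imp, not_le]
      exact ⟨hx, hx2⟩
    rw [ho.measure_eq_zero_iff (μ := μ)] at h0
    intro x hx
    by_contra hc
    push Not at hc
    have : x ∈ U ∩ (fun x => u x - v x) ⁻¹' Ioi 0 := ⟨hx, by simpa using hc⟩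
    rw [h0] at this
    exact this
  intro x hx
  exact le_on_closure h1 hu hv hx

lemma ae_le_Icc {a b : ℝ} (hab : a < b) {u v : ℝ → ℝ}
    (hu : ContinuousOn u (Icc a b)) (hv : ContinuousOn v (Icc a b))
    (h : ∀ᵐ x ∂(volume.restrict (Ioo a b)), u x ≤ v x) : ∀ x ∈ Icc a b, u x ≤ v x := by
  have e := closure_Ioo hab.ne
  have := ae_le_closure (μ := volume) (isOpen_Ioo (a := a) (b := b)) (by rwa [e]) (by rwa [e]) h
  rwa [e] at this

lemma ae_eq_Icc {a b : ℝ} (hab : a < b) {u v : ℝ → ℝ}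
    (hu : ContinuousOn u (Icc a b)) (hv : ContinuousOn v (Icc a b))
    (h : ∀ᵐ x ∂(volume.restrict (Ioo a b)), u x = v x) : ∀ x ∈ Icc a b, u x = v x := fun x hx =>
  le_antisymm (ae_le_Icc hab hu hv (h.mono fun _ h => h.le) x hx)
    (ae_le_Icc hab hv hu (h.mono fun _ h => h.ge) x hx)

lemma ae_le_rect {a b c d : ℝ} (hab : a < b) (hcd : c < d) {u v : ℝ × ℝ → ℝ}
    (hu : ContinuousOn u (Icc a b ×ˢ Icc c d)) (hv : ContinuousOn v (Icc a b ×ˢ Icc c d))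
    (h : ∀ᵐ x ∂(volume.restrict (Ioo a b ×ˢ Ioo c d)), u x ≤ v x) :
    ∀ x ∈ Icc a b ×ˢ Icc c d, u x ≤ v x := by
  have e : closure (Ioo a b ×ˢ Ioo c d) = Icc a b ×ˢ Icc c d := by
    rw [closure_prod_eq, closure_Ioo hab.ne, closure_Ioo hcd.ne]
  have := ae_le_closure (μ := volume) (isOpen_Ioo (a := a) (b := b) |>.prod
    (isOpen_Ioo (a := c) (b := d))) (by rwa [e]) (by rwa [e]) h
  rwa [e] at this

lemma prim_cont {h : ℝ → ℝ} (hm : Measurable h) {C : ℝ} (hC : ∀ x, |h x| ≤ C) :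
    Continuous (fun x => ∫ s in (0:ℝ)..x, h s) := by
  have hC0 : 0 ≤ C := (abs_nonneg _).trans (hC 0)
  exact (LipschitzWith.of_dist_le_mul (K := ⟨C, hC0⟩) fun x y => by
    rw [Real.dist_eq, Real.dist_eq]; exact prim_dist hm hC x y).continuous

lemma stream_abstract {z m : ℝ} (hz : 0 < z) (hm : 0 < m) {α β : ℝ × ℝ → ℝ} (hα : Measurable α)
    (hβ : Measurable β) {C : ℝ} (hαC : ∀ p, |α p| ≤ C) (hβC : ∀ p, |β p| ≤ C)
    {g : ℝ → ℝ} (hg : Continuous g) (hgC : ∀ x, |g x| ≤ C)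
    (hw : ∀ ξ : ℝ × ℝ → ℝ, ContDiff ℝ 1 ξ → (∀ ψ ∈ Ioo (0:ℝ) m, ξ (z, ψ) = 0) →
      (∫ p in Ioo 0 z ×ˢ Ioo 0 m, (α p * pdx ξ p + β p * pdy ξ p)) -
        ∫ φ in Ioo 0 z, g φ * ξ (φ, m) = 0)
    {a : ℝ → ℝ} (ha : ContinuousOn a (Icc 0 z)) (hαa : ∀ p : ℝ × ℝ, p.1 ∈ Ioo 0 z → |α p| ≤ a p.1) :
    ∃ (Θ : ℝ × ℝ → ℝ) (L : NNReal), LipschitzWith L Θ ∧ (∀ φ ∈ Icc 0 z, Θ (φ, 0) = 0) ∧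
      (∀ φ ∈ Icc 0 z, Θ (φ, m) = ∫ s in (0:ℝ)..φ, g s) ∧
      (∀ p ∈ Icc 0 z ×ˢ Icc 0 m, |Θ p| ≤ m * a p.1) ∧
      ∀ᵐ p ∂(volume.restrict (Ioo 0 z ×ˢ Ioo 0 m)), pdx Θ p = β p ∧ pdy Θ p = -α p := by
  obtain ⟨hA, hB⟩ := stream_ae hz hm hα hβ hαC hβC hg hgC hw
  have hC0 : 0 ≤ C := (abs_nonneg _).trans (hαC 0)
  have hαx : ∀ x, Measurable (fun s => α (x, s)) := fun x => hα.comp (by fun_prop)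
  have hβy : ∀ y, Measurable (fun s => β (s, y)) := fun y => hβ.comp (by fun_prop)
  set T1 : ℝ × ℝ → ℝ := fun p => -primY α p with hT1
  set T2 : ℝ × ℝ → ℝ := fun p => ∫ s in (0:ℝ)..p.1, β (s, p.2) with hT2
  have hA' : ∀ᵐ p ∂(volume.restrict (Ioo 0 z)).prod (volume.restrict (Ioo 0 m)), T1 p = T2 p := by
    rw [Measure.prod_restrict, ← Measure.volume_eq_prod]; exact hA
  have hT1y : ∀ x, Continuous fun y => T1 (x, y) := fun x =>
    (prim_cont (hαx x) (fun _ => hαC _)).neg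
  have hT2x : ∀ y, Continuous fun x => T2 (x, y) := fun y =>
    (prim_cont (hβy y) (fun _ => hβC _))
  have hA1 := Measure.ae_ae_of_ae_prod hA'
  set G : Set ℝ := {φ | φ ∈ Ioo 0 z ∧ (∀ᵐ ψ ∂(volume.restrict (Ioo 0 m)), T1 (φ, ψ) = T2 (φ, ψ)) ∧
    T1 (φ, m) = ∫ s in (0:ℝ)..φ, g s} with hG
  have hGae : ∀ᵐ φ ∂(volume.restrict (Ioo 0 z)), φ ∈ G := by
    filter_upwards [hA1, hB, ae_restrict_mem measurableSet_Ioo] with φ h1 h2 h3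
    exact ⟨h3, h1, h2⟩
  have hLip : LipschitzOnWith (⟨C, hC0⟩ + ⟨C, hC0⟩) T1 (G ×ˢ Icc 0 m) := by
    apply LipschitzOnWith.of_dist_le_mul
    rintro ⟨x, y⟩ ⟨hx, hy⟩ ⟨x', y'⟩ ⟨hx', hy'⟩
    have k1 : |T1 (x, y) - T1 (x', y)| ≤ C * |x - x'| := by
      refine ae_le_Icc hm (u := fun y => |T1 (x, y) - T1 (x', y)|) (v := fun _ => C * |x - x'|)
        ((hT1y x).sub (hT1y x')).abs.continuousOn continuousOn_const ?_ y hy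
      filter_upwards [hx.2.1, hx'.2.1] with ψ h1 h2
      rw [h1, h2]
      exact prim_dist (hβy ψ) (fun _ => hβC _) x x'
    have k2 : |T1 (x', y) - T1 (x', y')| ≤ C * |y - y'| := by
      have := prim_dist (hαx x') (fun _ => hαC _) y' y
      rw [abs_sub_comm y' y] at this
      simp only [hT1, primY]
      rw [show -(∫ s in (0:ℝ)..y, α (x', s)) - -(∫ s in (0:ℝ)..y', α (x', s)) =
        (∫ s in (0:ℝ)..y', α (x', s)) - ∫ s in (0:ℝ)..y, α (x', s) by ring]
      exact this
    rw [Real.dist_eq, Prod.dist_eq, Real.dist_eq, Real.dist_eq]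
    have k3 := abs_sub_le (T1 (x, y)) (T1 (x', y)) (T1 (x', y'))
    have k4 := mul_le_mul_of_nonneg_left (le_max_left |x - x'| |y - y'|) hC0
    have k5 := mul_le_mul_of_nonneg_left (le_max_right |x - x'| |y - y'|) hC0
    have : ((⟨C, hC0⟩ + ⟨C, hC0⟩ : NNReal) : ℝ) = C + C := rfl
    rw [this]
    simp only at k4 k5 ⊢
    linarith
  obtain ⟨Θ, hΘ, hΘe⟩ := hLip.extend_real
  have hΘc := hΘ.continuous
  have hGT : ∀ φ ∈ G, ∀ ψ ∈ Icc 0 m, Θ (φ, ψ) = T1 (φ, ψ) := fun φ hφ ψ hψ =>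
    (hΘe ⟨hφ, hψ⟩).symm
  refine ⟨Θ, _, hΘ, ?_, ?_, ?_, ?_⟩
  · refine ae_eq_Icc hz (u := fun φ => Θ (φ, 0)) (v := fun _ => 0) (by fun_prop) (by fun_prop) ?_
    filter_upwards [hGae] with φ hφ
    rw [hGT φ hφ 0 ⟨le_rfl, hm.le⟩]
    simp [hT1, primY]
  · refine ae_eq_Icc hz (u := fun φ => Θ (φ, m)) (v := fun φ => ∫ s in (0:ℝ)..φ, g s) (by fun_prop)
      (prim_cont hg.measurable hgC).continuousOn ?_
    filter_upwards [hGae] with φ hφ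
    rw [hGT φ hφ m ⟨hm.le, le_rfl⟩]
    exact hφ.2.2
  · rintro ⟨φ, ψ⟩ ⟨hφ, hψ⟩
    refine ae_le_Icc hz (u := fun φ => |Θ (φ, ψ)|) (v := fun φ => m * a φ) (by fun_prop)
      (continuousOn_const.mul ha) ?_ φ hφ
    filter_upwards [hGae] with x hx
    rw [hGT x hx ψ hψ]
    have hax : 0 ≤ a x := (abs_nonneg _).trans (hαa (x, 0) hx.1)
    have := intervalIntegral.norm_integral_le_of_norm_le_const (f := fun s => α (x, s)) (a := 0)
      (b := ψ) (C := a x) (fun s _ => by rw [Real.norm_eq_abs]; exact hαa (x, s) hx.1)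
    simp only [hT1, primY, abs_neg]
    rw [Real.norm_eq_abs, sub_zero, abs_of_nonneg hψ.1] at this
    refine this.trans ?_
    rw [mul_comm m]
    exact mul_le_mul_of_nonneg_left hψ.2 hax
  · have mx := pdx_meas hΘc
    have my := pdy_meas hΘc
    have e1 : ∀ᵐ p ∂(volume.restrict (Ioo 0 z)).prod (volume.restrict (Ioo 0 m)), pdy Θ p = -α p := by
      rw [Measure.ae_prod_iff_ae_ae (p := fun p => pdy Θ p = -α p) (measurableSet_eq_fun my hα.neg)]
      filter_upwards [hGae] with φ hφ
      filter_upwards [ae_restrict_of_ae (LocallyIntegrable.ae_hasDerivAt_integral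
        (bdd_locInt (hαx φ) (fun _ => hαC _))), ae_restrict_mem measurableSet_Ioo] with ψ h1 h2
      have h3 : HasDerivAt (fun y => T1 (φ, y)) (-α (φ, ψ)) ψ := (h1 0).neg
      unfold pdy
      rw [← h3.deriv]
      apply Filter.EventuallyEq.deriv_eq
      filter_upwards [Ioo_mem_nhds h2.1 h2.2] with y hy
      exact hGT φ hφ y ⟨hy.1.le, hy.2.le⟩
    have e2 : ∀ᵐ p ∂(volume.restrict (Ioo 0 z)).prod (volume.restrict (Ioo 0 m)), pdx Θ p = β p := by
      rw [Measure.ae_prod_iff_ae_ae (measurableSet_eq_fun mx hβ)]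
      rw [Measure.ae_ae_comm (p := fun x y => pdx Θ (x, y) = β (x, y)) (measurableSet_eq_fun mx hβ)]
      have m2 : Measurable T2 := by
        have := (primY_meas (hβ.comp measurable_swap)).comp measurable_swap
        exact this
      have hsw : ∀ᵐ ψ ∂(volume.restrict (Ioo 0 m)), ∀ᵐ φ ∂(volume.restrict (Ioo 0 z)),
          Θ (φ, ψ) = T2 (φ, ψ) := by
        rw [← Measure.ae_ae_comm (p := fun x y => Θ (x, y) = T2 (x, y))
          (measurableSet_eq_fun hΘc.measurable m2)]
        filter_upwards [hGae] with φ hφ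
        filter_upwards [hφ.2.1, ae_restrict_mem measurableSet_Ioo] with ψ h1 h2
        rw [← h1, hGT φ hφ ψ ⟨h2.1.le, h2.2.le⟩]
      filter_upwards [hsw] with ψ hψ
      have hall := ae_eq_Icc hz (u := fun φ => Θ (φ, ψ)) (v := fun φ => T2 (φ, ψ)) (by fun_prop)
        (hT2x ψ).continuousOn hψ
      filter_upwards [ae_restrict_of_ae (LocallyIntegrable.ae_hasDerivAt_integral
        (bdd_locInt (hβy ψ) (fun _ => hβC _))), ae_restrict_mem measurableSet_Ioo] with φ h1 h2
      have h3 : HasDerivAt (fun x => T2 (x, ψ)) (β (φ, ψ)) φ := h1 0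
      unfold pdx
      rw [← h3.deriv]
      apply Filter.EventuallyEq.deriv_eq
      filter_upwards [Ioo_mem_nhds h2.1 h2.2] with y hy
      exact hall y ⟨hy.1.le, hy.2.le⟩
    rw [Measure.volume_eq_prod, ← Measure.prod_restrict]
    filter_upwards [e1, e2] with p h1 h2 using ⟨h2, h1⟩


def clampF (c x : ℝ) : ℝ := max (-c) (min x c)

lemma clampF_abs {c x : ℝ} (hc : 0 ≤ c) : |clampF c x| ≤ c := by
  unfold clampF
  rw [abs_le]
  exact ⟨le_max_left _ _, max_le (by linarith) (min_le_right _ _)⟩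

lemma clampF_eq {c x : ℝ} (h : |x| ≤ c) : clampF c x = x := by
  unfold clampF
  rw [abs_le] at h
  rw [min_eq_left h.2, max_eq_right h.1]

/-- the speed-variable bounds extend to the closed rectangle -/
lemma Q_bounds {z m lamp M1 M2 : ℝ} (hz : 0 < z) (hm : 0 < m) (hlam : 2 < lamp) {Q : ℝ × ℝ → ℝ}
    (hL : ∃ L : NNReal, LipschitzOnWith L Q (Icc 0 z ×ˢ Icc 0 m))
    (hest : ∀ᵐ p ∂(volume.restrict (Ioo (0 : ℝ) z ×ˢ Ioo (0 : ℝ) m)),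
      (-M2 * p.1 ^ (lamp + 2) ≤ Q p ∧ Q p ≤ -M1 * p.1 ^ (lamp + 2))) :
    ∀ p ∈ Icc 0 z ×ˢ Icc 0 m, -M2 * p.1 ^ (lamp + 2) ≤ Q p ∧ Q p ≤ -M1 * p.1 ^ (lamp + 2) := by
  obtain ⟨L, hL⟩ := hL
  have hc : Continuous (fun p : ℝ × ℝ => p.1 ^ (lamp + 2)) :=
    continuous_fst.rpow_const (fun _ => Or.inr (by linarith))
  intro p hp
  exact ⟨ae_le_rect hz hm (u := fun p => -M2 * p.1 ^ (lamp + 2))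
    (continuous_const.mul hc).continuousOn hL.continuousOn
    (hest.mono fun _ h => h.1) p hp, ae_le_rect hz hm (v := fun p => -M1 * p.1 ^ (lamp + 2))
      hL.continuousOn (continuous_const.mul hc).continuousOn (hest.mono fun _ h => h.2) p hp⟩

lemma b_up {γ S : ℝ} (hγ : 1 < γ) (hS : 0 ≤ S) {lamp M1 : ℝ} (hM1 : 0 < M1) :
    ∃ C > 0, ∀ φ > 0, ∀ s ∈ Ico (-S) 0, s ≤ -M1 * φ ^ (lamp + 2) →
      bfun γ s ≤ C * φ ^ (-(lamp / 2 + 1)) := by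
  obtain ⟨c, hc, C, hC, h⟩ := b_size hγ hS
  refine ⟨C / √M1, by positivity, fun φ hφ s hs hsφ => ?_⟩
  have h1 := (h s hs).2
  have h2 : √M1 * φ ^ (lamp / 2 + 1) ≤ √(-s) := by
    apply Real.le_sqrt_of_sq_le
    rw [mul_pow, Real.sq_sqrt hM1.le, ← Real.rpow_natCast, ← Real.rpow_mul hφ.le]
    rw [show (lamp / 2 + 1) * ((2:ℕ):ℝ) = lamp + 2 by push_cast; ring]
    linarith
  have h3 := b_pos hγ hs.2
  have h4 : bfun γ s * (√M1 * φ ^ (lamp / 2 + 1)) ≤ C :=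
    (mul_le_mul_of_nonneg_left h2 h3.le).trans h1
  rw [Real.rpow_neg hφ.le, ← div_eq_mul_inv, div_div, le_div_iff₀ (by positivity)]
  exact h4

lemma b_low {γ S : ℝ} (hγ : 1 < γ) (hS : 0 ≤ S) {lamp M2 : ℝ} (hM2 : 0 < M2) :
    ∃ c > 0, ∀ φ > 0, ∀ s ∈ Ico (-S) 0, -M2 * φ ^ (lamp + 2) ≤ s →
      c * φ ^ (-(lamp / 2 + 1)) ≤ bfun γ s := by
  obtain ⟨c, hc, C, hC, h⟩ := b_size hγ hS
  refine ⟨c / √M2, by positivity, fun φ hφ s hs hsφ => ?_⟩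
  have h1 := (h s hs).1
  have h2 : √(-s) ≤ √M2 * φ ^ (lamp / 2 + 1) := by
    apply Real.sqrt_le_iff.2 ⟨by positivity, _⟩
    rw [mul_pow, Real.sq_sqrt hM2.le, ← Real.rpow_natCast, ← Real.rpow_mul hφ.le]
    rw [show (lamp / 2 + 1) * ((2:ℕ):ℝ) = lamp + 2 by push_cast; ring]
    linarith
  have h3 := b_pos hγ hs.2
  have h4 : c ≤ bfun γ s * (√M2 * φ ^ (lamp / 2 + 1)) :=
    h1.trans (mul_le_mul_of_nonneg_left h2 h3.le)
  rw [Real.rpow_neg hφ.le, ← div_eq_mul_inv, div_div, div_le_iff₀ (by positivity)]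
  exact h4

lemma sol_stream {γ : ℝ} (hγ : 1 < γ) {m lamp M1 M2 l : ℝ} (hm : 0 < m) (hlam : 2 < lamp)
    (hl0 : 0 < l) {f Qp : ℝ → ℝ} {Q : ℝ × ℝ → ℝ} (hf : ContDiff ℝ 3 f) (hf0 : deriv f 0 = 0)
    (hM1 : 0 < M1) (hM12 : M1 ≤ M2)
    (hQpc : ContinuousOn Qp (Icc 0 l))
    (hQpr : ∀ x ∈ Icc (0 : ℝ) l, cstar γ ≤ Qp x ∧ Qp x < qmaxF γ)
    (hsol : SupersonicWeakSol γ m l f Qp Q)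
    (hcomp : ∀ x ∈ Icc (0 : ℝ) l, Qp x = AplusInv γ (Q (PhiP f Qp x, m)))
    (hest : ∀ᵐ p ∂(volume.restrict (Ioo (0 : ℝ) (zetaP f Qp l) ×ˢ Ioo (0 : ℝ) m)),
      (-M2 * p.1 ^ (lamp + 2) ≤ Q p ∧ Q p ≤ -M1 * p.1 ^ (lamp + 2)) ∧
      (-M2 * p.1 ^ (lamp + 1) ≤ pdx Q p ∧ pdx Q p ≤ -M1 * p.1 ^ (lamp + 1)) ∧
      |pdy Q p| ≤ M2 * p.1 ^ (3 * lamp / 2 + 1)) :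
    ∃ (Θ : ℝ × ℝ → ℝ) (L : NNReal), LipschitzWith L Θ ∧
      (∀ φ ∈ Icc 0 (zetaP f Qp l), Θ (φ, 0) = 0) ∧
      (∀ φ ∈ Icc 0 (zetaP f Qp l), Θ (φ, m) = ThP f (XP f Qp l φ)) ∧
      (∀ p ∈ Icc 0 (zetaP f Qp l) ×ˢ Icc 0 m, |Θ p| ≤ m * (M2 * p.1 ^ (lamp + 1))) ∧
      ∀ᵐ p ∂(volume.restrict (Ioo 0 (zetaP f Qp l) ×ˢ Ioo 0 m)),
        pdx Θ p = -(bfun γ (Q p) * pdy Q p) ∧ pdy Θ p = -pdx Q p := by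
  obtain ⟨hζ, -, -, -, -⟩ := X_facts hγ hl0 hf hQpc hQpr
  obtain ⟨hgc, hgi, -⟩ := wall_facts hγ hl0 hf hf0 hQpc hQpr hcomp
  obtain ⟨hLip, hneg, -, hweak⟩ := hsol
  set z := zetaP f Qp l with hz
  have hQb := Q_bounds hζ hm hlam hLip (hest.mono fun _ h => h.1)
  have hM2 : 0 < M2 := by linarith
  set S := M2 * z ^ (lamp + 2) with hS
  have hS0 : 0 ≤ S := by positivity
  obtain ⟨C1, hC1, hbup⟩ := b_up hγ hS0 (lamp := lamp) hM1
  obtain ⟨L, hL⟩ := hLip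
  obtain ⟨Qe, hQe, hQee⟩ := hL.extend_real
  have hQec := hQe.continuous
  set D : Set (ℝ × ℝ) := Ioo 0 z ×ˢ Ioo 0 m with hD
  have hDm : MeasurableSet D := measurableSet_Ioo.prod measurableSet_Ioo
  set C2 := C1 * M2 * z ^ lamp with hC2
  have hC20 : 0 ≤ C2 := by positivity
  set α : ℝ × ℝ → ℝ := D.indicator (fun p => clampF (M2 * p.1 ^ (lamp + 1)) (pdx Qe p)) with hαd
  set β : ℝ × ℝ → ℝ := D.indicator (fun p => clampF C2 (-(bfun γ (Qe p) * pdy Qe p))) with hβd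
  set g0 : ℝ → ℝ := fun φ => deriv (ThP f) (XP f Qp l φ) * Real.cos (ThP f (XP f Qp l φ)) /
          AplusInv γ (Q (φ, m)) with hg0
  set g : ℝ → ℝ := fun φ => g0 (max 0 (min φ z)) with hgd
  have hproj : ∀ φ : ℝ, max 0 (min φ z) ∈ Icc 0 z := fun φ =>
    ⟨le_max_left _ _, max_le hζ.le (min_le_right _ _)⟩
  have hprojeq : ∀ φ ∈ Icc 0 z, max 0 (min φ z) = φ := fun φ hφ => by
    rw [min_eq_left hφ.2, max_eq_right hφ.1]
  have hgcont : Continuous g := hgc.comp_continuous (by fun_prop) hproj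
  obtain ⟨Cg, hCg⟩ := isCompact_Icc.exists_bound_of_continuousOn hgc
  have hbm : Measurable (bfun γ) := (measurable_deriv (Kfun γ)).neg
  have hαm : Measurable α := by
    apply Measurable.indicator _ hDm
    have h1 := pdx_meas hQec
    unfold clampF
    have h2 : Measurable (fun p : ℝ × ℝ => M2 * p.1 ^ (lamp + 1)) :=
      (measurable_fst.pow_const _).const_mul _
    exact h2.neg.max (h1.min h2)
  have hβm : Measurable β := by
    apply Measurable.indicator _ hDm
    have h1 := pdy_meas hQec
    unfold clampF
    have h2 : Measurable (fun p : ℝ × ℝ => -(bfun γ (Qe p) * pdy Qe p)) :=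
      ((hbm.comp hQec.measurable).mul h1).neg
    exact measurable_const.max (h2.min measurable_const)
  have hαa : ∀ p : ℝ × ℝ, p.1 ∈ Ioo 0 z → |α p| ≤ M2 * p.1 ^ (lamp + 1) := by
    intro p hp
    have hpos : 0 ≤ M2 * p.1 ^ (lamp + 1) := by have := hp.1; positivity
    by_cases h : p ∈ D
    · rw [hαd, indicator_of_mem h]; exact clampF_abs hpos
    · rw [hαd, indicator_of_notMem h, abs_zero]; exact hpos
  have hαb : ∀ p, |α p| ≤ M2 * z ^ (lamp + 1) := by
    intro p
    by_cases h : p ∈ D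
    · refine (hαa p h.1).trans ?_
      have := h.1.1
      have := Real.rpow_le_rpow h.1.1.le h.1.2.le (show 0 ≤ lamp + 1 by linarith)
      exact mul_le_mul_of_nonneg_left this hM2.le
    · rw [hαd, indicator_of_notMem h, abs_zero]; positivity
  have hβb : ∀ p, |β p| ≤ C2 := by
    intro p
    by_cases h : p ∈ D
    · rw [hβd, indicator_of_mem h]; exact clampF_abs hC20
    · rw [hβd, indicator_of_notMem h, abs_zero]; exact hC20
  have hgood : ∀ᵐ p ∂(volume.restrict D), α p = pdx Q p ∧ β p = -(bfun γ (Q p) * pdy Q p) := by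
    filter_upwards [hest, ae_restrict_mem hDm] with p hp hpD
    obtain ⟨⟨h1, h2⟩, ⟨h3, h4⟩, h5⟩ := hp
    have hp0 : 0 < p.1 := hpD.1.1
    have eQ : ∀ p ∈ D, Qe p = Q p := fun p hp => (hQee (Ioo_sub_Icc_prod hp)).symm
    have ex : pdx Qe p = pdx Q p := pdx_congr eQ hpD
    have ey : pdy Qe p = pdy Q p := pdy_congr eQ hpD
    constructor
    · rw [hαd, indicator_of_mem hpD, ex]
      apply clampF_eq
      rw [abs_le]
      have : 0 < M1 * p.1 ^ (lamp + 1) := by positivity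
      have : 0 < M2 * p.1 ^ (lamp + 1) := by positivity
      exact ⟨by linarith, by linarith⟩
    · rw [hβd, indicator_of_mem hpD, ey, eQ p hpD]
      apply clampF_eq
      have hQneg : Q p < 0 := by
        have : 0 < M1 * p.1 ^ (lamp + 2) := by positivity
        linarith
      have hQS : -S ≤ Q p := by
        have := Real.rpow_le_rpow hp0.le hpD.1.2.le (show 0 ≤ lamp + 2 by linarith)
        have := mul_le_mul_of_nonneg_left this hM2.le
        rw [hS]; linarith
      have hb := hbup p.1 hp0 (Q p) ⟨hQS, hQneg⟩ h2
      rw [abs_neg, abs_mul, abs_of_pos (b_pos hγ hQneg)]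
      calc bfun γ (Q p) * |pdy Q p|
          ≤ (C1 * p.1 ^ (-(lamp / 2 + 1))) * (M2 * p.1 ^ (3 * lamp / 2 + 1)) :=
            mul_le_mul hb h5 (abs_nonneg _) (by positivity)
        _ = C1 * M2 * p.1 ^ lamp := by
            have e : p.1 ^ lamp = p.1 ^ (-(lamp / 2 + 1)) * p.1 ^ (3 * lamp / 2 + 1) := by
              rw [← Real.rpow_add hp0]; congr 1; ring
            rw [e]; ring
        _ ≤ C2 := by
            have := Real.rpow_le_rpow hp0.le hpD.1.2.le (show 0 ≤ lamp by linarith)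
            exact mul_le_mul_of_nonneg_left this (by positivity)
  set C := max (max (M2 * z ^ (lamp + 1)) C2) Cg with hC
  have hac : ContinuousOn (fun φ : ℝ => M2 * φ ^ (lamp + 1)) (Icc 0 z) := by
    have : Continuous (fun φ : ℝ => φ ^ (lamp + 1)) :=
      continuous_id.rpow_const (fun _ => Or.inr (by linarith))
    fun_prop
  have key := stream_abstract hζ hm hαm hβm (C := C)
    (fun p => (hαb p).trans ((le_max_left _ _).trans (le_max_left _ _)))
    (fun p => (hβb p).trans ((le_max_right _ _).trans (le_max_left _ _))) hgcont
    (fun x => (hCg _ (hproj x)).trans (le_max_right _ _)) ?_ hac hαa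
  · obtain ⟨Θ, L', hΘ, h1, h2, h3, h4⟩ := key
    refine ⟨Θ, L', hΘ, h1, ?_, h3, ?_⟩
    · intro φ hφ
      rw [h2 φ hφ, ← hgi φ hφ]
      apply intervalIntegral.integral_congr
      intro s hs
      rw [uIcc_of_le hφ.1] at hs
      have : max 0 (min s z) = s := hprojeq s ⟨hs.1, hs.2.trans hφ.2⟩
      simp only [hgd, this, hg0]
    · filter_upwards [h4, hgood] with p hp hq
      rw [hp.1, hp.2, hq.1, hq.2]
      exact ⟨rfl, rfl⟩
  · intro ξ hξ hξ0
    have := hweak ξ hξ hξ0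
    refine Eq.trans ?_ this
    congr 1
    · apply integral_congr_ae
      filter_upwards [hgood] with p hp
      rw [hp.1, hp.2]; ring
    · apply setIntegral_congr_fun measurableSet_Ioo
      intro φ hφ
      have : max 0 (min φ z) = φ := hprojeq φ ⟨hφ.1.le, hφ.2.le⟩
      simp only [hgd, this, hg0]


lemma K_tan {γ s t : ℝ} (hγ : 1 < γ) (hs : s < 0) (ht : t < 0) :
    Kfun γ t - Kfun γ s ≤ bfun γ s * (s - t) := by
  rcases lt_trichotomy t s with h | h | h
  · obtain ⟨c, hc, hc2⟩ := exists_hasDerivAt_eq_slope (Kfun γ) (fun x => -bfun γ x) h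
      (fun x hx => (K_hasDeriv hγ (hx.2.trans_lt hs)).continuousAt.continuousWithinAt)
      (fun x hx => K_hasDeriv hγ (hx.2.trans hs))
    have h1 := b_mono hγ hc.2.le hs
    have h2 : 0 < s - t := by linarith
    rw [eq_div_iff h2.ne'] at hc2
    nlinarith
  · subst h; simp
  · obtain ⟨c, hc, hc2⟩ := exists_hasDerivAt_eq_slope (Kfun γ) (fun x => -bfun γ x) h
      (fun x hx => (K_hasDeriv hγ (hx.2.trans_lt ht)).continuousAt.continuousWithinAt)
      (fun x hx => K_hasDeriv hγ (hx.2.trans ht))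
    have h1 := b_mono hγ hc.1.le (hc.2.trans ht)
    have h2 : 0 < t - s := by linarith
    rw [eq_div_iff h2.ne'] at hc2
    nlinarith

set_option maxHeartbeats 1000000 in
/-- pointwise inequalities -/
lemma pt_ineq {γ : ℝ} (hγ : 1 < γ) {lamp M1 M2 T : ℝ} (hlam : 2 < lamp) (hM1 : 0 < M1)
    (hM12 : M1 ≤ M2) (hT : 0 < T) :
    ∃ C > 0, ∀ x ∈ Ioc 0 T, ∀ s t : ℝ,
      (-M2 * x ^ (lamp + 2) ≤ s ∧ s ≤ -M1 * x ^ (lamp + 2)) →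
      (-M2 * x ^ (lamp + 2) ≤ t ∧ t ≤ -M1 * x ^ (lamp + 2)) →
      0 ≤ (Kfun γ t - Kfun γ s) * (s - t) ∧
      (s - t) ^ 2 ≤ C * ((Kfun γ t - Kfun γ s) * (s - t)) ∧
      (Kfun γ t - Kfun γ s) ^ 2 ≤
        C * x ^ (-(lamp / 2 + 1)) * ((Kfun γ t - Kfun γ s) * (s - t)) ∧
      x ^ (3 * lamp / 2 + 1) * |bfun γ s * (s - t) - (Kfun γ t - Kfun γ s)| ≤
        C * ((Kfun γ t - Kfun γ s) * (s - t)) ∧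
      (Kfun γ t - Kfun γ s) * (s - t) ≤ C * x ^ (lamp + 2) := by
  have hM2 : 0 < M2 := by linarith
  set S := M2 * T ^ (lamp + 2) with hS
  have hS0 : 0 ≤ S := by positivity
  obtain ⟨C1, hC1, hup⟩ := b_up hγ hS0 (lamp := lamp) hM1
  obtain ⟨c1, hc1, hlow⟩ := b_low hγ hS0 (lamp := lamp) hM2
  obtain ⟨C2, hC2, hlip⟩ := b_lip hγ hS0
  obtain ⟨C3, hC3⟩ := isCompact_Icc.exists_bound_of_continuousOn
    ((K_cont hγ).mono (show Icc (-S) 0 ⊆ Iic 0 from fun x hx => hx.2))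
  have hC30 : 0 ≤ C3 := (norm_nonneg _).trans (hC3 0 ⟨by linarith, le_rfl⟩)
  set Ca := T ^ (lamp / 2 + 1) / c1 with hCa
  set Cb := C2 / (M1 * √M1) * T ^ (lamp / 2 - 1) / c1 with hCb
  set Cc := 2 * C3 * M2 with hCc
  have hCa0 : 0 < Ca := by positivity
  have hCb0 : 0 < Cb := by positivity
  have hCc0 : 0 ≤ Cc := by positivity
  refine ⟨Ca + C1 + Cb + Cc, by positivity, ?_⟩
  intro x hx s t hs ht
  have hx0 : 0 < x := hx.1
  set X := x ^ (lamp + 2) with hX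
  have hX0 : 0 < X := by positivity
  have hXS : M2 * X ≤ S := mul_le_mul_of_nonneg_left
    (Real.rpow_le_rpow hx0.le hx.2 (by linarith)) hM2.le
  have hMX : 0 < M1 * X := by positivity
  have hs0 : s < 0 := by linarith
  have ht0 : t < 0 := by linarith
  have k1 := K_tan hγ hs0 ht0
  have k2 := K_tan hγ ht0 hs0
  have bs1 := hup x hx0 s ⟨by linarith, hs0⟩ hs.2
  have bt1 := hup x hx0 t ⟨by linarith, ht0⟩ ht.2
  have bs2 := hlow x hx0 s ⟨by linarith, hs0⟩ hs.1
  have bt2 := hlow x hx0 t ⟨by linarith, ht0⟩ ht.1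
  have bl := hlip (M1 * X) hMX s ⟨by linarith, by linarith⟩ t ⟨by linarith, by linarith⟩
  have bsp := b_pos hγ hs0
  have btp := b_pos hγ ht0
  have hKs := hC3 s ⟨by linarith, hs0.le⟩
  have hKt := hC3 t ⟨by linarith, ht0.le⟩
  rw [Real.norm_eq_abs, abs_le] at hKs hKt
  set w := s - t with hw
  set v := Kfun γ t - Kfun γ s with hv
  set b := bfun γ s with hb
  set b' := bfun γ t with hb'
  have k2' : b' * w ≤ v := by
    have q1 : bfun γ t * (t - s) = -(b' * w) := by rw [hw]; ring
    rw [hv]; linarith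
  set xk := x ^ (-(lamp / 2 + 1)) with hxk
  have hxk0 : 0 < xk := by positivity
  have hlowvw : c1 * xk * w ^ 2 ≤ v * w := by
    rcases le_total 0 w with h | h
    · have q1 := mul_le_mul_of_nonneg_right k2' h
      have q2 := mul_le_mul_of_nonneg_right bt2 (sq_nonneg w)
      have q3 : b' * w ^ 2 = b' * w * w := by ring
      linarith
    · have q1 := mul_le_mul_of_nonpos_right k1 h
      have q2 := mul_le_mul_of_nonneg_right bs2 (sq_nonneg w)
      have q3 : b * w ^ 2 = b * w * w := by ring
      linarith
  have hvw : 0 ≤ v * w := le_trans (by positivity) hlowvw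
  have hxkT : 1 ≤ T ^ (lamp / 2 + 1) * xk := by
    rw [hxk, Real.rpow_neg hx0.le, ← div_eq_mul_inv, one_le_div (by positivity)]
    exact Real.rpow_le_rpow hx0.le hx.2 (by linarith)
  have hmul : ∀ A B : ℝ, 0 ≤ B → A ≤ B → A * (v * w) ≤ B * (v * w) := fun A B _ h =>
    mul_le_mul_of_nonneg_right h hvw
  refine ⟨hvw, ?_, ?_, ?_, ?_⟩
  · have h1 : w ^ 2 ≤ Ca * (v * w) := by
      rw [hCa, div_mul_eq_mul_div, le_div_iff₀ hc1]
      have := mul_le_mul_of_nonneg_left hlowvw (show 0 ≤ T ^ (lamp / 2 + 1) by positivity)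
      have h3 := mul_le_mul_of_nonneg_right hxkT (show 0 ≤ c1 * w ^ 2 by positivity)
      have q1 : T ^ (lamp / 2 + 1) * (c1 * xk * w ^ 2) = T ^ (lamp / 2 + 1) * xk * (c1 * w ^ 2) := by ring
      linarith
    exact h1.trans (hmul _ _ (by positivity) (by linarith))
  · have h1 : v ^ 2 ≤ C1 * xk * (v * w) := by
      rcases le_total 0 w with h | h
      · have hv0 : 0 ≤ v := le_trans (by positivity) k2'
        have : v ≤ C1 * xk * w := k1.trans (mul_le_mul_of_nonneg_right bs1 h)
        have q1 := mul_le_mul_of_nonneg_left this hv0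
        calc v ^ 2 = v * v := by ring
          _ ≤ v * (C1 * xk * w) := q1
          _ = _ := by ring
      · have hv0 : v ≤ 0 := k1.trans (mul_nonpos_of_nonneg_of_nonpos bsp.le h)
        have : C1 * xk * w ≤ v := le_trans (mul_le_mul_of_nonpos_right bt1 h) k2'
        have q1 := mul_le_mul_of_nonpos_left this hv0
        calc v ^ 2 = v * v := by ring
          _ ≤ v * (C1 * xk * w) := q1
          _ = _ := by ring
    refine h1.trans (hmul _ _ (by positivity) ?_)
    exact mul_le_mul_of_nonneg_right (by linarith) hxk0.le
  · have h0 : |b * w - v| ≤ |b - b'| * |w| := by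
      rw [← abs_mul, abs_of_nonneg (by linarith : 0 ≤ b * w - v)]
      refine le_trans ?_ (le_abs_self _)
      have q1 : (b - b') * w = b * w - b' * w := by ring
      linarith
    have hδ : M1 * X * √(M1 * X) = M1 * √M1 * x ^ (3 * lamp / 2 + 3) := by
      rw [Real.sqrt_mul hM1.le, hX, Real.sqrt_eq_rpow (x ^ (lamp + 2)), ← Real.rpow_mul hx0.le]
      have e : x ^ (3 * lamp / 2 + 3) = x ^ (lamp + 2) * x ^ ((lamp + 2) * (1 / 2)) := by
        rw [← Real.rpow_add hx0]; congr 1; ring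
      rw [e]
      generalize x ^ (lamp + 2) = A1
      generalize x ^ ((lamp + 2) * (1 / 2)) = A2
      ring
    rw [hδ] at bl
    have e1 : x ^ (3 * lamp / 2 + 3) = x ^ (3 * lamp / 2 + 1) * x ^ (2:ℝ) := by
      rw [← Real.rpow_add hx0]; congr 1; ring
    have e2 : T ^ (lamp / 2 - 1) * xk * x ^ (2:ℝ) ≥ 1 := by
      have : xk * x ^ (2:ℝ) = (x ^ (lamp / 2 - 1))⁻¹ := by
        rw [hxk, ← Real.rpow_add hx0, ← Real.rpow_neg hx0.le]; congr 1; ring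
      rw [mul_assoc, this, ← div_eq_mul_inv, ge_iff_le, one_le_div (by positivity)]
      exact Real.rpow_le_rpow hx0.le hx.2 (by linarith)
    set Y := x ^ (3 * lamp / 2 + 1) with hY
    have hY0 : 0 < Y := by positivity
    set Z := x ^ (2:ℝ) with hZ
    have hZ0 : 0 < Z := by positivity
    set N := M1 * √M1 with hN
    have hN0 : 0 < N := by positivity
    have h1 : Y * |b * w - v| ≤ Cb * (v * w) := by
      have a1 : Y * |b * w - v| * (N * Z) ≤ C2 * w ^ 2 := by
        calc Y * |b * w - v| * (N * Z) ≤ Y * (|b - b'| * |w|) * (N * Z) := by gcongr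
          _ = (|b - b'| * (N * (Y * Z))) * |w| := by ring
          _ ≤ (C2 * |w|) * |w| := by rw [← e1]; gcongr
          _ = C2 * w ^ 2 := by rw [mul_assoc, abs_mul_abs_self]; ring
      have a2 : w ^ 2 ≤ T ^ (lamp / 2 - 1) * Z / c1 * (v * w) := by
        rw [div_mul_eq_mul_div, le_div_iff₀ hc1]
        have := mul_le_mul_of_nonneg_left hlowvw (show 0 ≤ T ^ (lamp / 2 - 1) * Z by positivity)
        have h3 := mul_le_mul_of_nonneg_right e2 (show 0 ≤ c1 * w ^ 2 by positivity)
        have q1 : T ^ (lamp / 2 - 1) * Z * (c1 * xk * w ^ 2) =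
          T ^ (lamp / 2 - 1) * xk * Z * (c1 * w ^ 2) := by ring
        linarith
      have a3 : Y * |b * w - v| * (N * Z) ≤ Cb * (v * w) * (N * Z) := by
        refine a1.trans ((mul_le_mul_of_nonneg_left a2 hC2.le).trans (le_of_eq ?_))
        rw [hCb]; field_simp
      exact le_of_mul_le_mul_right a3 (by positivity)
    exact h1.trans (hmul _ _ (by positivity) (by linarith))
  · have h1 : |v| ≤ 2 * C3 := by rw [hv, abs_le]; constructor <;> linarith [hKs.1, hKs.2, hKt.1, hKt.2]
    have h2 : |w| ≤ M2 * X := by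
      rw [hw, abs_le]
      constructor <;> linarith [hs.1, hs.2, ht.1, ht.2]
    have h3 : v * w ≤ |v| * |w| := by rw [← abs_mul]; exact le_abs_self _
    have h4 : |v| * |w| ≤ 2 * C3 * (M2 * X) := mul_le_mul h1 h2 (abs_nonneg _) (by positivity)
    have h5 : Cc * X ≤ (Ca + C1 + Cb + Cc) * X :=
      mul_le_mul_of_nonneg_right (by linarith) hX0.le
    rw [hCc] at h5
    rw [hCc]
    linarith


/-- the collected facts about one solution on `[0,T]×[0,m]` -/
structure SolF (γ m lamp M1 M2 T : ℝ) (Q Θ : ℝ × ℝ → ℝ) : Prop where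
  lipQ : ∃ L : NNReal, LipschitzOnWith L Q (Icc 0 T ×ˢ Icc 0 m)
  bd : ∀ p ∈ Icc 0 T ×ˢ Icc 0 m,
    -M2 * p.1 ^ (lamp + 2) ≤ Q p ∧ Q p ≤ -M1 * p.1 ^ (lamp + 2)
  ae : ∀ᵐ p ∂(volume.restrict (Ioo 0 T ×ˢ Ioo 0 m)),
    pdx Q p ≤ 0 ∧ |pdy Q p| ≤ M2 * p.1 ^ (3 * lamp / 2 + 1) ∧
      pdx Θ p = -(bfun γ (Q p) * pdy Q p) ∧ pdy Θ p = -pdx Q p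
  lipT : ∃ L : NNReal, LipschitzWith L Θ
  bot : ∀ φ ∈ Icc 0 T, Θ (φ, 0) = 0
  bdT : ∀ p ∈ Icc 0 T ×ˢ Icc 0 m, |Θ p| ≤ m * (M2 * p.1 ^ (lamp + 1))

lemma SolF.neg {γ m lamp M1 M2 T : ℝ} {Q Θ : ℝ × ℝ → ℝ} (h : SolF γ m lamp M1 M2 T Q Θ)
    (hM1 : 0 < M1) {p : ℝ × ℝ} (hp : p ∈ Icc 0 T ×ˢ Icc 0 m) (hp0 : 0 < p.1) : Q p < 0 := by
  have := (h.bd p hp).2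
  have : 0 < M1 * p.1 ^ (lamp + 2) := by positivity
  linarith

lemma SolF.nonpos {γ m lamp M1 M2 T : ℝ} {Q Θ : ℝ × ℝ → ℝ} (h : SolF γ m lamp M1 M2 T Q Θ)
    (hM1 : 0 < M1) {p : ℝ × ℝ} (hp : p ∈ Icc 0 T ×ˢ Icc 0 m) : Q p ≤ 0 := by
  have := (h.bd p hp).2
  have h0 : 0 ≤ p.1 := hp.1.1
  have : 0 ≤ M1 * p.1 ^ (lamp + 2) := by positivity
  linarith

lemma K_lip {γ : ℝ} (hγ : 1 < γ) {δ : ℝ} (hδ : 0 < δ) :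
    LipschitzOnWith (bfun γ (-δ)).toNNReal (Kfun γ) (Iic (-δ)) := by
  apply Convex.lipschitzOnWith_of_nnnorm_hasDerivWithin_le (convex_Iic _)
    (fun x hx => (K_hasDeriv hγ (lt_of_le_of_lt hx (by linarith))).hasDerivWithinAt)
  intro x hx
  have hx0 : x < 0 := lt_of_le_of_lt hx (by linarith)
  have h1 := b_mono hγ (show x ≤ -δ from hx) (by linarith : -δ < 0)
  have h2 := b_pos hγ hx0
  rw [← NNReal.coe_le_coe, coe_nnnorm, norm_neg, Real.norm_eq_abs, abs_of_pos h2,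
    Real.coe_toNNReal _ (by linarith)]
  exact h1

lemma SolF.lipK {γ m lamp M1 M2 T : ℝ} {Q Θ : ℝ × ℝ → ℝ} (h : SolF γ m lamp M1 M2 T Q Θ)
    (hγ : 1 < γ) (hlam : 2 < lamp) (hM1 : 0 < M1) {ε φ : ℝ} (hε : 0 < ε) (hφ : φ ≤ T) :
    ∃ L : NNReal, LipschitzOnWith L (fun p => Kfun γ (Q p)) (Icc ε φ ×ˢ Icc 0 m) := by
  obtain ⟨L, hL⟩ := h.lipQ
  have hsub : Icc ε φ ×ˢ Icc 0 m ⊆ Icc 0 T ×ˢ Icc 0 m :=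
    prod_mono (Icc_subset_Icc hε.le hφ) Subset.rfl
  have hδ : 0 < M1 * ε ^ (lamp + 2) := by positivity
  refine ⟨_, (K_lip hγ hδ).comp (hL.mono hsub) ?_⟩
  intro p hp
  have h1 := (h.bd p (hsub hp)).2
  have h2 := Real.rpow_le_rpow hε.le hp.1.1 (show 0 ≤ lamp + 2 by linarith)
  have h3 := mul_le_mul_of_nonneg_left h2 hM1.le
  simp only [mem_Iic]
  linarith

lemma SolF.contK {γ m lamp M1 M2 T : ℝ} {Q Θ : ℝ × ℝ → ℝ} (h : SolF γ m lamp M1 M2 T Q Θ)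
    (hγ : 1 < γ) (hM1 : 0 < M1) :
    ContinuousOn (fun p => Kfun γ (Q p)) (Icc 0 T ×ˢ Icc 0 m) := by
  obtain ⟨L, hL⟩ := h.lipQ
  exact (K_cont hγ).comp hL.continuousOn fun p hp => h.nonpos hM1 hp

lemma SolF.derivs {γ m lamp M1 M2 T : ℝ} {Q Θ : ℝ × ℝ → ℝ} (h : SolF γ m lamp M1 M2 T Q Θ)
    (hγ : 1 < γ) (hM1 : 0 < M1) :
    ∀ᵐ p ∂(volume.restrict (Ioo 0 T ×ˢ Ioo 0 m)), ∃ Qx Qy : ℝ,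
      (HasDerivAt (fun x => Q (x, p.2)) Qx p.1 ∧ HasDerivAt (fun y => Q (p.1, y)) Qy p.2) ∧
      (HasDerivAt (fun x => Kfun γ (Q (x, p.2))) (-(bfun γ (Q p) * Qx)) p.1 ∧
        HasDerivAt (fun y => Kfun γ (Q (p.1, y))) (-(bfun γ (Q p) * Qy)) p.2) ∧
      (HasDerivAt (fun x => Θ (x, p.2)) (-(bfun γ (Q p) * Qy)) p.1 ∧
        HasDerivAt (fun y => Θ (p.1, y)) (-Qx) p.2) ∧
      Qx ≤ 0 ∧ |Qy| ≤ M2 * p.1 ^ (3 * lamp / 2 + 1) := by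
  obtain ⟨L, hL⟩ := h.lipT
  filter_upwards [lip_ae_deriv h.lipQ, lip_ae_deriv (F := Θ) (a := 0) (b := T) (c := 0) (d := m)
    ⟨L, hL.lipschitzOnWith⟩, h.ae, ae_restrict_mem (measurableSet_Ioo.prod measurableSet_Ioo)]
    with p h1 h2 h3 hp
  have hneg := h.neg hM1 (Ioo_sub_Icc_prod hp) hp.1.1
  have hK := K_hasDeriv hγ hneg
  refine ⟨pdx Q p, pdy Q p, h1, ⟨?_, ?_⟩, ⟨?_, ?_⟩, h3.1, h3.2.1⟩
  · have := HasDerivAt.comp p.1 (h₂ := Kfun γ) (h := fun x => Q (x, p.2)) hK h1.1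
    rw [neg_mul] at this
    exact this
  · have := HasDerivAt.comp p.2 (h₂ := Kfun γ) (h := fun y => Q (p.1, y)) hK h1.2
    rw [neg_mul] at this
    exact this
  · rw [← h3.2.2.1]; exact h2.1
  · rw [← h3.2.2.2]; exact h2.2

def wF (Q Q' : ℝ × ℝ → ℝ) (p : ℝ × ℝ) : ℝ := Q p - Q' p
def vF (γ : ℝ) (Q Q' : ℝ × ℝ → ℝ) (p : ℝ × ℝ) : ℝ := Kfun γ (Q' p) - Kfun γ (Q p)
def eF (γ : ℝ) (Q Q' Θ Θ' : ℝ × ℝ → ℝ) (p : ℝ × ℝ) : ℝ :=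
  wF Θ Θ' p * wF Θ Θ' p + vF γ Q Q' p * wF Q Q' p

lemma rect_sub {ε φ T m : ℝ} (hε : 0 ≤ ε) (hφ : φ ≤ T) :
    Icc ε φ ×ˢ Icc 0 m ⊆ Icc 0 T ×ˢ Icc 0 m :=
  prod_mono (Icc_subset_Icc hε hφ) Subset.rfl

lemma rect_sub_o {ε φ T m : ℝ} (hε : 0 ≤ ε) (hφ : φ ≤ T) :
    Ioo ε φ ×ˢ Ioo 0 m ⊆ Ioo 0 T ×ˢ Ioo 0 m :=
  prod_mono (Ioo_subset_Ioo hε hφ) Subset.rfl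

lemma lips {γ m lamp M1 M2 T : ℝ} {Q Θ Q' Θ' : ℝ × ℝ → ℝ} (h : SolF γ m lamp M1 M2 T Q Θ)
    (h' : SolF γ m lamp M1 M2 T Q' Θ')
    (hγ : 1 < γ) (hlam : 2 < lamp) (hM1 : 0 < M1) {ε φ : ℝ} (hε : 0 < ε) (hφ : φ ≤ T) :
    (∃ L, LipschitzOnWith L (wF Q Q') (Icc ε φ ×ˢ Icc 0 m)) ∧
    (∃ L, LipschitzOnWith L (vF γ Q Q') (Icc ε φ ×ˢ Icc 0 m)) ∧
    (∃ L, LipschitzOnWith L (wF Θ Θ') (Icc ε φ ×ˢ Icc 0 m)) ∧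
    (∃ L, LipschitzOnWith L (eF γ Q Q' Θ Θ') (Icc ε φ ×ˢ Icc 0 m)) := by
  have hc : IsCompact (Icc ε φ ×ˢ Icc 0 m) := isCompact_Icc.prod isCompact_Icc
  obtain ⟨L1, hL1⟩ := h.lipQ
  obtain ⟨L2, hL2⟩ := h'.lipQ
  obtain ⟨L3, hL3⟩ := h.lipT
  obtain ⟨L4, hL4⟩ := h'.lipT
  have hs := rect_sub (m := m) hε.le hφ
  have a1 : ∃ L, LipschitzOnWith L (wF Q Q') (Icc ε φ ×ˢ Icc 0 m) :=
    lip_sub ⟨L1, hL1.mono hs⟩ ⟨L2, hL2.mono hs⟩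
  have a2 : ∃ L, LipschitzOnWith L (vF γ Q Q') (Icc ε φ ×ˢ Icc 0 m) :=
    lip_sub (h'.lipK hγ hlam hM1 hε hφ) (h.lipK hγ hlam hM1 hε hφ)
  have a3 : ∃ L, LipschitzOnWith L (wF Θ Θ') (Icc ε φ ×ˢ Icc 0 m) :=
    lip_sub ⟨L3, hL3.lipschitzOnWith⟩ ⟨L4, hL4.lipschitzOnWith⟩
  exact ⟨a1, a2, a3, lip_add (lip_mul hc a3 a3) (lip_mul hc a2 a1)⟩

lemma energy_I1 {γ m lamp M1 M2 T : ℝ} {Q Θ Q' Θ' : ℝ × ℝ → ℝ} (h : SolF γ m lamp M1 M2 T Q Θ)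
    (h' : SolF γ m lamp M1 M2 T Q' Θ')
    (hγ : 1 < γ) (hlam : 2 < lamp) (hm : 0 < m) (hM1 : 0 < M1) {ε φ : ℝ} (hε : 0 < ε)
    (hεφ : ε ≤ φ) (hφ : φ ≤ T) :
    (∫ y in (0:ℝ)..m, eF γ Q Q' Θ Θ' (φ, y)) - (∫ y in (0:ℝ)..m, eF γ Q Q' Θ Θ' (ε, y)) +
      ∫ s in ε..φ, 2 * (wF Θ Θ' (s, m) * vF γ Q Q' (s, m)) ≤ 0 := by
  obtain ⟨a1, a2, a3, a4⟩ := lips h h' hγ hlam hM1 hε hφ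
  have hc : IsCompact (Icc ε φ ×ˢ Icc 0 m) := isCompact_Icc.prod isCompact_Icc
  have key := div_ineq (F := eF γ Q Q' Θ Θ')
    (G := fun p => (wF Θ Θ' p * vF γ Q Q' p) + wF Θ Θ' p * vF γ Q Q' p) (H := fun _ => 0) hεφ hm.le a4
    (lip_add (lip_mul hc a3 a2) (lip_mul hc a3 a2)) (by simp) ?_
  · have e0 : ∫ x in ε..φ, (wF Θ Θ' (x, 0) * vF γ Q Q' (x, 0) + wF Θ Θ' (x, 0) * vF γ Q Q' (x, 0)) = 0 := by
      rw [intervalIntegral.integral_congr (g := fun _ => (0:ℝ))]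
      · simp
      · intro x hx
        rw [uIcc_of_le hεφ] at hx
        have hx' : x ∈ Icc 0 T := ⟨by linarith [hx.1], by linarith [hx.2]⟩
        simp [wF, h.bot x hx', h'.bot x hx']
    rw [e0] at key
    simp only [integral_zero, sub_zero] at key
    have e1 : ∀ s, 2 * (wF Θ Θ' (s, m) * vF γ Q Q' (s, m)) =
      wF Θ Θ' (s, m) * vF γ Q Q' (s, m) + wF Θ Θ' (s, m) * vF γ Q Q' (s, m) := fun s => by ring
    simp only [e1]
    exact key
  · have hs := rect_sub_o (m := m) hε.le hφ
    filter_upwards [ae_restrict_of_ae_restrict_of_subset hs (h.derivs hγ hM1),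
      ae_restrict_of_ae_restrict_of_subset hs (h'.derivs hγ hM1),
      ae_restrict_mem (measurableSet_Ioo.prod measurableSet_Ioo)] with p hp hp' hpD
    have hpD' := Ioo_sub_Icc_prod (hs hpD)
    have hp0 : 0 < p.1 := (hs hpD).1.1
    have hn := h.neg hM1 hpD' hp0
    have hn' := h'.neg hM1 hpD' hp0
    obtain ⟨Qx, Qy, ⟨q1, q2⟩, ⟨q3, q4⟩, ⟨q5, q6⟩, q7, q8⟩ := hp
    obtain ⟨Rx, Ry, ⟨r1, r2⟩, ⟨r3, r4⟩, ⟨r5, r6⟩, r7, r8⟩ := hp'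
    have t1 := K_tan hγ hn hn'
    have t2 := K_tan hγ hn' hn
    have d1 := ((q5.sub r5).mul (q5.sub r5)).add ((r3.sub q3).mul (q1.sub r1))
    have d2 := ((q6.sub r6).mul (r4.sub q4)).add ((q6.sub r6).mul (r4.sub q4))
    have e1 : pdx (eF γ Q Q' Θ Θ') p = _ := d1.deriv
    have e2 : pdy (fun p => (wF Θ Θ' p * vF γ Q Q' p) + wF Θ Θ' p * vF γ Q Q' p) p = _ := d2.deriv
    rw [e1, e2]
    simp only [Pi.sub_apply, Prod.mk.eta]
    generalize bfun γ (Q p) = b at *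
    generalize bfun γ (Q' p) = b' at *
    generalize Kfun γ (Q p) = k at *
    generalize Kfun γ (Q' p) = k' at *
    have f1 : Qx * (b * (Q p - Q' p) - (k' - k)) ≤ 0 :=
      mul_nonpos_of_nonpos_of_nonneg q7 (by linarith)
    have f2 : Rx * (b' * (Q' p - Q p) - (k - k')) ≤ 0 :=
      mul_nonpos_of_nonpos_of_nonneg r7 (by linarith)
    linarith


lemma e_pt {γ m lamp M1 M2 T : ℝ} {Q Θ Q' Θ' : ℝ × ℝ → ℝ} (h : SolF γ m lamp M1 M2 T Q Θ)
    (h' : SolF γ m lamp M1 M2 T Q' Θ')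
    (hγ : 1 < γ) (hlam : 2 < lamp) (hM1 : 0 < M1) (hM12 : M1 ≤ M2) (hT : 0 < T) :
    ∃ C > 0, ∀ p ∈ Icc 0 T ×ˢ Icc 0 m, 0 < p.1 →
      0 ≤ vF γ Q Q' p * wF Q Q' p ∧
      wF Q Q' p ^ 2 ≤ C * (vF γ Q Q' p * wF Q Q' p) ∧
      vF γ Q Q' p ^ 2 ≤ C * p.1 ^ (-(lamp / 2 + 1)) * (vF γ Q Q' p * wF Q Q' p) ∧
      p.1 ^ (3 * lamp / 2 + 1) * |bfun γ (Q p) * wF Q Q' p - vF γ Q Q' p| ≤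
        C * (vF γ Q Q' p * wF Q Q' p) ∧
      p.1 ^ (3 * lamp / 2 + 1) * |bfun γ (Q' p) * wF Q Q' p - vF γ Q Q' p| ≤
        C * (vF γ Q Q' p * wF Q Q' p) ∧
      vF γ Q Q' p * wF Q Q' p ≤ C * p.1 ^ (lamp + 2) := by
  obtain ⟨C, hC, hpt⟩ := pt_ineq (lamp := lamp) hγ hlam hM1 hM12 hT
  refine ⟨C, hC, fun p hp hp0 => ?_⟩
  have hx : p.1 ∈ Ioc 0 T := ⟨hp0, hp.1.2⟩
  obtain ⟨a1, a2, a3, a4, a5⟩ := hpt p.1 hx (Q p) (Q' p) (h.bd p hp) (h'.bd p hp)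
  obtain ⟨_, _, _, b4, _⟩ := hpt p.1 hx (Q' p) (Q p) (h'.bd p hp) (h.bd p hp)
  refine ⟨a1, a2, a3, a4, ?_, a5⟩
  have e1 : bfun γ (Q' p) * (Q' p - Q p) - (Kfun γ (Q p) - Kfun γ (Q' p)) =
    -(bfun γ (Q' p) * wF Q Q' p - vF γ Q Q' p) := by simp only [wF, vF]; ring
  have e2 : (Kfun γ (Q p) - Kfun γ (Q' p)) * (Q' p - Q p) = vF γ Q Q' p * wF Q Q' p := by
    simp only [wF, vF]; ring
  rw [e1, e2, abs_neg] at b4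
  exact b4

lemma lip_pow {ε φ m : ℝ} (hε : 0 < ε) (k : ℝ) (hk : 0 < k) :
    ∃ L, LipschitzOnWith L (fun p : ℝ × ℝ => p.1 ^ (-k)) (Icc ε φ ×ˢ Icc 0 m) := by
  have h1 : LipschitzOnWith (k * ε ^ (-k - 1)).toNNReal (fun x : ℝ => x ^ (-k)) (Icc ε φ) := by
    apply Convex.lipschitzOnWith_of_nnnorm_hasDerivWithin_le (convex_Icc _ _)
      (fun x hx => (Real.hasDerivAt_rpow_const (p := -k)
        (Or.inl (lt_of_lt_of_le hε hx.1).ne')).hasDerivWithinAt)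
    intro x hx
    have hx0 := lt_of_lt_of_le hε hx.1
    have h2 : 0 < x ^ (-k - 1) := by positivity
    have h3 : 0 < ε ^ (-k - 1) := by positivity
    rw [← NNReal.coe_le_coe, coe_nnnorm, Real.norm_eq_abs, Real.coe_toNNReal _ (by positivity),
      abs_mul, abs_neg, abs_of_pos hk, abs_of_pos h2]
    exact mul_le_mul_of_nonneg_left
      (Real.rpow_le_rpow_of_nonpos hε hx.1 (by linarith)) hk.le
  refine ⟨_, h1.comp (LipschitzWith.prod_fst.lipschitzOnWith) ?_⟩
  intro p hp
  exact hp.1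

lemma I2_div {γ m lamp M1 M2 T : ℝ} {Q Θ Q' Θ' : ℝ × ℝ → ℝ} (h : SolF γ m lamp M1 M2 T Q Θ)
    (h' : SolF γ m lamp M1 M2 T Q' Θ')
    (hγ : 1 < γ) (hlam : 2 < lamp) (hm : 0 < m) (hM1 : 0 < M1) (hM12 : M1 ≤ M2) (hT : 0 < T)
    {C : ℝ} (hC : 0 < C) (hpt : ∀ p ∈ Icc 0 T ×ˢ Icc 0 m, 0 < p.1 →
      0 ≤ vF γ Q Q' p * wF Q Q' p ∧
      wF Q Q' p ^ 2 ≤ C * (vF γ Q Q' p * wF Q Q' p) ∧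
      vF γ Q Q' p ^ 2 ≤ C * p.1 ^ (-(lamp / 2 + 1)) * (vF γ Q Q' p * wF Q Q' p) ∧
      p.1 ^ (3 * lamp / 2 + 1) * |bfun γ (Q p) * wF Q Q' p - vF γ Q Q' p| ≤
        C * (vF γ Q Q' p * wF Q Q' p) ∧
      p.1 ^ (3 * lamp / 2 + 1) * |bfun γ (Q' p) * wF Q Q' p - vF γ Q Q' p| ≤
        C * (vF γ Q Q' p * wF Q Q' p) ∧
      vF γ Q Q' p * wF Q Q' p ≤ C * p.1 ^ (lamp + 2))
    {k : ℝ} (hk : k = lamp / 2 + 1) {ε φ : ℝ} (hε : 0 < ε)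
    (hεφ : ε ≤ φ) (hφ : φ ≤ T) :
    (∫ y in (0:ℝ)..m, φ ^ (-k) * (y * (wF Θ Θ' (φ, y) * wF Q Q' (φ, y)))) -
      (∫ y in (0:ℝ)..m, ε ^ (-k) * (y * (wF Θ Θ' (ε, y) * wF Q Q' (ε, y)))) +
      ∫ s in ε..φ, s ^ (-k) * ((m / 2) * eF γ Q Q' Θ Θ' (s, m)) ≤
      ∫ p in Ioo ε φ ×ˢ Ioo 0 m, (k * m * (1 + C) / 2 + T * (1 / 2 + m * M2 * C)) *
        (p.1 ^ (-k - 1) * eF γ Q Q' Θ Θ' p) := by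
  obtain ⟨a1, a2, a3, a4⟩ := lips h h' hγ hlam hM1 hε hφ
  have hk0 : 0 < k := by rw [hk]; linarith
  have hc : IsCompact (Icc ε φ ×ˢ Icc 0 m) := isCompact_Icc.prod isCompact_Icc
  have lx := lip_pow (φ := φ) (m := m) hε k hk0
  have lx1 := lip_pow (φ := φ) (m := m) hε (k + 1) (by linarith)
  have ly : ∃ L, LipschitzOnWith L (fun p : ℝ × ℝ => p.2) (Icc ε φ ×ˢ Icc 0 m) :=
    ⟨1, LipschitzWith.prod_snd.lipschitzOnWith⟩
  have ly2 : ∃ L, LipschitzOnWith L (fun p : ℝ × ℝ => p.2 / 2) (Icc ε φ ×ˢ Icc 0 m) := by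
    have : ∃ L, LipschitzOnWith L (fun _ : ℝ × ℝ => (1/2 : ℝ)) (Icc ε φ ×ˢ Icc 0 m) :=
      ⟨0, (LipschitzWith.const _).lipschitzOnWith⟩
    convert! lip_mul hc ly this using 4
    ring
  have key := div_ineq (F := fun p => p.1 ^ (-k) * (p.2 * (wF Θ Θ' p * wF Q Q' p)))
    (G := fun p => p.1 ^ (-k) * ((p.2 / 2) * eF γ Q Q' Θ Θ' p))
    (H := fun p => (k * m * (1 + C) / 2 + T * (1 / 2 + m * M2 * C)) *
        (p.1 ^ (-k - 1) * eF γ Q Q' Θ Θ' p)) hεφ hm.le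
    (lip_mul hc lx (lip_mul hc ly (lip_mul hc a3 a1)))
    (lip_mul hc lx (lip_mul hc ly2 a4)) ?_ ?_
  · simpa using key
  · obtain ⟨L1, b1⟩ := lx1
    obtain ⟨L2, b2⟩ := a4
    have := ((b1.continuousOn.mul b2.continuousOn).integrableOn_compact hc (μ := volume)).mono_set
      (Ioo_sub_Icc_prod (a := ε) (b := φ) (c := 0) (d := m))
    have e : -k - 1 = -(k + 1) := by ring
    rw [e]
    exact this.const_mul _
  · have hs := rect_sub_o (m := m) hε.le hφ
    filter_upwards [ae_restrict_of_ae_restrict_of_subset hs (h.derivs hγ hM1),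
      ae_restrict_of_ae_restrict_of_subset hs (h'.derivs hγ hM1),
      ae_restrict_mem (measurableSet_Ioo.prod measurableSet_Ioo)] with p hp hp' hpD
    have hpD' := Ioo_sub_Icc_prod (hs hpD)
    have hp0 : 0 < p.1 := (hs hpD).1.1
    obtain ⟨Qx, Qy, ⟨q1, q2⟩, ⟨q3, q4⟩, ⟨q5, q6⟩, q7, q8⟩ := hp
    obtain ⟨Rx, Ry, ⟨r1, r2⟩, ⟨r3, r4⟩, ⟨r5, r6⟩, r7, r8⟩ := hp'
    have dx := Real.hasDerivAt_rpow_const (p := -k) (Or.inl hp0.ne')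
    have d1 := dx.mul (((q5.sub r5).mul (q1.sub r1)).const_mul p.2)
    have d2 := (((hasDerivAt_id p.2).div_const 2).mul
      (((q6.sub r6).mul (q6.sub r6)).add ((r4.sub q4).mul (q2.sub r2)))).const_mul (p.1 ^ (-k))
    have e1 : pdx (fun p => p.1 ^ (-k) * (p.2 * (wF Θ Θ' p * wF Q Q' p))) p = _ := d1.deriv
    have e2 : pdy (fun p => p.1 ^ (-k) * ((p.2 / 2) * eF γ Q Q' Θ Θ' p)) p = _ := d2.deriv
    rw [e1, e2]
    obtain ⟨t1, t2, -, t4, t5, -⟩ := hpt p hpD' hp0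
    simp only [Pi.sub_apply, Pi.mul_apply, Pi.add_apply, Prod.mk.eta, id]
    have ev : eF γ Q Q' Θ Θ' p = wF Θ Θ' p * wF Θ Θ' p + vF γ Q Q' p * wF Q Q' p := rfl
    have ew : Q p - Q' p = wF Q Q' p := rfl
    have eo : Θ p - Θ' p = wF Θ Θ' p := rfl
    have evv : Kfun γ (Q' p) - Kfun γ (Q p) = vF γ Q Q' p := rfl
    rw [ev, ew, eo, evv]
    have hpx : p.1 ^ (-k) ≤ T * p.1 ^ (-k - 1) := by
      have : p.1 ^ (-k) = p.1 ^ (1:ℝ) * p.1 ^ (-k - 1) := by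
        rw [← Real.rpow_add hp0]; congr 1; ring
      rw [this, Real.rpow_one]
      exact mul_le_mul_of_nonneg_right hpD'.1.2 (by positivity)
    have hX0 : 0 < p.1 ^ (-k) := by positivity
    have hX1 : 0 < p.1 ^ (-k - 1) := by positivity
    have hy0 : 0 ≤ p.2 := hpD'.2.1
    have hym : p.2 ≤ m := hpD'.2.2
    have hM2 : 0 < M2 := by linarith
    have g1 : |Qy * (bfun γ (Q p) * wF Q Q' p - vF γ Q Q' p)| ≤ M2 * (C * (vF γ Q Q' p * wF Q Q' p)) := by
      rw [abs_mul]
      calc _ ≤ M2 * p.1 ^ (3 * lamp / 2 + 1) * |bfun γ (Q p) * wF Q Q' p - vF γ Q Q' p| :=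
            mul_le_mul_of_nonneg_right q8 (abs_nonneg _)
        _ ≤ _ := by rw [mul_assoc]; exact mul_le_mul_of_nonneg_left t4 hM2.le
    have g2 : |Ry * (bfun γ (Q' p) * wF Q Q' p - vF γ Q Q' p)| ≤ M2 * (C * (vF γ Q Q' p * wF Q Q' p)) := by
      rw [abs_mul]
      calc _ ≤ M2 * p.1 ^ (3 * lamp / 2 + 1) * |bfun γ (Q' p) * wF Q Q' p - vF γ Q Q' p| :=
            mul_le_mul_of_nonneg_right r8 (abs_nonneg _)
        _ ≤ _ := by rw [mul_assoc]; exact mul_le_mul_of_nonneg_left t5 hM2.le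
    clear e1 e2 d1 d2 q1 q2 q3 q4 q5 q6 q8 r1 r2 r3 r4 r5 r6 r8 dx ev ew eo evv hpt t4 t5
    generalize bfun γ (Q p) = b at *
    generalize bfun γ (Q' p) = b' at *
    generalize wF Q Q' p = w at *
    generalize vF γ Q Q' p = v at *
    generalize wF Θ Θ' p = o at *
    generalize p.1 ^ (-k) = X at *
    generalize p.1 ^ (-k-1) = Y at *
    generalize p.2 = y at *
    have ho : 0 ≤ o * o := mul_self_nonneg o
    have g3 : -(o * w) ≤ (1 + C) / 2 * (o * o + v * w) := by
      have : 0 ≤ (o + w) ^ 2 := sq_nonneg _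
      have : 0 ≤ C * (o * o) := by positivity
      linarith
    have g4 : y * -(o * w) ≤ m * ((1 + C) / 2 * (o * o + v * w)) :=
      (mul_le_mul_of_nonneg_left g3 hy0).trans
        (mul_le_mul_of_nonneg_right hym (by positivity))
    have g5 : (k * Y) * (y * -(o * w)) ≤ (k * Y) * (m * ((1 + C) / 2 * (o * o + v * w))) :=
      mul_le_mul_of_nonneg_left g4 (by positivity)
    have g6 : Ry * (b' * w - v) - Qy * (b * w - v) ≤ 2 * (M2 * C * (o * o + v * w)) := by
      have := (abs_le.1 g1).1
      have := (abs_le.1 g2).2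
      have : 0 ≤ M2 * C * (o * o) := by positivity
      linarith
    have g7 : y * (Ry * (b' * w - v) - Qy * (b * w - v)) ≤ m * (2 * (M2 * C * (o * o + v * w))) :=
      (mul_le_mul_of_nonneg_left g6 hy0).trans
        (mul_le_mul_of_nonneg_right hym (by positivity))
    have g8 : X * ((1/2) * (o * o + v * w) + (1/2) * (y * (Ry * (b' * w - v) - Qy * (b * w - v)))) ≤
      (T * Y) * ((1/2) * (o * o + v * w) + (1/2) * (m * (2 * (M2 * C * (o * o + v * w))))) := by
      calc _ ≤ X * ((1/2) * (o * o + v * w) + (1/2) * (m * (2 * (M2 * C * (o * o + v * w))))) :=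
            mul_le_mul_of_nonneg_left (by linarith) hX0.le
        _ ≤ _ := mul_le_mul_of_nonneg_right hpx (by positivity)
    linarith


lemma cont_line_x {F : ℝ × ℝ → ℝ} {a b c d x : ℝ} (hF : ContinuousOn F (Icc a b ×ˢ Icc c d))
    (hx : x ∈ Icc a b) : ContinuousOn (fun y => F (x, y)) (Icc c d) :=
  hF.comp (by fun_prop) fun y hy => ⟨hx, hy⟩

lemma cont_line_y {F : ℝ × ℝ → ℝ} {a b c d y : ℝ} (hF : ContinuousOn F (Icc a b ×ˢ Icc c d))
    (hy : y ∈ Icc c d) : ContinuousOn (fun x => F (x, y)) (Icc a b) :=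
  hF.comp (by fun_prop) fun x hx => ⟨hx, hy⟩

lemma ii_of_cont {z : ℝ → ℝ} {a b : ℝ} (hab : a ≤ b) (hz : ContinuousOn z (Icc a b)) :
    IntervalIntegrable z volume a b := by
  apply ContinuousOn.intervalIntegrable
  rwa [uIcc_of_le hab]

lemma SolF.contE {γ m lamp M1 M2 T : ℝ} {Q Θ Q' Θ' : ℝ × ℝ → ℝ} (h : SolF γ m lamp M1 M2 T Q Θ)
    (h' : SolF γ m lamp M1 M2 T Q' Θ') (hγ : 1 < γ) (hM1 : 0 < M1) :
    ContinuousOn (wF Q Q') (Icc 0 T ×ˢ Icc 0 m) ∧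
    ContinuousOn (vF γ Q Q') (Icc 0 T ×ˢ Icc 0 m) ∧
    ContinuousOn (wF Θ Θ') (Icc 0 T ×ˢ Icc 0 m) ∧
    ContinuousOn (eF γ Q Q' Θ Θ') (Icc 0 T ×ˢ Icc 0 m) := by
  obtain ⟨L1, hL1⟩ := h.lipQ
  obtain ⟨L2, hL2⟩ := h'.lipQ
  obtain ⟨L3, hL3⟩ := h.lipT
  obtain ⟨L4, hL4⟩ := h'.lipT
  have a1 : ContinuousOn (wF Q Q') (Icc 0 T ×ˢ Icc 0 m) := hL1.continuousOn.sub hL2.continuousOn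
  have a2 : ContinuousOn (vF γ Q Q') (Icc 0 T ×ˢ Icc 0 m) := (h'.contK hγ hM1).sub (h.contK hγ hM1)
  have a3 : ContinuousOn (wF Θ Θ') (Icc 0 T ×ˢ Icc 0 m) :=
    hL3.continuous.continuousOn.sub hL4.continuous.continuousOn
  exact ⟨a1, a2, a3, (a3.mul a3).add (a2.mul a1)⟩

lemma energy_I2 {γ m lamp M1 M2 T : ℝ} {Q Θ Q' Θ' : ℝ × ℝ → ℝ} (h : SolF γ m lamp M1 M2 T Q Θ)
    (h' : SolF γ m lamp M1 M2 T Q' Θ')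
    (hγ : 1 < γ) (hlam : 2 < lamp) (hm : 0 < m) (hM1 : 0 < M1) (hM12 : M1 ≤ M2) (hT : 0 < T)
    {k : ℝ} (hk : k = lamp / 2 + 1) :
    ∃ C2 : ℝ, 0 ≤ C2 ∧ ∀ φ ∈ Ioc 0 T, ∀ ε ∈ Ioo 0 φ, ∀ S : ℝ, 0 ≤ S →
      (∀ s ∈ Ioc 0 φ, (∫ y in (0:ℝ)..m, eF γ Q Q' Θ Θ' (s, y)) ≤ S * s ^ (2 * k)) →
      ∫ s in ε..φ, vF γ Q Q' (s, m) ^ 2 ≤ C2 * S * φ ^ k := by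
  obtain ⟨C, hC, hpt⟩ := e_pt h h' hγ hlam hM1 hM12 hT
  have hM2 : 0 < M2 := by linarith
  have hk0 : 0 < k := by rw [hk]; linarith
  obtain ⟨c1, c2, c3, c4⟩ := h.contE h' hγ hM1
  set D : ℝ := k * m * (1 + C) / 2 + T * (1 / 2 + m * M2 * C) with hD
  have hD0 : 0 ≤ D := by positivity
  refine ⟨C * (2 / m * (D + m * (1 + C))), by positivity, ?_⟩
  intro φ hφ ε hε S hS hES
  have key := I2_div h h' hγ hlam hm hM1 hM12 hT hC hpt hk hε.1 hε.2.le hφ.2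
  rw [← hD] at key
  have hφ0 : 0 < φ := hφ.1
  -- boundary terms
  have bt : ∀ s ∈ Ioc 0 φ, |∫ y in (0:ℝ)..m, s ^ (-k) * (y * (wF Θ Θ' (s, y) * wF Q Q' (s, y)))| ≤
      m * (1 + C) / 2 * (S * φ ^ k) := by
    intro s hs
    have hs0 : 0 < s := hs.1
    have hsT : s ∈ Icc 0 T := ⟨hs.1.le, hs.2.trans hφ.2⟩
    have hE := hES s hs
    have i4 := ii_of_cont hm.le (cont_line_x c4 hsT)
    have h1 : |∫ y in (0:ℝ)..m, s ^ (-k) * (y * (wF Θ Θ' (s, y) * wF Q Q' (s, y)))| ≤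
        ∫ y in (0:ℝ)..m, s ^ (-k) * (m * (1 + C) / 2) * eF γ Q Q' Θ Θ' (s, y) := by
      rw [← Real.norm_eq_abs]
      apply intervalIntegral.norm_integral_le_of_norm_le hm.le _ (i4.const_mul _)
      refine ae_of_all _ fun y hy => ?_
      obtain ⟨t1, t2, -⟩ := hpt (s, y) ⟨hsT, hy.1.le, hy.2⟩ hs0
      simp only [eF]
      generalize wF Q Q' (s, y) = w at *
      generalize vF γ Q Q' (s, y) = v at *
      generalize wF Θ Θ' (s, y) = o at *
      have hX0 : 0 < s ^ (-k) := by positivity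
      rw [Real.norm_eq_abs, abs_mul, abs_of_pos hX0, mul_assoc (s ^ (-k))]
      apply mul_le_mul_of_nonneg_left _ hX0.le
      rw [abs_mul, abs_of_pos hy.1]
      have ho : 0 ≤ o * o := mul_self_nonneg o
      have : |o * w| ≤ (1 + C) / 2 * (o * o + v * w) := by
        have : 0 ≤ C * (o * o) := by positivity
        rw [abs_le]
        constructor
        · have : 0 ≤ (o + w) ^ 2 := sq_nonneg _
          linarith
        · have : 0 ≤ (o - w) ^ 2 := sq_nonneg _
          linarith
      calc _ ≤ m * ((1 + C) / 2 * (o * o + v * w)) :=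
          mul_le_mul hy.2 this (abs_nonneg _) hm.le
        _ = _ := by ring
    refine h1.trans ?_
    rw [intervalIntegral.integral_const_mul]
    have e1 : s ^ (2 * k) = s ^ k * s ^ k := by rw [← Real.rpow_add hs0]; congr 1; ring
    have e2 : s ^ (-k) * s ^ k = 1 := by rw [← Real.rpow_add hs0]; simp
    have e3 : s ^ k ≤ φ ^ k := Real.rpow_le_rpow hs0.le hs.2 hk0.le
    calc _ ≤ s ^ (-k) * (m * (1 + C) / 2) * (S * s ^ (2 * k)) :=
          mul_le_mul_of_nonneg_left hE (by positivity)
      _ = m * (1 + C) / 2 * (S * s ^ k) * (s ^ (-k) * s ^ k) := by rw [e1]; ring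
      _ = m * (1 + C) / 2 * (S * s ^ k) := by rw [e2, mul_one]
      _ ≤ _ := by gcongr
  have b1 := (abs_le.1 (bt φ ⟨hφ0, le_rfl⟩)).1
  have b2 := (abs_le.1 (bt ε ⟨hε.1, hε.2.le⟩)).2
  -- the area term
  have har : ∫ p in Ioo ε φ ×ˢ Ioo 0 m, D * (p.1 ^ (-k - 1) * eF γ Q Q' Θ Θ' p) ≤
      D * (S * φ ^ k) := by
    rw [integral_const_mul]
    apply mul_le_mul_of_nonneg_left _ hD0
    have hint : IntegrableOn (fun p : ℝ × ℝ => p.1 ^ (-k - 1) * eF γ Q Q' Θ Θ' p)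
        (Ioo ε φ ×ˢ Ioo 0 m) := by
      have hc : IsCompact (Icc ε φ ×ˢ Icc 0 m) := isCompact_Icc.prod isCompact_Icc
      refine IntegrableOn.mono_set (ContinuousOn.integrableOn_compact hc ?_)
        (Ioo_sub_Icc_prod (a := ε) (b := φ) (c := 0) (d := m))
      refine ContinuousOn.mul ?_ (c4.mono (rect_sub hε.1.le hφ.2))
      intro p hp
      have : p.1 ≠ 0 := (lt_of_lt_of_le hε.1 hp.1.1).ne'
      exact (continuous_fst.continuousAt.rpow_const (Or.inl this)).continuousWithinAt
    rw [Measure.volume_eq_prod] at hint ⊢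
    rw [setIntegral_prod _ hint]
    have hin : ∀ x ∈ Ioo ε φ, ∫ y in Ioo 0 m, x ^ (-k - 1) * eF γ Q Q' Θ Θ' (x, y) ≤ S * φ ^ (k - 1) := by
      intro x hx
      have hx0 : 0 < x := hε.1.trans hx.1
      rw [integral_const_mul, ← integral_Ioc_eq_integral_Ioo, ← intervalIntegral.integral_of_le hm.le]
      have hE := hES x ⟨hx0, hx.2.le⟩
      have hk1 : 0 ≤ k - 1 := by rw [hk]; linarith
      calc _ ≤ x ^ (-k - 1) * (S * x ^ (2 * k)) := mul_le_mul_of_nonneg_left hE (by positivity)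
        _ = S * x ^ (k - 1) := by
          have : x ^ (k - 1) = x ^ (-k - 1) * x ^ (2 * k) := by
            rw [← Real.rpow_add hx0]; congr 1; ring
          rw [this]; ring
        _ ≤ _ := mul_le_mul_of_nonneg_left (Real.rpow_le_rpow hx0.le hx.2.le hk1) hS
    have hii := hint
    rw [IntegrableOn, ← Measure.prod_restrict] at hii
    calc _ ≤ ∫ x in Ioo ε φ, S * φ ^ (k - 1) :=
          setIntegral_mono_on hii.integral_prod_left
            ((continuous_const.integrableOn_Icc).mono_set Ioo_subset_Icc_self) measurableSet_Ioo hin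
      _ = (φ - ε) * (S * φ ^ (k - 1)) := by
          rw [setIntegral_const]; simp [Measure.real, ENNReal.toReal_ofReal (sub_nonneg.2 hε.2.le)]
      _ ≤ φ * (S * φ ^ (k - 1)) := by
          apply mul_le_mul_of_nonneg_right _ (by positivity)
          linarith [hε.1]
      _ = _ := by
          have : φ ^ k = φ * φ ^ (k - 1) := by
            nth_rw 2 [← Real.rpow_one φ]
            rw [← Real.rpow_add hφ0]; congr 1; ring
          rw [this]; ring
  -- conclusion
  have hmm : m ∈ Icc 0 m := ⟨hm.le, le_rfl⟩
  have hsubI : Icc ε φ ⊆ Icc 0 T := Icc_subset_Icc hε.1.le hφ.2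
  have f1 : ContinuousOn (fun s => s ^ (-k) * ((m / 2) * eF γ Q Q' Θ Θ' (s, m))) (Icc ε φ) := by
    refine ContinuousOn.mul ?_ (continuousOn_const.mul ((cont_line_y c4 hmm).mono hsubI))
    intro s hs
    exact (Real.continuousAt_rpow_const _ _ (Or.inl (lt_of_lt_of_le hε.1 hs.1).ne')).continuousWithinAt
  have fin : ∫ s in ε..φ, vF γ Q Q' (s, m) ^ 2 ≤
      ∫ s in ε..φ, (C * (2 / m)) * (s ^ (-k) * ((m / 2) * eF γ Q Q' Θ Θ' (s, m))) := by
    apply intervalIntegral.integral_mono_on hε.2.le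
      (ii_of_cont hε.2.le (((cont_line_y c2 hmm).mono hsubI).pow 2))
      ((ii_of_cont hε.2.le f1).const_mul _)
    intro s hs
    have hs0 : 0 < s := lt_of_lt_of_le hε.1 hs.1
    obtain ⟨t1, -, t3, -⟩ := hpt (s, m) ⟨hsubI hs, hmm⟩ hs0
    rw [← hk] at t3
    have hX0 : 0 < s ^ (-k) := by positivity
    simp only [eF]
    refine t3.trans ?_
    simp only
    have : C * (2 / m) * (s ^ (-k) * (m / 2 * (wF Θ Θ' (s, m) * wF Θ Θ' (s, m) +
      vF γ Q Q' (s, m) * wF Q Q' (s, m)))) = C * s ^ (-k) * (wF Θ Θ' (s, m) * wF Θ Θ' (s, m) +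
      vF γ Q Q' (s, m) * wF Q Q' (s, m)) := by field_simp
    rw [this]
    apply mul_le_mul_of_nonneg_left _ (by positivity)
    linarith [mul_self_nonneg (wF Θ Θ' (s, m))]
  rw [intervalIntegral.integral_const_mul] at fin
  refine fin.trans ?_
  have : ∫ s in ε..φ, s ^ (-k) * ((m / 2) * eF γ Q Q' Θ Θ' (s, m)) ≤ (D + m * (1 + C)) * (S * φ ^ k) := by
    linarith
  calc _ ≤ C * (2 / m) * ((D + m * (1 + C)) * (S * φ ^ k)) :=
        mul_le_mul_of_nonneg_left this (by positivity)
    _ = _ := by ring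


lemma uniq_core {γ m lamp M1 M2 T B : ℝ} {Q Θ Q' Θ' : ℝ × ℝ → ℝ} (h : SolF γ m lamp M1 M2 T Q Θ)
    (h' : SolF γ m lamp M1 M2 T Q' Θ')
    (hγ : 1 < γ) (hlam : 2 < lamp) (hm : 0 < m) (hM1 : 0 < M1) (hM12 : M1 ≤ M2) (hT : 0 < T)
    (hB : 0 ≤ B) (hwall : ∀ s ∈ Icc 0 T, |wF Θ Θ' (s, m)| ≤
      B * s ^ lamp * ∫ r in (0:ℝ)..s, |vF γ Q Q' (r, m)|) :
    ∀ p ∈ Icc 0 T ×ˢ Icc 0 m, Q p = Q' p := by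
  obtain ⟨C, hC, hpt⟩ := e_pt h h' hγ hlam hM1 hM12 hT
  obtain ⟨C2, hC2, hI2⟩ := energy_I2 h h' hγ hlam hm hM1 hM12 hT (k := lamp / 2 + 1) rfl
  obtain ⟨c1, c2, c3, c4⟩ := h.contE h' hγ hM1
  have hM2 : 0 < M2 := by linarith
  have hmm : m ∈ Icc 0 m := ⟨hm.le, le_rfl⟩
  have hz : ContinuousOn (fun s => vF γ Q Q' (s, m)) (Icc 0 T) := cont_line_y c2 hmm
  have e0 : ∀ p ∈ Icc 0 T ×ˢ Icc 0 m, 0 < p.1 → 0 ≤ eF γ Q Q' Θ Θ' p := by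
    intro p hp hp0
    have := (hpt p hp hp0).1
    have := mul_self_nonneg (wF Θ Θ' p)
    simp only [eF]; linarith
  have e1 : ∀ p ∈ Icc 0 T ×ˢ Icc 0 m, 0 < p.1 →
      eF γ Q Q' Θ Θ' p ≤ ((2 * m * M2) ^ 2 * T ^ lamp + C) * p.1 ^ (lamp + 2) := by
    intro p hp hp0
    have a1 := (hpt p hp hp0).2.2.2.2.2
    have a2 := h.bdT p hp
    have a3 := h'.bdT p hp
    have a4 : |wF Θ Θ' p| ≤ 2 * m * M2 * p.1 ^ (lamp + 1) := by
      have := abs_sub (Θ p) (Θ' p)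
      simp only [wF]; linarith
    have a5 : wF Θ Θ' p * wF Θ Θ' p ≤ (2 * m * M2 * p.1 ^ (lamp + 1)) * (2 * m * M2 * p.1 ^ (lamp + 1)) := by
      rw [← abs_mul_abs_self]
      exact mul_le_mul a4 a4 (abs_nonneg _) (by positivity)
    have a6 : p.1 ^ (lamp + 1) * p.1 ^ (lamp + 1) = p.1 ^ lamp * p.1 ^ (lamp + 2) := by
      rw [← Real.rpow_add hp0, ← Real.rpow_add hp0]; congr 1; ring
    have a7 : p.1 ^ lamp ≤ T ^ lamp := Real.rpow_le_rpow hp0.le hp.1.2 (by linarith)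
    have a8 : (2 * m * M2 * p.1 ^ (lamp + 1)) * (2 * m * M2 * p.1 ^ (lamp + 1)) ≤
        (2 * m * M2) ^ 2 * (T ^ lamp * p.1 ^ (lamp + 2)) := by
      calc _ = (2 * m * M2) ^ 2 * (p.1 ^ (lamp + 1) * p.1 ^ (lamp + 1)) := by ring
        _ = (2 * m * M2) ^ 2 * (p.1 ^ lamp * p.1 ^ (lamp + 2)) := by rw [a6]
        _ ≤ _ := by gcongr
    simp only [eF]; linarith
  have ek : lamp + 2 = 2 * (lamp / 2 + 1) := by ring
  have main := abstract_gronwall (T := T) (k := lamp / 2 + 1)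
    (C0 := m * ((2 * m * M2) ^ 2 * T ^ lamp + C)) (C1 := 2 * B) (C2 := C2)
    (E := fun s => ∫ y in (0:ℝ)..m, eF γ Q Q' Θ Θ' (s, y)) (z := fun s => vF γ Q Q' (s, m))
    (by linarith) (by positivity) (by positivity) hC2 hT hz ?_ ?_ hI2
  · -- conclusion
    intro p hp
    rcases (hp.1.1).eq_or_lt with h0 | h0
    · have a1 := h.bd p hp
      have a2 := h'.bd p hp
      rw [← h0, Real.zero_rpow (by linarith)] at a1 a2
      linarith [a1.1, a1.2, a2.1, a2.2]
    · have hE := main p.1 ⟨h0, hp.1.2⟩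
      have hcy := cont_line_x c4 hp.1
      have hey : eF γ Q Q' Θ Θ' (p.1, p.2) = 0 := by
        by_contra hne
        have hpos : 0 < eF γ Q Q' Θ Θ' (p.1, p.2) :=
          lt_of_le_of_ne (e0 _ ⟨hp.1, hp.2⟩ h0) (Ne.symm hne)
        have := intervalIntegral.integral_pos hm hcy (fun y hy => e0 _ ⟨hp.1, hy.1.le, hy.2⟩ h0)
          ⟨p.2, hp.2, hpos⟩
        linarith
      obtain ⟨t1, t2, -⟩ := hpt p hp h0
      have t3 := mul_self_nonneg (wF Θ Θ' p)
      simp only [Prod.mk.eta, eF] at hey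
      have t4 : vF γ Q Q' p * wF Q Q' p = 0 := by linarith
      rw [t4, mul_zero] at t2
      have t5 : wF Q Q' p = 0 := by
        have : wF Q Q' p ^ 2 = 0 := le_antisymm t2 (sq_nonneg _)
        exact pow_eq_zero_iff (two_ne_zero) |>.1 this
      simp only [wF] at t5
      linarith
  · intro s hs
    have hsT : s ∈ Icc 0 T := ⟨hs.1.le, hs.2⟩
    have hcy := cont_line_x c4 hsT
    constructor
    · exact intervalIntegral.integral_nonneg hm.le fun y hy => e0 _ ⟨hsT, hy⟩ hs.1
    · have := intervalIntegral.integral_mono_on (g := fun _ => ((2 * m * M2) ^ 2 * T ^ lamp + C) * s ^ (lamp + 2))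
        hm.le (ii_of_cont hm.le hcy)
        (by simp) (fun y hy => e1 _ ⟨hsT, hy⟩ hs.1)
      rw [intervalIntegral.integral_const] at this
      rw [← ek]
      refine this.trans (le_of_eq ?_)
      simp only [smul_eq_mul]; ring
  · intro φ hφ ε hε
    have i1 := energy_I1 h h' hγ hlam hm hM1 hε.1 hε.2.le hφ.2
    set J := ∫ s in (0:ℝ)..φ, |vF γ Q Q' (s, m)| with hJ
    have hza : ContinuousOn (fun s => |vF γ Q Q' (s, m)|) (Icc 0 T) := hz.abs
    have ii : ∀ a b, 0 ≤ a → a ≤ b → b ≤ T →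
        IntervalIntegrable (fun s => |vF γ Q Q' (s, m)|) volume a b := fun a b h1 h2 h3 =>
      ii_of_cont h2 (hza.mono (Icc_subset_Icc h1 h3))
    have hJ0 : 0 ≤ J := intervalIntegral.integral_nonneg hφ.1.le fun y hy => abs_nonneg _
    have hmono : ∀ s ∈ Icc ε φ, ∫ r in (0:ℝ)..s, |vF γ Q Q' (r, m)| ≤ J := by
      intro s hs
      have hs0 : 0 ≤ s := hε.1.le.trans hs.1
      rw [hJ, ← intervalIntegral.integral_add_adjacent_intervals (ii 0 s le_rfl hs0 (hs.2.trans hφ.2))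
        (ii s φ hs0 hs.2 hφ.2)]
      have := intervalIntegral.integral_nonneg (f := fun r => |vF γ Q Q' (r, m)|) (μ := volume)
        hs.2 fun y hy => abs_nonneg _
      linarith
    have hJe : ∫ s in ε..φ, |vF γ Q Q' (s, m)| ≤ J := by
      rw [hJ, ← intervalIntegral.integral_add_adjacent_intervals (ii 0 ε le_rfl hε.1.le (hε.2.le.trans hφ.2))
        (ii ε φ hε.1.le hε.2.le hφ.2)]
      have := intervalIntegral.integral_nonneg (f := fun r => |vF γ Q Q' (r, m)|) (μ := volume)
        hε.1.le fun y hy => abs_nonneg _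
      linarith
    have hb : |∫ s in ε..φ, 2 * (wF Θ Θ' (s, m) * vF γ Q Q' (s, m))| ≤
        ∫ s in ε..φ, (2 * (B * φ ^ lamp * J)) * |vF γ Q Q' (s, m)| := by
      rw [← Real.norm_eq_abs]
      apply intervalIntegral.norm_integral_le_of_norm_le hε.2.le _
        ((ii ε φ hε.1.le hε.2.le hφ.2).const_mul _)
      refine ae_of_all _ fun s hs => ?_
      have hs0 : 0 ≤ s := hε.1.le.trans hs.1.le
      have w1 := hwall s ⟨hs0, hs.2.trans hφ.2⟩
      have w2 := hmono s ⟨hs.1.le, hs.2⟩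
      have w3 : s ^ lamp ≤ φ ^ lamp := Real.rpow_le_rpow hs0 hs.2 (by linarith)
      have w5 : |wF Θ Θ' (s, m)| ≤ B * φ ^ lamp * J :=
        w1.trans (mul_le_mul (mul_le_mul_of_nonneg_left w3 hB) w2
          (intervalIntegral.integral_nonneg hs0 fun y hy => abs_nonneg _)
          (mul_nonneg hB (by have := hφ.1; positivity)))
      rw [Real.norm_eq_abs, abs_mul, abs_mul, abs_of_pos (by norm_num : (0:ℝ) < 2), mul_assoc 2]
      exact mul_le_mul_of_nonneg_left (mul_le_mul_of_nonneg_right w5 (abs_nonneg _)) (by norm_num)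
    have eR : ∫ s in ε..φ, (2 * (B * φ ^ lamp * J)) * |vF γ Q Q' (s, m)| =
        (2 * (B * φ ^ lamp * J)) * ∫ s in ε..φ, |vF γ Q Q' (s, m)| :=
      intervalIntegral.integral_const_mul _ _
    rw [eR] at hb
    have hBJ : 0 ≤ 2 * (B * φ ^ lamp * J) := by have := hφ.1; positivity
    have h3 := mul_le_mul_of_nonneg_left hJe hBJ
    have h4 := (abs_le.1 hb).1
    have ek2 : 2 * (lamp / 2 + 1) - 2 = lamp := by ring
    rw [ek2]
    have h5 : 2 * (B * φ ^ lamp * J) * J = 2 * B * φ ^ lamp * J ^ 2 := by ring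
    linarith


lemma mk_SolF {γ : ℝ} (hγ : 1 < γ) {m lamp M1 M2 l T : ℝ} (hm : 0 < m) (hlam : 2 < lamp)
    (hl0 : 0 < l) {f Qp : ℝ → ℝ} {Q : ℝ × ℝ → ℝ} (hf : ContDiff ℝ 3 f) (hf0 : deriv f 0 = 0)
    (hM1 : 0 < M1) (hM12 : M1 ≤ M2)
    (hQpc : ContinuousOn Qp (Icc 0 l))
    (hQpr : ∀ x ∈ Icc (0 : ℝ) l, cstar γ ≤ Qp x ∧ Qp x < qmaxF γ)
    (hsol : SupersonicWeakSol γ m l f Qp Q)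
    (hcomp : ∀ x ∈ Icc (0 : ℝ) l, Qp x = AplusInv γ (Q (PhiP f Qp x, m)))
    (hest : ∀ᵐ p ∂(volume.restrict (Ioo (0 : ℝ) (zetaP f Qp l) ×ˢ Ioo (0 : ℝ) m)),
      (-M2 * p.1 ^ (lamp + 2) ≤ Q p ∧ Q p ≤ -M1 * p.1 ^ (lamp + 2)) ∧
      (-M2 * p.1 ^ (lamp + 1) ≤ pdx Q p ∧ pdx Q p ≤ -M1 * p.1 ^ (lamp + 1)) ∧
      |pdy Q p| ≤ M2 * p.1 ^ (3 * lamp / 2 + 1)) (hT : T ≤ zetaP f Qp l) :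
    ∃ Θ : ℝ × ℝ → ℝ, SolF γ m lamp M1 M2 T Q Θ ∧
      (∀ φ ∈ Icc 0 T, Θ (φ, m) = ThP f (XP f Qp l φ)) := by
  obtain ⟨hζ, -⟩ := X_facts hγ hl0 hf hQpc hQpr
  obtain ⟨Θ, L, hL, h0, h1, hb, hae⟩ := sol_stream hγ hm hlam hl0 hf hf0 hM1 hM12 hQpc hQpr hsol hcomp hest
  have hQb := Q_bounds hζ hm hlam hsol.1 (hest.mono fun _ h => h.1)
  have hI : Icc 0 T ⊆ Icc 0 (zetaP f Qp l) := Icc_subset_Icc_right hT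
  have hs := rect_sub (m := m) le_rfl hT
  have hso := rect_sub_o (m := m) le_rfl hT
  refine ⟨Θ, ⟨?_, fun p hp => hQb p (hs hp), ?_, ⟨L, hL⟩, fun φ hφ => h0 φ (hI hφ),
    fun p hp => hb p (hs hp)⟩, fun φ hφ => h1 φ (hI hφ)⟩
  · obtain ⟨L', hL'⟩ := hsol.1
    exact ⟨L', hL'.mono hs⟩
  · filter_upwards [ae_restrict_of_ae_restrict_of_subset hso hae,
      ae_restrict_of_ae_restrict_of_subset hso hest,
      ae_restrict_mem (measurableSet_Ioo.prod measurableSet_Ioo)] with p g1 g2 g3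
    refine ⟨?_, g2.2.2, g1.1, g1.2⟩
    have hp0 : 0 < p.1 := g3.1.1
    have : 0 < M1 * p.1 ^ (lamp + 1) := by positivity
    linarith [g2.2.1.2]

/-- difference of the wall positions -/
lemma X_diff {γ : ℝ} (hγ : 1 < γ) {m l : ℝ} (hl0 : 0 < l) {f Qp Qp' : ℝ → ℝ} {Q Q' : ℝ × ℝ → ℝ}
    (hf : ContDiff ℝ 3 f) (hf0 : deriv f 0 = 0)
    (hQpc : ContinuousOn Qp (Icc 0 l)) (hQpc' : ContinuousOn Qp' (Icc 0 l))
    (hQpr : ∀ x ∈ Icc (0 : ℝ) l, cstar γ ≤ Qp x ∧ Qp x < qmaxF γ)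
    (hQpr' : ∀ x ∈ Icc (0 : ℝ) l, cstar γ ≤ Qp' x ∧ Qp' x < qmaxF γ)
    (hcomp : ∀ x ∈ Icc (0 : ℝ) l, Qp x = AplusInv γ (Q (PhiP f Qp x, m)))
    (hcomp' : ∀ x ∈ Icc (0 : ℝ) l, Qp' x = AplusInv γ (Q' (PhiP f Qp' x, m)))
    {s : ℝ} (hs : s ∈ Icc 0 (zetaP f Qp l)) (hs' : s ∈ Icc 0 (zetaP f Qp' l)) :
    |XP f Qp l s - XP f Qp' l s| ≤
      |(∫ r in (0:ℝ)..s, 1 / AplusInv γ (Q (r, m))) - ∫ r in (0:ℝ)..s, 1 / AplusInv γ (Q' (r, m))| := by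
  obtain ⟨-, -, h1⟩ := wall_facts hγ hl0 hf hf0 hQpc hQpr hcomp
  obtain ⟨-, -, h2⟩ := wall_facts hγ hl0 hf hf0 hQpc' hQpr' hcomp'
  rw [h1 s hs, h2 s hs']
  exact arc_grow hf _ _

lemma SolF.contI {γ m lamp M1 M2 T : ℝ} {Q Θ : ℝ × ℝ → ℝ} (h : SolF γ m lamp M1 M2 T Q Θ)
    (hγ : 1 < γ) (hM1 : 0 < M1) (hm : 0 < m) :
    ContinuousOn (fun r => 1 / AplusInv γ (Q (r, m))) (Icc 0 T) := by
  obtain ⟨L, hL⟩ := h.lipQ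
  have hmm : m ∈ Icc 0 m := ⟨hm.le, le_rfl⟩
  have hcq : ContinuousOn (fun r => Q (r, m)) (Icc 0 T) := cont_line_y hL.continuousOn hmm
  have hn : ∀ r ∈ Icc 0 T, Q (r, m) ≤ 0 := fun r hr => h.nonpos hM1 (p := (r, m)) ⟨hr, hmm⟩
  refine continuousOn_const.div ((AI_cont hγ).comp hcq hn) fun r hr => ?_
  have := (AI_mem hγ (hn r hr)).1
  exact (lt_of_lt_of_le (cstar_pos hγ) this).ne'

lemma final_step {γ : ℝ} (hγ : 1 < γ) {m l : ℝ} (hm : 0 < m) (hl0 : 0 < l) {f Qp Qp' : ℝ → ℝ}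
    {Q Q' : ℝ × ℝ → ℝ}
    (hf : ContDiff ℝ 3 f) (hf0 : deriv f 0 = 0)
    (hQpc : ContinuousOn Qp (Icc 0 l)) (hQpc' : ContinuousOn Qp' (Icc 0 l))
    (hQpr : ∀ x ∈ Icc (0 : ℝ) l, cstar γ ≤ Qp x ∧ Qp x < qmaxF γ)
    (hQpr' : ∀ x ∈ Icc (0 : ℝ) l, cstar γ ≤ Qp' x ∧ Qp' x < qmaxF γ)
    (hcomp : ∀ x ∈ Icc (0 : ℝ) l, Qp x = AplusInv γ (Q (PhiP f Qp x, m)))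
    (hcomp' : ∀ x ∈ Icc (0 : ℝ) l, Qp' x = AplusInv γ (Q' (PhiP f Qp' x, m)))
    (hle : zetaP f Qp l ≤ zetaP f Qp' l)
    (hQ : ∀ p ∈ Icc (0 : ℝ) (zetaP f Qp l) ×ˢ Icc (0 : ℝ) m, Q p = Q' p) :
    (∀ x ∈ Icc (0 : ℝ) l, Qp x = Qp' x) ∧ zetaP f Qp l = zetaP f Qp' l := by
  obtain ⟨hζ, hPX, hX, -⟩ := X_facts hγ hl0 hf hQpc hQpr
  obtain ⟨hζ', hPX', hX', -⟩ := X_facts hγ hl0 hf hQpc' hQpr'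
  have hmm : m ∈ Icc 0 m := ⟨hm.le, le_rfl⟩
  have hXX : ∀ s ∈ Icc 0 (zetaP f Qp l), XP f Qp l s = XP f Qp' l s := by
    intro s hs
    have h1 := X_diff hγ hl0 hf hf0 hQpc hQpc' hQpr hQpr' hcomp hcomp' hs ⟨hs.1, hs.2.trans hle⟩
    have h2 : ∫ r in (0:ℝ)..s, 1 / AplusInv γ (Q (r, m)) = ∫ r in (0:ℝ)..s, 1 / AplusInv γ (Q' (r, m)) := by
      apply intervalIntegral.integral_congr
      intro r hr
      rw [uIcc_of_le hs.1] at hr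
      simp only
      rw [hQ (r, m) ⟨⟨hr.1, hr.2.trans hs.2⟩, hmm⟩]
    rw [h2, sub_self, abs_zero] at h1
    exact sub_eq_zero.1 (abs_eq_zero.1 (le_antisymm h1 (abs_nonneg _)))
  have hPP : ∀ x ∈ Icc 0 l, PhiP f Qp x = PhiP f Qp' x := by
    intro x hx
    obtain ⟨a1, a2⟩ := hPX x hx
    have a3 := (hX' (PhiP f Qp x) ⟨a1.1, a1.2.trans hle⟩).2.1
    rw [← hXX _ a1, a2] at a3
    exact a3.symm
  refine ⟨fun x hx => ?_, hPP l ⟨hl0.le, le_rfl⟩⟩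
  rw [hcomp x hx, hcomp' x hx, hQ _ ⟨(hPX x hx).1, hmm⟩, hPP x hx]

theorem stmt_7 (γ : ℝ) (hγ : 1 < γ) (m lamp δ1 δ2 δ3 l : ℝ)
    (hm : 0 < m) (hlam : 2 < lamp) (hδ1 : 0 < δ1) (hδ12 : δ1 ≤ δ2) (hδ3 : 0 < δ3)
    (hl0 : 0 < l) (hl1 : l ≤ 1)
    (f : ℝ → ℝ) (hf4 : ContDiff ℝ 4 f) (hnoz : NozzlePlus lamp δ1 δ2 l f)
    (hf3 : ∀ x ∈ Icc (0 : ℝ) l, |deriv (deriv (deriv f)) x| ≤ δ3 * x ^ (lamp - 1))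
    (hm0 : f 0 * cstar γ ^ (1 + 2 / (γ - 1) : ℝ) = m)
    (M1 M2 : ℝ) (hM1 : 0 < M1) (hM12 : M1 ≤ M2)
    (Qp Qp' : ℝ → ℝ) (Q Q' : ℝ × ℝ → ℝ)
    (hQpc : ContinuousOn Qp (Icc 0 l))
    (hQpc' : ContinuousOn Qp' (Icc 0 l))
    (hQpr : ∀ x ∈ Icc (0 : ℝ) l, cstar γ ≤ Qp x ∧ Qp x < qmaxF γ)
    (hQpr' : ∀ x ∈ Icc (0 : ℝ) l, cstar γ ≤ Qp' x ∧ Qp' x < qmaxF γ)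
    (hsol : SupersonicWeakSol γ m l f Qp Q)
    (hsol' : SupersonicWeakSol γ m l f Qp' Q')
    (hcomp : ∀ x ∈ Icc (0 : ℝ) l, Qp x = AplusInv γ (Q (PhiP f Qp x, m)))
    (hcomp' : ∀ x ∈ Icc (0 : ℝ) l, Qp' x = AplusInv γ (Q' (PhiP f Qp' x, m)))
    (hest : ∀ᵐ p ∂(volume.restrict (Ioo (0 : ℝ) (zetaP f Qp l) ×ˢ Ioo (0 : ℝ) m)),
      (-M2 * p.1 ^ (lamp + 2) ≤ Q p ∧ Q p ≤ -M1 * p.1 ^ (lamp + 2)) ∧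
      (-M2 * p.1 ^ (lamp + 1) ≤ pdx Q p ∧ pdx Q p ≤ -M1 * p.1 ^ (lamp + 1)) ∧
      |pdy Q p| ≤ M2 * p.1 ^ (3 * lamp / 2 + 1))
    (hest' : ∀ᵐ p ∂(volume.restrict (Ioo (0 : ℝ) (zetaP f Qp' l) ×ˢ Ioo (0 : ℝ) m)),
      (-M2 * p.1 ^ (lamp + 2) ≤ Q' p ∧ Q' p ≤ -M1 * p.1 ^ (lamp + 2)) ∧
      (-M2 * p.1 ^ (lamp + 1) ≤ pdx Q' p ∧ pdx Q' p ≤ -M1 * p.1 ^ (lamp + 1)) ∧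
      |pdy Q' p| ≤ M2 * p.1 ^ (3 * lamp / 2 + 1)) :
    (∀ p ∈ Icc (0 : ℝ) (min (zetaP f Qp l) (zetaP f Qp' l)) ×ˢ Icc (0 : ℝ) m,
      Q p = Q' p) ∧
    (∀ x ∈ Icc (0 : ℝ) l, Qp x = Qp' x) ∧
    zetaP f Qp l = zetaP f Qp' l ∧
    (∀ p ∈ Icc (0 : ℝ) (zetaP f Qp l) ×ˢ Icc (0 : ℝ) m, Q p = Q' p) := by
  have hf := hnoz.1
  have hf0 := hnoz.2.2.1
  obtain ⟨hζ, hPX, hX, -⟩ := X_facts hγ hl0 hf hQpc hQpr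
  obtain ⟨hζ', hPX', hX', -⟩ := X_facts hγ hl0 hf hQpc' hQpr'
  have hcs := cstar_pos hγ
  have hM2 : 0 < M2 := by linarith
  have hmm : m ∈ Icc 0 m := ⟨hm.le, le_rfl⟩
  have hcore : ∀ p ∈ Icc (0 : ℝ) (min (zetaP f Qp l) (zetaP f Qp' l)) ×ˢ Icc (0 : ℝ) m,
      Q p = Q' p := by
    have hTl := min_le_left (zetaP f Qp l) (zetaP f Qp' l)
    have hTr := min_le_right (zetaP f Qp l) (zetaP f Qp' l)
    have hT : 0 < min (zetaP f Qp l) (zetaP f Qp' l) := lt_min hζ hζ'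
    generalize min (zetaP f Qp l) (zetaP f Qp' l) = T at *
    obtain ⟨Θ, h, hΘ⟩ := mk_SolF hγ hm hlam hl0 hf hf0 hM1 hM12 hQpc hQpr hsol hcomp hest hTl
    obtain ⟨Θ', h', hΘ'⟩ := mk_SolF hγ hm hlam hl0 hf hf0 hM1 hM12 hQpc' hQpr' hsol' hcomp' hest' hTr
    have hS : 0 ≤ M2 * T ^ (lamp + 2) := by positivity
    obtain ⟨C, hC, hqK⟩ := q_K hγ hS
    have hrange : ∀ {Q Θ : ℝ × ℝ → ℝ}, SolF γ m lamp M1 M2 T Q Θ → ∀ r ∈ Icc 0 T,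
        Q (r, m) ∈ Icc (-(M2 * T ^ (lamp + 2))) 0 := by
      intro Q Θ h r hr
      refine ⟨?_, h.nonpos hM1 (p := (r, m)) ⟨hr, hmm⟩⟩
      have h1 := (h.bd (r, m) ⟨hr, hmm⟩).1
      have h2 : r ^ (lamp + 2) ≤ T ^ (lamp + 2) := Real.rpow_le_rpow hr.1 hr.2 (by linarith)
      have h3 := mul_le_mul_of_nonneg_left h2 hM2.le
      simp only at h1
      linarith
    have hδ2 : 0 < δ2 := by linarith
    refine uniq_core h h' hγ hlam hm hM1 hM12 hT (B := δ2 * (1 / cstar γ) ^ lamp * C)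
      (by positivity) ?_
    intro s hs
    have hsl : s ∈ Icc 0 (zetaP f Qp l) := ⟨hs.1, hs.2.trans hTl⟩
    have hsr : s ∈ Icc 0 (zetaP f Qp' l) := ⟨hs.1, hs.2.trans hTr⟩
    have x1 := X_diff hγ hl0 hf hf0 hQpc hQpc' hQpr hQpr' hcomp hcomp' hsl hsr
    obtain ⟨u1, -, u3⟩ := hX s hsl
    obtain ⟨v1, -, v3⟩ := hX' s hsr
    have hIs : Icc 0 s ⊆ Icc 0 T := Icc_subset_Icc_right hs.2
    have i1 := ii_of_cont hs.1 ((h.contI hγ hM1 hm).mono hIs)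
    have i2 := ii_of_cont hs.1 ((h'.contI hγ hM1 hm).mono hIs)
    obtain ⟨-, c2, -⟩ := h.contE h' hγ hM1
    have i3 := ii_of_cont hs.1 (((cont_line_y c2 hmm).mono hIs).abs)
    have x2 : |(∫ r in (0:ℝ)..s, 1 / AplusInv γ (Q (r, m))) -
        ∫ r in (0:ℝ)..s, 1 / AplusInv γ (Q' (r, m))| ≤
        C * ∫ r in (0:ℝ)..s, |vF γ Q Q' (r, m)| := by
      rw [← intervalIntegral.integral_sub i1 i2, ← intervalIntegral.integral_const_mul,
        ← Real.norm_eq_abs]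
      apply intervalIntegral.norm_integral_le_of_norm_le hs.1 _ (i3.const_mul C)
      refine ae_of_all _ fun r hr => ?_
      have hr' : r ∈ Icc 0 T := ⟨hr.1.le, hr.2.trans hs.2⟩
      have := hqK _ (hrange h r hr') _ (hrange h' r hr')
      rw [abs_sub_comm (Kfun γ _)] at this
      exact this
    have x3 := ThP_lip hδ1 hδ2.le (by linarith : 0 < lamp) hnoz u1 v1 (z := s * (1 / cstar γ))
      (by rw [mul_one_div, le_div_iff₀ hcs]; linarith)
      (by rw [mul_one_div, le_div_iff₀ hcs]; linarith)
    have x4 : (s * (1 / cstar γ)) ^ lamp = s ^ lamp * (1 / cstar γ) ^ lamp :=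
      Real.mul_rpow hs.1 (by positivity)
    rw [x4] at x3
    simp only [wF]
    rw [hΘ s hs, hΘ' s hs]
    have hs0 := hs.1
    calc _ ≤ _ := x3
      _ ≤ δ2 * (s ^ lamp * (1 / cstar γ) ^ lamp) * (C * ∫ r in (0:ℝ)..s, |vF γ Q Q' (r, m)|) :=
        mul_le_mul_of_nonneg_left (x1.trans x2) (by positivity)
      _ = _ := by ring
  rcases le_total (zetaP f Qp l) (zetaP f Qp' l) with hle | hle
  · rw [min_eq_left hle] at hcore ⊢
    obtain ⟨g1, g2⟩ := final_step hγ hm hl0 hf hf0 hQpc hQpc' hQpr hQpr' hcomp hcomp' hle hcore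
    exact ⟨hcore, g1, g2, hcore⟩
  · rw [min_eq_right hle] at hcore ⊢
    obtain ⟨g1, g2⟩ := final_step hγ hm hl0 hf hf0 hQpc' hQpc hQpr' hQpr hcomp' hcomp hle
      (fun p hp => (hcore p hp).symm)
    refine ⟨hcore, fun x hx => (g1 x hx).symm, g2.symm, ?_⟩
    rw [← g2]
    exact hcore
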